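/- arXiv:2112.02703 — 4 statements merged into one kernel-verified Lean document; each statement's English description precedes it below -/
import Mathlib

section
/- Let D_a and D_b be two different chord diagrams in CD_{n,k}, let Z ∈ Mat_{n×(k+4)}(ℝ) be positive, and let C_a and C_b be domino matrices of D_a and D_b respectively, each satisfying the sign rules of its own diagram. Then the row spaces of C_a·Z and C_b·Z in ℝ^{k+4} are different. (Equivalently: the images Z̃(S_{D_a}) and Z̃(S_{D_b}) of two different BCFW cells are disjoint, for every positive Z.) -/
open scoped Classical

noncomputable section

/-- A rectangular `n × r` matrix (with `r ≤ n`) is *positive* if all of its maximal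
`r × r` minors (rows selected in increasing order) have positive determinant. -/
def IsPositiveMatrix {n r : ℕ} (Z : Matrix (Fin n) (Fin r) ℝ) : Prop :=
  ∀ f : Fin r → Fin n, StrictMono f → 0 < (Z.submatrix f id).det

/-- A `k × n` matrix is *totally nonnegative* if all of its `k × k` minors
(columns selected in increasing order) have nonnegative determinant. -/
def IsTotallyNonnegRect {k n : ℕ} (C : Matrix (Fin k) (Fin n) ℝ) : Prop :=
  ∀ g : Fin k → Fin n, StrictMono g → 0 ≤ (C.submatrix id g).det

/-- The row of `Z` whose (1-based) marker is `p`, i.e. the row with index `p - 1`. -/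
def markerRow {n r : ℕ} (Z : Matrix (Fin n) (Fin r) ℝ) (p : ℕ) : Fin r → ℝ :=
  if h : p - 1 < n then Z ⟨p - 1, h⟩ else 0

/-- The twistor coordinate `⟨Y a₁ a₂ a₃ a₄⟩`: the determinant of the `(k+4) × (k+4)` matrix
whose rows are the `k` rows of `Y` followed by the rows of `Z` with (1-based) markers
`a 0, a 1, a 2, a 3`. -/
def twistor {n k : ℕ} (Z : Matrix (Fin n) (Fin (k + 4)) ℝ)
    (Y : Matrix (Fin k) (Fin (k + 4)) ℝ) (a : Fin 4 → ℕ) : ℝ :=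
  ((Matrix.fromRows Y (Matrix.of fun t => markerRow Z (a t))).submatrix
    (⇑finSumFinEquiv.symm) id).det

/-- The row space of a matrix: the span of its rows. -/
def rowSpace {k n : ℕ} (A : Matrix (Fin k) (Fin n) ℝ) : Submodule ℝ (Fin n → ℝ) :=
  Submodule.span ℝ (Set.range fun r => A r)

/-- The minor of `A` on the set of rows `S` (taken in increasing order), using all columns;
defined to be `0` if `S` does not have the right cardinality. -/
def rowMinor {N r : ℕ} (A : Matrix (Fin N) (Fin r) ℝ) (S : Finset (Fin N)) : ℝ :=
  if h : S.card = r then (A.submatrix (fun t => (S.orderIsoOfFin h t).1) id).det else 0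

/-- The minor of `C` on the set of columns `J` (taken in increasing order), using all rows;
defined to be `0` if `J` does not have the right cardinality. -/
def colMinor {k N : ℕ} (C : Matrix (Fin k) (Fin N) ℝ) (J : Finset (Fin N)) : ℝ :=
  if h : J.card = k then (C.submatrix id (fun t => (J.orderIsoOfFin h t).1)).det else 0


/-- A chord diagram with `n` markers (labelled `1, …, n`) and `k` chords
`c_l = (tail l, tail l + 1, head l, head l + 1)`. -/
structure ChordDiagram (n k : ℕ) where
  tail : Fin k → ℕ
  head : Fin k → ℕ
  one_le_tail : ∀ l, 1 ≤ tail l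
  tail_add_two_le_head : ∀ l, tail l + 2 ≤ head l
  head_add_two_le : ∀ l, head l + 2 ≤ n
  tail_strictMono : StrictMono tail
  noncrossing : ∀ l m : Fin k, l < m → ¬(tail m < head l ∧ head l < head m)

namespace ChordDiagram

variable {n k : ℕ} (D : ChordDiagram n k)

/-- `c_m` is a descendant of `c_l`. -/
def Descendant (l m : Fin k) : Prop := D.tail l < D.tail m ∧ D.head m ≤ D.head l

/-- The number of descendants of `c_l`. -/
def below (l : Fin k) : ℕ := (Finset.univ.filter fun m => D.Descendant l m).card

/-- `c_l` is a top chord: it has no ancestor. -/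
def IsTop (l : Fin k) : Prop := ∀ m, ¬ D.Descendant m l

/-- `c_m` is the parent of `c_l`: the ancestor of `c_l` with the largest start. -/
def IsParent (m l : Fin k) : Prop :=
  D.Descendant m l ∧ ∀ m', D.Descendant m' l → D.tail m' ≤ D.tail m

/-- The number of chords starting after the start of `c_l` (equals `k - l` for the
`l`-th chord in the 1-based start-increasing ordering). -/
def behind (l : Fin k) : ℕ := (Finset.univ.filter fun m => D.tail l < D.tail m).card

/-- The number of descendants of `c_m` (the parent of `c_l`) that come before `c_l`
(equals `l - m - 1` in the 1-based start-increasing ordering). -/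
def beyond (l m : Fin k) : ℕ :=
  (Finset.univ.filter fun h => D.Descendant m h ∧ D.tail h < D.tail l).card

/-- The domino matrix of `D` with variables `α, β, γ, δ, ε` : the column with (0-based)
index `a` corresponds to the (1-based) marker `a + 1`. -/
def dominoMatrix (α β γ δ ε : Fin k → ℝ) : Matrix (Fin k) (Fin n) ℝ :=
  Matrix.of fun l a =>
    (if (a : ℕ) + 1 = D.tail l then α l else 0) +
    (if (a : ℕ) + 1 = D.tail l + 1 then β l else 0) +
    (if (a : ℕ) + 1 = D.head l then γ l else 0) +
    (if (a : ℕ) + 1 = D.head l + 1 then δ l else 0) +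
    (if D.IsTop l ∧ (a : ℕ) + 1 = n then ε l else 0) +
    (∑ m : Fin k, if D.IsParent m l then
        (if (a : ℕ) + 1 = D.tail m then ε l * α m else 0) +
        (if (a : ℕ) + 1 = D.tail m + 1 then ε l * β m else 0)
      else 0)

/-- The sign rules for the domino variables of `D`. -/
def SignRules (α β γ δ ε : Fin k → ℝ) : Prop :=
  (∀ l, 0 < α l) ∧ (∀ l, 0 < β l) ∧
  (∀ l, 0 < (-1 : ℝ) ^ D.below l * γ l) ∧
  (∀ l, 0 < (-1 : ℝ) ^ D.below l * δ l) ∧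
  (∀ l, D.IsTop l → 0 < (-1 : ℝ) ^ D.behind l * ε l) ∧
  (∀ l m, D.IsParent m l → 0 < (-1 : ℝ) ^ D.beyond l m * ε l) ∧
  (∀ l m, D.IsParent m l → D.head l = D.head m → δ l / γ l < δ m / γ m) ∧
  (∀ l m, D.head m = D.tail l → δ m / γ m < β l / α l)

end ChordDiagram


namespace Bcfw

variable {V : Type*} [AddCommGroup V] [Module ℝ V]

/-- The exterior product of a list of vectors. -/
def wedge (l : List V) : ExteriorAlgebra ℝ V := (l.map (ExteriorAlgebra.ι ℝ)).prod

@[simp] lemma wedge_nil : wedge ([] : List V) = 1 := rfl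

@[simp] lemma wedge_cons (v : V) (l : List V) :
    wedge (v :: l) = ExteriorAlgebra.ι ℝ v * wedge l := by simp [wedge]

@[simp] lemma wedge_append (l l' : List V) : wedge (l ++ l') = wedge l * wedge l' := by
  simp [wedge]

lemma ι_mul_ι_comm (u v : V) :
    ExteriorAlgebra.ι ℝ u * ExteriorAlgebra.ι ℝ v =
      -(ExteriorAlgebra.ι ℝ v * ExteriorAlgebra.ι ℝ u) :=
  eq_neg_of_add_eq_zero_left (ExteriorAlgebra.ι_add_mul_swap u v)

lemma wedge_mul_ι (l : List V) (v : V) :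
    wedge l * ExteriorAlgebra.ι ℝ v =
      (-1 : ℝ) ^ l.length • (ExteriorAlgebra.ι ℝ v * wedge l) := by
  induction l with
  | nil => simp
  | cons u l ih =>
    rw [wedge_cons, mul_assoc, ih, mul_smul_comm, ← mul_assoc, ι_mul_ι_comm, List.length_cons,
      pow_succ]
    simp [mul_assoc]

lemma ι_mul_wedge (l : List V) (v : V) :
    ExteriorAlgebra.ι ℝ v * wedge l =
      (-1 : ℝ) ^ l.length • (wedge l * ExteriorAlgebra.ι ℝ v) := by
  rw [wedge_mul_ι, smul_smul, ← mul_pow]; simp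

lemma commute_pair_wedge (u v : V) (l : List V) :
    Commute (ExteriorAlgebra.ι ℝ u * ExteriorAlgebra.ι ℝ v) (wedge l) := by
  rw [commute_iff_eq, mul_assoc, ι_mul_wedge, mul_smul_comm, ← mul_assoc, ι_mul_wedge,
    smul_mul_assoc, smul_smul, ← mul_pow]
  simp [mul_assoc]

lemma wedge_mul_ι_of_mem {l : List V} {v : V} (h : v ∈ l) :
    wedge l * ExteriorAlgebra.ι ℝ v = 0 := by
  obtain ⟨s, t, rfl⟩ := List.append_of_mem h
  rw [wedge_append, wedge_cons, mul_assoc, mul_assoc, wedge_mul_ι, mul_smul_comm, ← mul_assoc,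
    ExteriorAlgebra.ι_sq_zero]
  simp

lemma ι_mul_wedge_of_mem {l : List V} {v : V} (h : v ∈ l) :
    ExteriorAlgebra.ι ℝ v * wedge l = 0 := by
  rw [ι_mul_wedge, wedge_mul_ι_of_mem h, smul_zero]

/-- The exterior monomial of the vectors `z x`, `x ∈ L`. -/
def mon (z : ℕ → V) (L : List ℕ) : ExteriorAlgebra ℝ V := wedge (L.map z)

@[simp] lemma mon_nil (z : ℕ → V) : mon z [] = 1 := rfl

@[simp] lemma mon_cons (z : ℕ → V) (i : ℕ) (L : List ℕ) :
    mon z (i :: L) = ExteriorAlgebra.ι ℝ (z i) * mon z L := by simp [mon]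

@[simp] lemma mon_append (z : ℕ → V) (L L' : List ℕ) :
    mon z (L ++ L') = mon z L * mon z L' := by simp [mon]

lemma mon_congr {z z' : ℕ → V} {L : List ℕ} (h : ∀ x ∈ L, z x = z' x) : mon z L = mon z' L := by
  rw [mon, mon, List.map_congr_left h]

/-- `L` is a strictly increasing list of `m` markers from `S`. -/
def Admissible (S : Set ℕ) (m : ℕ) (L : List ℕ) : Prop :=
  L.Pairwise (· < ·) ∧ (∀ x ∈ L, x ∈ S) ∧ L.length = m

lemma Admissible.mono {S T : Set ℕ} {m : ℕ} {L : List ℕ} (h : Admissible S m L) (hST : S ⊆ T) :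
    Admissible T m L := ⟨h.1, fun x hx => hST (h.2.1 x hx), h.2.2⟩

lemma Admissible.append {S T : Set ℕ} {m m' : ℕ} {L L' : List ℕ} (h : Admissible S m L)
    (h' : Admissible T m' L') (hST : ∀ x ∈ S, ∀ y ∈ T, x < y) :
    Admissible (S ∪ T) (m + m') (L ++ L') := by
  refine ⟨List.pairwise_append.2 ⟨h.1, h'.1, fun x hx y hy => hST x (h.2.1 x hx) y (h'.2.1 y hy)⟩,
    fun x hx => ?_, by simp [h.2.2, h'.2.2]⟩
  rcases List.mem_append.1 hx with hx | hx
  exacts [Or.inl (h.2.1 x hx), Or.inr (h'.2.1 x hx)]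

lemma Admissible.append_top {S : Set ℕ} {m i : ℕ} {L : List ℕ} (h : Admissible S m L)
    (hi : i ∈ S) (hmax : ∀ x ∈ S, x ≤ i) (hL : i ∉ L) : Admissible S (m + 1) (L ++ [i]) := by
  refine ⟨List.pairwise_append.2 ⟨h.1, by simp, fun x hx y hy => ?_⟩, fun x hx => ?_,
    by simp [h.2.2]⟩
  · rw [List.mem_singleton] at hy
    subst hy
    exact lt_of_le_of_ne (hmax x (h.2.1 x hx)) (by rintro rfl; exact hL hx)
  · rcases List.mem_append.1 hx with hx | hx
    · exact h.2.1 x hx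
    · rw [List.mem_singleton] at hx; exact hx ▸ hi

lemma Admissible.cons_bot {S : Set ℕ} {m i : ℕ} {L : List ℕ} (h : Admissible S m L)
    (hi : i ∈ S) (hmin : ∀ x ∈ S, i ≤ x) (hL : i ∉ L) : Admissible S (m + 1) (i :: L) := by
  refine ⟨List.pairwise_cons.2 ⟨fun x hx => ?_, h.1⟩, fun x hx => ?_, by simp [h.2.2]⟩
  · exact lt_of_le_of_ne (hmin x (h.2.1 x hx)) (by rintro rfl; exact hL hx)
  · rcases List.mem_cons.1 hx with rfl | hx
    exacts [hi, h.2.1 x hx]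

/-- An increasing list in `[l, h + 1]` either avoids `h + 1` or ends with it. -/
lemma Admissible.split_top {l h m : ℕ} {L : List ℕ} (hL : Admissible (Set.Icc l (h + 1)) m L) :
    ∃ L' e, e ≤ 1 ∧ Admissible (Set.Icc l h) L'.length L' ∧ L = L' ++ List.replicate e (h + 1) := by
  rcases List.eq_nil_or_concat L with rfl | ⟨L', x, rfl⟩
  · exact ⟨[], 0, by simp, ⟨by simp, by simp, rfl⟩, by simp⟩
  · obtain ⟨h1, h2, -⟩ := hL
    rw [List.concat_eq_append] at h1 h2 ⊢
    obtain ⟨h1a, -, h1b⟩ := List.pairwise_append.1 h1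
    have hx := h2 x (by simp)
    rcases hx.2.lt_or_eq with hlt | rfl
    · refine ⟨L' ++ [x], 0, by simp, ⟨h1, fun y hy => ⟨(h2 y hy).1, ?_⟩, rfl⟩, by simp⟩
      rcases List.mem_append.1 hy with hy | hy
      · have := h1b y hy x (by simp); omega
      · rw [List.mem_singleton] at hy; omega
    · refine ⟨L', 1, le_rfl, ⟨h1a, fun y hy => ⟨(h2 y (by simp [hy])).1, ?_⟩, rfl⟩, by simp⟩
      have := h1b y hy _ (List.mem_singleton_self _); omega

/-- The convex cone of the increasing exterior monomials of degree `m` in the vectors `z x`,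
`x ∈ S`. -/
def cone (z : ℕ → V) (S : Set ℕ) (m : ℕ) : PointedCone ℝ (ExteriorAlgebra ℝ V) :=
  PointedCone.hull ℝ {u | ∃ L, Admissible S m L ∧ u = mon z L}

lemma smul_mem_cone {C : PointedCone ℝ (ExteriorAlgebra ℝ V)} {u : ExteriorAlgebra ℝ V} {c : ℝ}
    (hc : 0 ≤ c) (hu : u ∈ C) : c • u ∈ C := C.smul_mem hc hu

variable {z : ℕ → V} {S T : Set ℕ} {m m' : ℕ} {u v r : ExteriorAlgebra ℝ V} {J J' L : List ℕ}

lemma mon_mem_cone (h : Admissible S m L) : mon z L ∈ cone z S m :=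
  Submodule.subset_span ⟨L, h, rfl⟩

lemma map_mem_of_mem_cone (f : ExteriorAlgebra ℝ V →ₗ[ℝ] ExteriorAlgebra ℝ V)
    {C : PointedCone ℝ (ExteriorAlgebra ℝ V)} (h : ∀ L, Admissible S m L → f (mon z L) ∈ C)
    (hu : u ∈ cone z S m) : f u ∈ C := by
  have : cone z S m ≤ PointedCone.comap f C := by
    refine Submodule.span_le.2 ?_
    rintro _ ⟨L, hL, rfl⟩
    exact h L hL
  exact this hu

lemma cone_mono (h : S ⊆ T) : cone z S m ≤ cone z T m :=
  Submodule.span_mono fun _ ⟨L, hL, hu⟩ => ⟨L, hL.mono h, hu⟩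

lemma nonneg_of_mem_cone {φ : ExteriorAlgebra ℝ V →ₗ[ℝ] ℝ}
    (h : ∀ L, Admissible S m L → 0 ≤ φ (mon z L)) (hu : u ∈ cone z S m) : 0 ≤ φ u := by
  induction hu using Submodule.span_induction with
  | mem x hx => obtain ⟨L, hL, rfl⟩ := hx; exact h L hL
  | zero => simp
  | add x y _ _ hx hy => rw [map_add]; exact add_nonneg hx hy
  | smul c x _ hx =>
    change 0 ≤ φ ((c : ℝ) • x)
    rw [map_smul]
    exact mul_nonneg c.2 hx

lemma mul_mem_of_mem_cone {w : ExteriorAlgebra ℝ V} {C : PointedCone ℝ (ExteriorAlgebra ℝ V)}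
    (h : ∀ L, Admissible S m L → mon z L * w ∈ C) (hu : u ∈ cone z S m) : u * w ∈ C :=
  map_mem_of_mem_cone (LinearMap.mulRight ℝ w) h hu

lemma mul_mem_of_mem_cone_right {w : ExteriorAlgebra ℝ V}
    {C : PointedCone ℝ (ExteriorAlgebra ℝ V)}
    (h : ∀ L, Admissible S m L → w * mon z L ∈ C) (hu : u ∈ cone z S m) : w * u ∈ C :=
  map_mem_of_mem_cone (LinearMap.mulLeft ℝ w) h hu

lemma mul_mem_cone (hST : ∀ x ∈ S, ∀ y ∈ T, x < y) (hu : u ∈ cone z S m)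
    (hv : v ∈ cone z T m') : u * v ∈ cone z (S ∪ T) (m + m') :=
  mul_mem_of_mem_cone (fun L hL => mul_mem_of_mem_cone_right (fun L' hL' => by
    rw [← mon_append]; exact mon_mem_cone (hL.append hL' hST)) hv) hu

lemma mul_top_mem_cone {i : ℕ} (hi : i ∈ S) (hmax : ∀ x ∈ S, x ≤ i) (hu : u ∈ cone z S m) :
    u * ExteriorAlgebra.ι ℝ (z i) ∈ cone z S (m + 1) := by
  refine mul_mem_of_mem_cone (fun L hL => ?_) hu
  by_cases hiL : i ∈ L
  · rw [mon, wedge_mul_ι_of_mem (List.mem_map_of_mem hiL)]; exact zero_mem _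
  · have : mon z L * ExteriorAlgebra.ι ℝ (z i) = mon z (L ++ [i]) := by simp
    rw [this]
    exact mon_mem_cone (hL.append_top hi hmax hiL)

lemma bot_mul_mem_cone {i : ℕ} (hi : i ∈ S) (hmin : ∀ x ∈ S, i ≤ x) (hu : u ∈ cone z S m) :
    ExteriorAlgebra.ι ℝ (z i) * u ∈ cone z S (m + 1) := by
  refine mul_mem_of_mem_cone_right (fun L hL => ?_) hu
  by_cases hiL : i ∈ L
  · rw [mon, ι_mul_wedge_of_mem (List.mem_map_of_mem hiL)]; exact zero_mem _
  · rw [← mon_cons]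
    exact mon_mem_cone (hL.cons_bot hi hmin hiL)

/-- `u` lies in the cone of `S` and the monomial of `J` occurs in it with positive weight. -/
def Dominates (z : ℕ → V) (S : Set ℕ) (m : ℕ) (J : List ℕ) (u : ExteriorAlgebra ℝ V) : Prop :=
  Admissible S m J ∧ ∃ p : ℝ, 0 < p ∧ ∃ r ∈ cone z S m, u = p • mon z J + r

lemma Dominates.mem (h : Dominates z S m J u) : u ∈ cone z S m := by
  obtain ⟨hJ, p, hp, r, hr, rfl⟩ := h
  exact add_mem (smul_mem_cone hp.le (mon_mem_cone hJ)) hr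

lemma dominates_mon (h : Admissible S m J) : Dominates z S m J (mon z J) :=
  ⟨h, 1, one_pos, 0, zero_mem _, by simp⟩

lemma Dominates.add_right (h : Dominates z S m J u) (hr : r ∈ cone z S m) :
    Dominates z S m J (u + r) := by
  obtain ⟨hJ, p, hp, s, hs, rfl⟩ := h
  exact ⟨hJ, p, hp, s + r, add_mem hs hr, by rw [add_assoc]⟩

lemma Dominates.add_left (h : Dominates z S m J u) (hr : r ∈ cone z S m) :
    Dominates z S m J (r + u) := add_comm u r ▸ h.add_right hr

lemma Dominates.smul (h : Dominates z S m J u) {c : ℝ} (hc : 0 < c) :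
    Dominates z S m J (c • u) := by
  obtain ⟨hJ, p, hp, s, hs, rfl⟩ := h
  exact ⟨hJ, c * p, mul_pos hc hp, c • s, smul_mem_cone hc.le hs, by rw [smul_add, smul_smul]⟩

lemma Dominates.mono (h : Dominates z S m J u) (hST : S ⊆ T) : Dominates z T m J u := by
  obtain ⟨hJ, p, hp, s, hs, rfl⟩ := h
  exact ⟨hJ.mono hST, p, hp, s, cone_mono hST hs, rfl⟩

lemma Dominates.mul (h : Dominates z S m J u) (h' : Dominates z T m' J' v)
    (hST : ∀ x ∈ S, ∀ y ∈ T, x < y) : Dominates z (S ∪ T) (m + m') (J ++ J') (u * v) := by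
  have hv := h'.mem
  obtain ⟨hJ, p, hp, s, hs, rfl⟩ := h
  obtain ⟨hJ', p', hp', s', hs', rfl⟩ := h'
  refine ⟨hJ.append hJ' hST, p * p', mul_pos hp hp',
    p • (mon z J * s') + s * (p' • mon z J' + s'),
    add_mem (smul_mem_cone hp.le (mul_mem_cone hST (mon_mem_cone hJ) hs'))
      (mul_mem_cone hST hs hv), ?_⟩
  simp only [add_mul, mul_add, smul_mul_assoc, mul_smul_comm, mon_append, smul_add]
  module

lemma Dominates.mul_top {i : ℕ} (h : Dominates z S m J u) (hi : i ∈ S) (hmax : ∀ x ∈ S, x ≤ i)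
    (hJi : i ∉ J) : Dominates z S (m + 1) (J ++ [i]) (u * ExteriorAlgebra.ι ℝ (z i)) := by
  obtain ⟨hJ, p, hp, s, hs, rfl⟩ := h
  exact ⟨hJ.append_top hi hmax hJi, p, hp, _, mul_top_mem_cone hi hmax hs,
    by simp [add_mul]⟩

lemma Dominates.bot_mul {i : ℕ} (h : Dominates z S m J u) (hi : i ∈ S) (hmin : ∀ x ∈ S, i ≤ x)
    (hJi : i ∉ J) : Dominates z S (m + 1) (i :: J) (ExteriorAlgebra.ι ℝ (z i) * u) := by
  obtain ⟨hJ, p, hp, s, hs, rfl⟩ := h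
  exact ⟨hJ.cons_bot hi hmin hJi, p, hp, _, bot_mul_mem_cone hi hmin hs,
    by simp [mul_add]⟩

lemma Dominates.pos {φ : ExteriorAlgebra ℝ V →ₗ[ℝ] ℝ} (h : Dominates z S m J u)
    (hφ : ∀ L, Admissible S m L → 0 ≤ φ (mon z L)) (hJ : 0 < φ (mon z J)) : 0 < φ u := by
  obtain ⟨-, p, hp, s, hs, rfl⟩ := h
  have := nonneg_of_mem_cone hφ hs
  have := mul_pos hp hJ
  simp only [map_add, map_smul, smul_eq_mul]
  linarith

/-- Markers in `[l, h]` together with the last marker `N`. -/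
def markers (l h N : ℕ) : Set ℕ := {x | l ≤ x ∧ (x ≤ h ∨ x = N)}

/-- The vectors seen by the part of a diagram to the left of a top chord starting at `a`. -/
def leftVec (z : ℕ → V) (a N : ℕ) (ρ s : ℝ) : ℕ → V :=
  Function.update (Function.update z (a + 1) (z a + ρ • z (a + 1))) (a + 2) (-s • z N)

/-- The vectors seen by the part of a diagram below a top chord ending at `c`. -/
def rightVec (z : ℕ → V) (c N : ℕ) (ρ σ : ℝ) : ℕ → V :=
  Function.update (Function.update z (c + 1) (z c + ρ • z (c + 1))) (c + 2)
    (z c + ρ • z (c + 1) + σ • z N)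

section vectors

variable (z : ℕ → V) (a N : ℕ) (ρ s : ℝ)

lemma leftVec_of_le {i : ℕ} (h : i ≤ a) : leftVec z a N ρ s i = z i := by
  rw [leftVec, Function.update_of_ne (by omega), Function.update_of_ne (by omega)]

@[simp] lemma leftVec_add_one : leftVec z a N ρ s (a + 1) = z a + ρ • z (a + 1) := by
  rw [leftVec, Function.update_of_ne (by omega), Function.update_self]

@[simp] lemma leftVec_add_two : leftVec z a N ρ s (a + 2) = -s • z N := by
  rw [leftVec, Function.update_self]

lemma rightVec_of_le {i : ℕ} (h : i ≤ a) : rightVec z a N ρ s i = z i := by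
  rw [rightVec, Function.update_of_ne (by omega), Function.update_of_ne (by omega)]

@[simp] lemma rightVec_add_one : rightVec z a N ρ s (a + 1) = z a + ρ • z (a + 1) := by
  rw [rightVec, Function.update_of_ne (by omega), Function.update_self]

@[simp] lemma rightVec_add_two :
    rightVec z a N ρ s (a + 2) = z a + ρ • z (a + 1) + s • z N := by
  rw [rightVec, Function.update_self]

end vectors

lemma ι_pow_eq_zero (x : V) {i : ℕ} (hi : 2 ≤ i) : ExteriorAlgebra.ι ℝ x ^ i = 0 := by
  obtain ⟨j, rfl⟩ := Nat.exists_eq_add_of_le hi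
  rw [pow_add, pow_two, ExteriorAlgebra.ι_sq_zero, zero_mul]

lemma mon_replicate (z : ℕ → V) (e i : ℕ) :
    mon z (List.replicate e i) = ExteriorAlgebra.ι ℝ (z i) ^ e := by
  induction e with
  | zero => simp
  | succ e ih => rw [List.replicate_succ, mon_cons, ih, pow_succ']

section merge

variable {lo a c N m₁ m₂ : ℕ} {ρ σ : ℝ} {w : ExteriorAlgebra ℝ V} {J₁ J₂ : List ℕ}

lemma Icc_union_subset (hac : a + 1 ≤ c) (hlo : lo ≤ a) :
    Set.Icc lo a ∪ Set.Icc (a + 1) c ⊆ Set.Icc lo c := by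
  rintro x (hx | hx) <;> simp only [Set.mem_Icc] at * <;> omega

lemma mul_mem_cone_Icc (hac : a + 1 ≤ c) (hlo : lo ≤ a) (hu : u ∈ cone z (Set.Icc lo a) m₁)
    (hw : w ∈ cone z (Set.Icc (a + 1) c) m₂) : u * w ∈ cone z (Set.Icc lo c) (m₁ + m₂) :=
  cone_mono (Icc_union_subset hac hlo)
    (mul_mem_cone (fun x hx y hy => by simp only [Set.mem_Icc] at *; omega) hu hw)

lemma Dominates.mul_Icc (hac : a + 1 ≤ c) (hlo : lo ≤ a)
    (hu : Dominates z (Set.Icc lo a) m₁ J₁ u)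
    (hw : Dominates z (Set.Icc (a + 1) c) m₂ J₂ w) :
    Dominates z (Set.Icc lo c) (m₁ + m₂) (J₁ ++ J₂) (u * w) :=
  (hu.mul hw (fun x hx y hy => by simp only [Set.mem_Icc] at *; omega)).mono
    (Icc_union_subset hac hlo)

lemma ι_left_expand (u w : ExteriorAlgebra ℝ V) (p q : V) (ρ : ℝ) :
    u * ExteriorAlgebra.ι ℝ (p + ρ • q) * w =
      u * ExteriorAlgebra.ι ℝ p * w + ρ • (u * (ExteriorAlgebra.ι ℝ q * w)) := by
  simp [mul_add, add_mul, mul_assoc]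

lemma left_merge_mem (hac : a + 1 ≤ c) (hlo : lo ≤ a) (hρ : 0 ≤ ρ)
    (hu : u ∈ cone z (Set.Icc lo a) m₁) (hw : w ∈ cone z (Set.Icc (a + 1) c) m₂) (i : ℕ) :
    u * ExteriorAlgebra.ι ℝ (z a + ρ • z (a + 1)) ^ i * w ∈
      cone z (Set.Icc lo c) (m₁ + i + m₂) := by
  rcases Nat.lt_or_ge i 2 with hi | hi
  · interval_cases i
    · simpa using mul_mem_cone_Icc hac hlo hu hw
    · rw [pow_one, ι_left_expand]
      refine add_mem (mul_mem_cone_Icc hac hlo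
        (mul_top_mem_cone ⟨hlo, le_rfl⟩ (fun x hx => hx.2) hu) hw) (smul_mem_cone hρ ?_)
      rw [show m₁ + 1 + m₂ = m₁ + (m₂ + 1) by ring]
      exact mul_mem_cone_Icc hac hlo hu (bot_mul_mem_cone ⟨le_rfl, hac⟩ (fun x hx => hx.1) hw)
  · rw [ι_pow_eq_zero _ hi]; simp

lemma left_merge_dominates_fst (hac : a + 1 ≤ c) (hlo : lo ≤ a) (hρ : 0 ≤ ρ)
    (hu : Dominates z (Set.Icc lo a) m₁ J₁ u) (hw : Dominates z (Set.Icc (a + 1) c) m₂ J₂ w)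
    (ha : a ∉ J₁) :
    Dominates z (Set.Icc lo c) (m₁ + 1 + m₂) (J₁ ++ [a] ++ J₂)
      (u * ExteriorAlgebra.ι ℝ (z a + ρ • z (a + 1)) * w) := by
  rw [ι_left_expand]
  refine ((hu.mul_top ⟨hlo, le_rfl⟩ (fun x hx => hx.2) ha).mul_Icc hac hlo hw).add_right
    (smul_mem_cone hρ ?_)
  rw [show m₁ + 1 + m₂ = m₁ + (m₂ + 1) by ring]
  exact mul_mem_cone_Icc hac hlo hu.mem
    (bot_mul_mem_cone ⟨le_rfl, hac⟩ (fun x hx => hx.1) hw.mem)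

lemma left_merge_dominates_snd (hac : a + 1 ≤ c) (hlo : lo ≤ a) (hρ : 0 < ρ)
    (hu : Dominates z (Set.Icc lo a) m₁ J₁ u) (hw : Dominates z (Set.Icc (a + 1) c) m₂ J₂ w)
    (ha : a + 1 ∉ J₂) :
    Dominates z (Set.Icc lo c) (m₁ + 1 + m₂) (J₁ ++ (a + 1) :: J₂)
      (u * ExteriorAlgebra.ι ℝ (z a + ρ • z (a + 1)) * w) := by
  rw [ι_left_expand]
  refine Dominates.add_left (Dominates.smul ?_ hρ) (mul_mem_cone_Icc hac hlo
    (mul_top_mem_cone ⟨hlo, le_rfl⟩ (fun x hx => hx.2) hu.mem) hw.mem)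
  rw [show m₁ + 1 + m₂ = m₁ + (m₂ + 1) by ring]
  exact hu.mul_Icc hac hlo (hw.bot_mul ⟨le_rfl, hac⟩ (fun x hx => hx.1) ha)

lemma Icc_subset_succ : Set.Icc lo c ⊆ Set.Icc lo (c + 1) := fun x hx => by
  simp only [Set.mem_Icc] at *; omega

lemma Icc_subset_markers : Set.Icc lo c ⊆ markers lo c N := fun _ hx => ⟨hx.1, Or.inl hx.2⟩

lemma mul_snd_mem (hlo : lo ≤ c + 1) (hu : u ∈ cone z (Set.Icc lo c) m) :
    u * ExteriorAlgebra.ι ℝ (z (c + 1)) ∈ cone z (Set.Icc lo (c + 1)) (m + 1) :=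
  mul_top_mem_cone ⟨hlo, le_rfl⟩ (fun _ hx => hx.2) (cone_mono Icc_subset_succ hu)

lemma Dominates.mul_snd (hlo : lo ≤ c + 1) (hu : Dominates z (Set.Icc lo c) m J u) :
    Dominates z (Set.Icc lo (c + 1)) (m + 1) (J ++ [c + 1])
      (u * ExteriorAlgebra.ι ℝ (z (c + 1))) :=
  (hu.mono Icc_subset_succ).mul_top ⟨hlo, le_rfl⟩ (fun x hx => hx.2)
    fun h => by have := (hu.1.2.1 _ h).2; omega

lemma mul_fst_mem (hlo : lo ≤ c) (hu : u ∈ cone z (Set.Icc lo c) m) :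
    u * ExteriorAlgebra.ι ℝ (z c) ∈ cone z (Set.Icc lo (c + 1)) (m + 1) :=
  cone_mono Icc_subset_succ (mul_top_mem_cone ⟨hlo, le_rfl⟩ (fun _ hx => hx.2) hu)

lemma mul_last_mem (hlo : lo ≤ c) (hN : c < N) (hu : u ∈ cone z (Set.Icc lo c) m) :
    u * ExteriorAlgebra.ι ℝ (z N) ∈ cone z (markers lo c N) (m + 1) :=
  mul_top_mem_cone ⟨by omega, Or.inr rfl⟩ (fun x hx => by rcases hx.2 with h | h <;> omega)
    (cone_mono Icc_subset_markers hu)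

lemma Dominates.mul_last (hlo : lo ≤ c) (hN : c < N) (hu : Dominates z (Set.Icc lo c) m J u) :
    Dominates z (markers lo c N) (m + 1) (J ++ [N]) (u * ExteriorAlgebra.ι ℝ (z N)) :=
  (hu.mono Icc_subset_markers).mul_top ⟨by omega, Or.inr rfl⟩
    (fun x hx => by rcases hx.2 with h | h <;> omega)
    fun h => by have := (hu.1.2.1 _ h).2; omega

lemma ι_right_expand (u : ExteriorAlgebra ℝ V) (p q : V) (ρ : ℝ) :
    u * ExteriorAlgebra.ι ℝ (p + ρ • q) =
      u * ExteriorAlgebra.ι ℝ p + ρ • (u * ExteriorAlgebra.ι ℝ q) := by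
  simp [mul_add]

lemma mul_pair_mem (hlo : lo ≤ c) (hρ : 0 ≤ ρ) (hu : u ∈ cone z (Set.Icc lo c) m) :
    u * ExteriorAlgebra.ι ℝ (z c + ρ • z (c + 1)) ∈ cone z (Set.Icc lo (c + 1)) (m + 1) := by
  rw [ι_right_expand]
  exact add_mem (mul_fst_mem hlo hu) (smul_mem_cone hρ (mul_snd_mem (by omega) hu))

lemma Dominates.mul_pair (hlo : lo ≤ c) (hρ : 0 < ρ) (hu : Dominates z (Set.Icc lo c) m J u) :
    Dominates z (Set.Icc lo (c + 1)) (m + 1) (J ++ [c + 1])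
      (u * ExteriorAlgebra.ι ℝ (z c + ρ • z (c + 1))) := by
  rw [ι_right_expand]
  exact ((hu.mul_snd (by omega)).smul hρ).add_left (mul_fst_mem hlo hu.mem)

lemma mul_pair_mul_last (u : ExteriorAlgebra ℝ V) (x y : V) (σ : ℝ) :
    u * ExteriorAlgebra.ι ℝ x * ExteriorAlgebra.ι ℝ (x + σ • y) =
      σ • (u * ExteriorAlgebra.ι ℝ x * ExteriorAlgebra.ι ℝ y) := by
  rw [ι_right_expand, mul_assoc u, ExteriorAlgebra.ι_sq_zero, mul_zero, zero_add]

lemma mul_triple_mul_last (u : ExteriorAlgebra ℝ V) (x y : V) (σ : ℝ) :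
    u * ExteriorAlgebra.ι ℝ (x + σ • y) * ExteriorAlgebra.ι ℝ y =
      u * ExteriorAlgebra.ι ℝ x * ExteriorAlgebra.ι ℝ y := by
  rw [ι_right_expand, add_mul, smul_mul_assoc, mul_assoc u (ExteriorAlgebra.ι ℝ y),
    ExteriorAlgebra.ι_sq_zero, mul_zero, smul_zero, add_zero]

lemma right_merge_mem (hlo : lo ≤ c) (hN : c + 1 < N) (hρ : 0 ≤ ρ) (hσ : 0 ≤ σ)
    (hu : u ∈ cone z (Set.Icc lo c) m) (j k l : ℕ) :
    u * ExteriorAlgebra.ι ℝ (z c + ρ • z (c + 1)) ^ j *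
      ExteriorAlgebra.ι ℝ (z c + ρ • z (c + 1) + σ • z N) ^ k * ExteriorAlgebra.ι ℝ (z N) ^ l ∈
      cone z (markers lo (c + 1) N) (m + j + k + l) := by
  rcases Nat.lt_or_ge j 2 with hj | hj
  swap; · rw [ι_pow_eq_zero _ hj]; simp
  rcases Nat.lt_or_ge k 2 with hk | hk
  swap; · rw [ι_pow_eq_zero _ hk]; simp
  rcases Nat.lt_or_ge l 2 with hl | hl
  swap; · rw [ι_pow_eq_zero _ hl]; simp
  have h1 := cone_mono Icc_subset_succ hu
  have h2 := mul_pair_mem hlo hρ hu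
  have h3 := mul_last_mem (by omega) hN h1
  have h4 := mul_last_mem (by omega) hN h2
  have hsub : Set.Icc lo (c + 1) ⊆ markers lo (c + 1) N := Icc_subset_markers
  interval_cases j <;> interval_cases k <;> interval_cases l <;>
    simp only [pow_zero, pow_one, mul_one, add_zero]
  · exact cone_mono hsub h1
  · exact h3
  · rw [ι_right_expand]
    exact add_mem (cone_mono hsub h2) (smul_mem_cone hσ h3)
  · rw [mul_triple_mul_last]
    exact h4
  · exact cone_mono hsub h2
  · exact h4
  · rw [mul_pair_mul_last]
    exact smul_mem_cone hσ h4
  · rw [mul_triple_mul_last, mul_assoc u, ExteriorAlgebra.ι_sq_zero]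
    simp

lemma right_merge_dominates (hlo : lo ≤ c) (hN : c + 1 < N) (hρ : 0 < ρ) (hσ : 0 < σ)
    (hu : Dominates z (Set.Icc lo c) m J u) {j k l : ℕ} (hj : j ≤ 1) (hkl : k + l ≤ 1) :
    Dominates z (markers lo (c + 1) N) (m + j + k + l)
      (J ++ List.replicate j (c + 1) ++ List.replicate (k + l) N)
      (u * ExteriorAlgebra.ι ℝ (z c + ρ • z (c + 1)) ^ j *
        ExteriorAlgebra.ι ℝ (z c + ρ • z (c + 1) + σ • z N) ^ k *
        ExteriorAlgebra.ι ℝ (z N) ^ l) := by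
  have h1 := hu.mono Icc_subset_succ
  have h2 := hu.mul_pair hlo hρ
  have h3 := h1.mul_last (by omega) hN
  have h4 := h2.mul_last (by omega) hN
  have hsub : Set.Icc lo (c + 1) ⊆ markers lo (c + 1) N := Icc_subset_markers
  have hk : k ≤ 1 := by omega
  have hl : l ≤ 1 - k := by omega
  interval_cases j <;> interval_cases k <;> interval_cases l <;>
    simp only [pow_zero, pow_one, mul_one, add_zero, zero_add, List.replicate_zero,
      List.replicate_one, List.append_nil]
  · exact h1.mono hsub
  · exact h3
  · rw [ι_right_expand]
    exact (h3.smul hσ).add_left (cone_mono hsub h2.mem)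
  · exact h2.mono hsub
  · exact h4
  · rw [mul_pair_mul_last]
    exact h4.smul hσ

lemma right_merge_dominates_fst (hlo : lo ≤ c) (hN : c + 1 < N) (hρ : 0 ≤ ρ) (hσ : 0 ≤ σ)
    (hu : Dominates z (Set.Icc lo c) m J u) (hc : c ∉ J) {l : ℕ} (hl : l ≤ 1) :
    Dominates z (markers lo (c + 1) N) (m + 1 + l)
      (J ++ [c] ++ List.replicate l N)
      (u * ExteriorAlgebra.ι ℝ (z c + ρ • z (c + 1) + σ • z N) *
        ExteriorAlgebra.ι ℝ (z N) ^ l) := by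
  have h2 : Dominates z (Set.Icc lo (c + 1)) (m + 1) (J ++ [c])
      (u * ExteriorAlgebra.ι ℝ (z c + ρ • z (c + 1))) := by
    rw [ι_right_expand]
    exact ((hu.mul_top ⟨hlo, le_rfl⟩ (fun x hx => hx.2) hc).mono Icc_subset_succ).add_right
      (smul_mem_cone hρ (mul_snd_mem (by omega) hu.mem))
  have h3 := mul_last_mem (by omega) hN (cone_mono Icc_subset_succ hu.mem)
  interval_cases l
  · simp only [pow_zero, mul_one, add_zero, List.replicate_zero, List.append_nil]
    rw [ι_right_expand]
    exact (h2.mono Icc_subset_markers).add_right (smul_mem_cone hσ h3)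
  · simp only [pow_one, List.replicate_one]
    rw [mul_triple_mul_last]
    exact h2.mul_last (by omega) hN

/-- Multiplying a chord between the monomials of the two sides of the chord. -/
lemma chord_expand (u : ExteriorAlgebra ℝ V) (W : List V) (b d n : V) {s α γ : ℝ}
    (hs : (-1 : ℝ) ^ W.length = s) (e : ℕ) {e' : ℕ} (he' : e' ≤ 1) :
    u * ExteriorAlgebra.ι ℝ b ^ e * ExteriorAlgebra.ι ℝ (-s • n) ^ e' *
        ExteriorAlgebra.ι ℝ (α • b + γ • d) * wedge W =
      α • (u * ExteriorAlgebra.ι ℝ b ^ (e + 1) * wedge W * ExteriorAlgebra.ι ℝ n ^ e') +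
        (s * γ) • (u * ExteriorAlgebra.ι ℝ b ^ e * wedge W * ExteriorAlgebra.ι ℝ d *
          ExteriorAlgebra.ι ℝ n ^ e') := by
  have hss : s * s = 1 := by rw [← hs, ← mul_pow]; simp
  set B := ExteriorAlgebra.ι ℝ b with hB
  set D := ExteriorAlgebra.ι ℝ d with hD
  set n' := ExteriorAlgebra.ι ℝ n with hn'
  set P := u * B ^ e with hP
  have hDw : D * wedge W = s • (wedge W * D) := by rw [hD, ι_mul_wedge, hs]
  have hnw : n' * wedge W = s • (wedge W * n') := by rw [hn', ι_mul_wedge, hs]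
  have hpow : u * B ^ (e + 1) = P * B := by rw [pow_succ, hP, mul_assoc]
  rw [hpow]
  interval_cases e'
  · simp only [pow_zero, mul_one, map_add, map_smul, ← hB, ← hD, mul_add, add_mul, mul_smul_comm,
      smul_mul_assoc]
    rw [mul_assoc P D, hDw, mul_smul_comm, smul_smul, mul_comm γ s, mul_assoc P (wedge W) D]
  · have hnB : n' * B = -(B * n') := ι_mul_ι_comm _ _
    have hnD : n' * D = -(D * n') := ι_mul_ι_comm _ _
    have h1 : P * n' * B * wedge W = -(s • (P * B * wedge W * n')) := by
      rw [mul_assoc P, hnB, mul_neg, neg_mul, mul_assoc, mul_assoc B, hnw]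
      simp [mul_assoc]
    have h2 : P * n' * D * wedge W = -(P * wedge W * D * n') := by
      rw [mul_assoc P, hnD, mul_neg, neg_mul, mul_assoc, mul_assoc D, hnw, mul_smul_comm,
        ← mul_assoc D, hDw, smul_mul_assoc, smul_smul, hss, one_smul]
      simp [mul_assoc]
    simp only [pow_one, map_add, map_smul, ← hB, ← hD, ← hn', mul_add, add_mul, mul_smul_comm,
      smul_mul_assoc, h1, h2]
    simp only [smul_neg, smul_smul]
    rw [← neg_smul, ← neg_smul]
    congr 2
    · linear_combination α * hss
    · ring

lemma left_merge_dominates (hac : a + 1 ≤ c) (hlo : lo ≤ a) (hρ : 0 < ρ)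
    (hu : Dominates z (Set.Icc lo a) m₁ J₁ u) (hw : Dominates z (Set.Icc (a + 1) c) m₂ J₂ w)
    (ha : a + 1 ∉ J₂) {i : ℕ} (hi : i ≤ 1) :
    Dominates z (Set.Icc lo c) (m₁ + i + m₂) (J₁ ++ List.replicate i (a + 1) ++ J₂)
      (u * ExteriorAlgebra.ι ℝ (z a + ρ • z (a + 1)) ^ i * w) := by
  interval_cases i
  · simpa using hu.mul_Icc hac hlo hw
  · simpa using left_merge_dominates_snd hac hlo hρ hu hw ha

end merge

/-- The row of a chord `(a, a + 1, c, c + 1)` whose last entry is at `N`. -/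
def chordVec (z : ℕ → V) (a c N : ℕ) (α γ ρ' ρ σ : ℝ) : V :=
  α • (z a + ρ' • z (a + 1)) + γ • (z c + ρ • z (c + 1) + σ • z N)

/-- The position and sign conditions on the entries of a chord of which the number of
descendants has parity `s`. -/
structure IsChord (lo N a c : ℕ) (s α γ ρ' ρ σ : ℝ) : Prop where
  lo_le : lo ≤ a
  add_two_le : a + 2 ≤ c
  add_two_le_last : c + 2 ≤ N
  tail_pos : 0 < α
  head_pos : 0 < s * γ
  tail_ratio_pos : 0 < ρ'
  head_ratio_pos : 0 < ρ
  last_ratio_pos : 0 < σ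

section chord

variable {lo a c N m₁ m₂ : ℕ} {s α γ ρ' ρ σ : ℝ} {w : ExteriorAlgebra ℝ V} {J₁ J₂ M : List ℕ}

/-- The product of monomials that arises by merging the two sides of a chord. -/
def mergeMon (z : ℕ → V) (a c N : ℕ) (ρ' ρ σ : ℝ) (L M : List ℕ) (i j k l : ℕ) :
    ExteriorAlgebra ℝ V :=
  mon z L * ExteriorAlgebra.ι ℝ (z a + ρ' • z (a + 1)) ^ i * mon z M *
    ExteriorAlgebra.ι ℝ (z c + ρ • z (c + 1)) ^ j *
    ExteriorAlgebra.ι ℝ (z c + ρ • z (c + 1) + σ • z N) ^ k * ExteriorAlgebra.ι ℝ (z N) ^ l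

lemma mon_leftVec (hL : ∀ x ∈ L, x ≤ a) (e e' : ℕ) :
    mon (leftVec z a N ρ s) (L ++ List.replicate e (a + 1) ++ List.replicate e' (a + 2)) =
      mon z L * ExteriorAlgebra.ι ℝ (z a + ρ • z (a + 1)) ^ e *
        ExteriorAlgebra.ι ℝ (-s • z N) ^ e' := by
  rw [mon_append, mon_append, mon_replicate, mon_replicate, leftVec_add_one, leftVec_add_two,
    mon_congr fun x hx => leftVec_of_le z a N ρ s (hL x hx)]

lemma mon_rightVec (hM : ∀ x ∈ M, x ≤ c) (f f' : ℕ) :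
    mon (rightVec z c N ρ σ) (M ++ List.replicate f (c + 1) ++ List.replicate f' (c + 2)) =
      mon z M * ExteriorAlgebra.ι ℝ (z c + ρ • z (c + 1)) ^ f *
        ExteriorAlgebra.ι ℝ (z c + ρ • z (c + 1) + σ • z N) ^ f' := by
  rw [mon_append, mon_append, mon_replicate, mon_replicate, rightVec_add_one, rightVec_add_two,
    mon_congr fun x hx => rightVec_of_le z c N ρ σ (hM x hx)]

lemma mon_mul_chord_mul_mon (hL : ∀ x ∈ L, x ≤ a) (hM : ∀ x ∈ M, x ≤ c) {e e' f f' : ℕ}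
    (he' : e' ≤ 1) (hs : (-1 : ℝ) ^ (M.length + f + f') = s) :
    mon (leftVec z a N ρ' s) (L ++ List.replicate e (a + 1) ++ List.replicate e' (a + 2)) *
        ExteriorAlgebra.ι ℝ (chordVec z a c N α γ ρ' ρ σ) *
        mon (rightVec z c N ρ σ) (M ++ List.replicate f (c + 1) ++ List.replicate f' (c + 2)) =
      α • mergeMon z a c N ρ' ρ σ L M (e + 1) f f' e' +
        (s * γ) • mergeMon z a c N ρ' ρ σ L M e f (f' + 1) e' := by
  rw [mon_leftVec hL]
  change _ * wedge (List.map (rightVec z c N ρ σ) _) = _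
  rw [chordVec, chord_expand _ _ _ _ _ (by simpa [add_assoc] using hs) _ he', ← mon,
    mon_rightVec hM, mergeMon, mergeMon, pow_succ _ f']
  simp only [mul_assoc]

lemma mergeMon_mem (h : IsChord lo N a c s α γ ρ' ρ σ) (hL : Admissible (Set.Icc lo a) m₁ L)
    (hM : Admissible (Set.Icc (a + 1) c) m₂ M) (i j k l : ℕ) :
    mergeMon z a c N ρ' ρ σ L M i j k l ∈ cone z (markers lo (c + 1) N)
      (m₁ + i + m₂ + j + k + l) := by
  have := h.lo_le; have := h.add_two_le; have := h.add_two_le_last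
  exact right_merge_mem (by omega) (by omega) h.head_ratio_pos.le h.last_ratio_pos.le
    (left_merge_mem (by omega) h.lo_le h.tail_ratio_pos.le (mon_mem_cone hL) (mon_mem_cone hM) i)
    j k l

lemma merge_mem_mon (h : IsChord lo N a c s α γ ρ' ρ σ)
    (hs : (-1 : ℝ) ^ m₂ = s) (h₁ : Admissible (Set.Icc lo (a + 2)) m₁ J₁)
    (h₂ : Admissible (Set.Icc (a + 1) (c + 2)) m₂ J₂) :
    mon (leftVec z a N ρ' s) J₁ * ExteriorAlgebra.ι ℝ (chordVec z a c N α γ ρ' ρ σ) *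
      mon (rightVec z c N ρ σ) J₂ ∈ cone z (markers lo (c + 1) N) (m₁ + 1 + m₂) := by
  have hm₁ := h₁.2.2
  have hm₂ := h₂.2.2
  obtain ⟨L₁, e', he', hL₁, rfl⟩ := h₁.split_top
  obtain ⟨L, e, he, hL, rfl⟩ := hL₁.split_top
  obtain ⟨M₁, f', hf', hM₁, rfl⟩ := h₂.split_top
  obtain ⟨M, f, hf, hM, rfl⟩ := hM₁.split_top
  simp only [List.length_append, List.length_replicate] at hm₁ hm₂
  subst hm₁ hm₂
  rw [mon_mul_chord_mul_mon (fun x hx => (hL.2.1 x hx).2) (fun x hx => (hM.2.1 x hx).2) he' hs]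
  refine add_mem (smul_mem_cone h.tail_pos.le ?_) (smul_mem_cone h.head_pos.le ?_)
  · convert mergeMon_mem h hL hM (e + 1) f f' e' using 2
    omega
  · convert mergeMon_mem h hL hM e f (f' + 1) e' using 2
    omega

lemma merge_mem (h : IsChord lo N a c s α γ ρ' ρ σ) (hs : (-1 : ℝ) ^ m₂ = s)
    (hu : u ∈ cone (leftVec z a N ρ' s) (Set.Icc lo (a + 2)) m₁)
    (hw : w ∈ cone (rightVec z c N ρ σ) (Set.Icc (a + 1) (c + 2)) m₂) :
    u * ExteriorAlgebra.ι ℝ (chordVec z a c N α γ ρ' ρ σ) * w ∈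
      cone z (markers lo (c + 1) N) (m₁ + 1 + m₂) := by
  rw [mul_assoc]
  refine mul_mem_of_mem_cone (fun L hL => ?_) hu
  rw [← mul_assoc]
  exact mul_mem_of_mem_cone_right (fun M hM => merge_mem_mon h hs hL hM) hw

lemma merge_dominates (h : IsChord lo N a c s α γ ρ' ρ σ) (hs : (-1 : ℝ) ^ m₂ = s)
    (hu : Dominates (leftVec z a N ρ' s) (Set.Icc lo (a + 2)) m₁ J₁ u)
    (hw : Dominates (rightVec z c N ρ σ) (Set.Icc (a + 1) (c + 2)) m₂ J₂ w)
    (hJ : Dominates z (markers lo (c + 1) N) (m₁ + 1 + m₂) J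
      (mon (leftVec z a N ρ' s) J₁ * ExteriorAlgebra.ι ℝ (chordVec z a c N α γ ρ' ρ σ) *
        mon (rightVec z c N ρ σ) J₂)) :
    Dominates z (markers lo (c + 1) N) (m₁ + 1 + m₂) J
      (u * ExteriorAlgebra.ι ℝ (chordVec z a c N α γ ρ' ρ σ) * w) := by
  have hw' := hw.mem
  obtain ⟨h₁, p, hp, r, hr, rfl⟩ := hu
  obtain ⟨h₂, q, hq, t, ht, rfl⟩ := hw
  have h3 := merge_mem h hs (smul_mem_cone hp.le (mon_mem_cone h₁)) ht
  have h4 := merge_mem h hs hr hw'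
  convert ((hJ.smul (mul_pos hp hq)).add_right h3).add_right h4 using 1
  simp only [add_mul, mul_add, smul_mul_assoc, mul_smul_comm]
  module

lemma mem_le (hL : Admissible (Set.Icc lo a) m₁ L) : ∀ x ∈ L, x ≤ a := fun x hx => (hL.2.1 x hx).2

/-- Merging with weight on the second tail marker. -/
lemma merge_dominates_tail_snd (h : IsChord lo N a c s α γ ρ' ρ σ) {e : ℕ} (he : e ≤ 1)
    (hs : (-1 : ℝ) ^ m₂ = s) (hL : Admissible (Set.Icc lo a) m₁ L)
    (hM : Admissible (Set.Icc (a + 2) c) m₂ M) :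
    Dominates z (markers lo (c + 1) N) (m₁ + e + 1 + m₂)
      (L ++ (a + 1) :: M ++ List.replicate e N)
      (mon (leftVec z a N ρ' s) (L ++ List.replicate e (a + 2)) *
        ExteriorAlgebra.ι ℝ (chordVec z a c N α γ ρ' ρ σ) * mon (rightVec z c N ρ σ) M) := by
  have := h.lo_le; have := h.add_two_le; have := h.add_two_le_last
  have hM' : Admissible (Set.Icc (a + 1) c) m₂ M := hM.mono (Set.Icc_subset_Icc_left (by omega))
  have key := mon_mul_chord_mul_mon (z := z) (N := N) (α := α) (γ := γ) (ρ' := ρ') (ρ := ρ)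
    (σ := σ) (e := 0) (f := 0) (f' := 0) (mem_le hL) (mem_le hM) he
    (s := s) (by rw [← hs, ← hM.2.2]; rfl)
  simp only [List.replicate_zero, List.append_nil] at key
  rw [key]
  refine Dominates.add_right (Dominates.smul ?_ h.tail_pos) (smul_mem_cone h.head_pos.le ?_)
  · have := right_merge_dominates (N := N) (by omega) (by omega) h.head_ratio_pos
      h.last_ratio_pos (left_merge_dominates (by omega) h.lo_le h.tail_ratio_pos
        (dominates_mon hL) (dominates_mon hM')
        (fun h => by have := (hM.2.1 _ h).1; omega) (z := z) (le_refl 1))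
      (Nat.zero_le 1) (k := 0) (l := e) (by omega)
    convert this using 1
    · omega
    · simp
    · simp [mergeMon]
  · convert mergeMon_mem h hL hM' 0 0 (0 + 1) e using 2
    omega

/-- Merging with weight on the first head marker. -/
lemma merge_dominates_head_fst (h : IsChord lo N a c s α γ ρ' ρ σ) {e e' : ℕ} (he : e ≤ 1)
    (he' : e' ≤ 1) (hs : (-1 : ℝ) ^ m₂ = s) (hL : Admissible (Set.Icc lo a) m₁ L)
    (hM : Admissible (Set.Icc (a + 2) c) m₂ M) (hc : c ∉ M) :
    Dominates z (markers lo (c + 1) N) (m₁ + e + e' + 1 + m₂)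
      (L ++ List.replicate e (a + 1) ++ M ++ [c] ++ List.replicate e' N)
      (mon (leftVec z a N ρ' s) (L ++ List.replicate e (a + 1) ++ List.replicate e' (a + 2)) *
        ExteriorAlgebra.ι ℝ (chordVec z a c N α γ ρ' ρ σ) * mon (rightVec z c N ρ σ) M) := by
  have := h.lo_le; have := h.add_two_le; have := h.add_two_le_last
  have hM' : Admissible (Set.Icc (a + 1) c) m₂ M := hM.mono (Set.Icc_subset_Icc_left (by omega))
  have key := mon_mul_chord_mul_mon (z := z) (N := N) (α := α) (γ := γ) (ρ' := ρ') (ρ := ρ)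
    (σ := σ) (e := e) (f := 0) (f' := 0) (mem_le hL) (mem_le hM) he'
    (s := s) (by rw [← hs, ← hM.2.2]; rfl)
  simp only [List.replicate_zero, List.append_nil] at key
  rw [key]
  refine Dominates.add_left (Dominates.smul ?_ h.head_pos) (smul_mem_cone h.tail_pos.le ?_)
  · have := right_merge_dominates_fst (N := N) (by omega) (by omega) h.head_ratio_pos.le
      h.last_ratio_pos.le (left_merge_dominates (by omega) h.lo_le h.tail_ratio_pos
        (dominates_mon hL) (dominates_mon hM')
        (fun h => by have := (hM.2.1 _ h).1; omega) (z := z) he)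
      (by
        have h1 : c ∉ L := fun h => by have := (hL.2.1 _ h).2; omega
        have h2 : c ∉ List.replicate e (a + 1) := fun h => by
          have := List.eq_of_mem_replicate h; omega
        simp [h1, hc, h2]) he'
    convert this using 1
    · omega
    · simp [mergeMon]
  · convert mergeMon_mem h hL hM' (e + 1) 0 0 e' using 2
    omega

/-- Merging with weight on the first tail marker. -/
lemma merge_dominates_tail_fst (h : IsChord lo N a c s α γ ρ' ρ σ) {f f' : ℕ} (hf : f ≤ 1)
    (hf' : f' ≤ 1) (hs : (-1 : ℝ) ^ (m₂ + f + f') = s) (hL : Admissible (Set.Icc lo a) m₁ L)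
    (hM : Admissible (Set.Icc (a + 1) c) m₂ M) (ha : a ∉ L) :
    Dominates z (markers lo (c + 1) N) (m₁ + 1 + (m₂ + f + f'))
      (L ++ [a] ++ M ++ List.replicate f (c + 1) ++ List.replicate f' N)
      (mon (leftVec z a N ρ' s) L *
        ExteriorAlgebra.ι ℝ (chordVec z a c N α γ ρ' ρ σ) *
        mon (rightVec z c N ρ σ)
          (M ++ List.replicate f (c + 1) ++ List.replicate f' (c + 2))) := by
  have := h.lo_le; have := h.add_two_le; have := h.add_two_le_last
  have key := mon_mul_chord_mul_mon (z := z) (N := N) (α := α) (γ := γ) (ρ' := ρ') (ρ := ρ)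
    (σ := σ) (e := 0) (e' := 0) (f := f) (f' := f') (mem_le hL) (mem_le hM) zero_le_one
    (s := s) (by rw [← hs, ← hM.2.2])
  simp only [List.replicate_zero, List.append_nil] at key
  rw [key]
  refine Dominates.add_right (Dominates.smul ?_ h.tail_pos) (smul_mem_cone h.head_pos.le ?_)
  · have := right_merge_dominates (N := N) (by omega) (by omega) h.head_ratio_pos
      h.last_ratio_pos (left_merge_dominates_fst (by omega) h.lo_le h.tail_ratio_pos.le
        (dominates_mon hL) (dominates_mon hM) (z := z) ha)
      hf (k := f') (l := 0) (by omega)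
    convert this using 1
    · omega
    · simp
    · simp [mergeMon]
  · convert mergeMon_mem h hL hM 0 f (f' + 1) 0 using 2
    omega

end chord

/-- The shape of a chord diagram: the node `A a c B` consists of the chord
`(a, a + 1, c, c + 1)`, the diagram `A` to its left and the diagram `B` below it. -/
inductive ChordTree
  | nil : ChordTree
  | node (A : ChordTree) (a c : ℕ) (B : ChordTree) : ChordTree

namespace ChordTree

/-- The last marker of the last top chord, or `0` if there are no chords. -/
def top : ChordTree → ℕ
  | nil => 0
  | node _ _ c _ => c + 1

/-- The chords in the order of their starts. -/
def chords : ChordTree → List (ℕ × ℕ)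
  | nil => []
  | node A a c B => A.chords ++ (a, c) :: B.chords

end ChordTree

/-- `Y` is, up to row operations, the image of a domino matrix of shape `T` on the markers
from `lo` to `N` under the vectors `z`. -/
def Cell : ChordTree → (ℕ → V) → ℕ → ℕ → List V → Prop
  | .nil, _, _, _, Y => Y = []
  | .node A a c B, z, lo, N, Y => ∃ α γ ρ' ρ σ : ℝ, ∃ YA YB : List V,
      IsChord lo N a c ((-1) ^ YB.length) α γ ρ' ρ σ ∧
      Cell A (leftVec z a N ρ' ((-1) ^ YB.length)) lo (a + 2) YA ∧
      Cell B (rightVec z c N ρ σ) (a + 1) (c + 2) YB ∧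
      Y = YA ++ chordVec z a c N α γ ρ' ρ σ :: YB

section cell

variable {A B : ChordTree} {lo a c N : ℕ} {Y : List V}

lemma Cell.top_le {T : ChordTree} (h : Cell T z lo N Y) : T.top ≤ N - 1 := by
  cases T with
  | nil => exact Nat.zero_le _
  | node A a c B =>
    obtain ⟨α, γ, ρ', ρ, σ, YA, YB, hc, -⟩ := h
    have := hc.add_two_le_last
    simp only [ChordTree.top]
    omega

lemma Dominates.markers_mono {h h' N : ℕ} (hu : Dominates z (markers a h N) m J u) (hh : h ≤ N)
    (hN : N ≤ h') : Dominates z (Set.Icc a h') m J u :=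
  hu.mono fun x hx => ⟨hx.1, by rcases hx.2 with h | h <;> omega⟩

lemma Dominates.admissible {h : ℕ} (hu : Dominates z S m J u)
    (hJ : ∀ x ∈ J, a ≤ x ∧ x ≤ h) : Admissible (Set.Icc a h) m J :=
  ⟨hu.1.1, fun x hx => hJ x hx, hu.1.2.2⟩

omit [AddCommGroup V] [Module ℝ V] in
lemma length_append_cons (YA YB : List V) (x : V) :
    (YA ++ x :: YB).length = YA.length + 1 + YB.length := by
  rw [List.length_append, List.length_cons]; omega

lemma wedge_append_cons (YA YB : List V) (x : V) :
    wedge (YA ++ x :: YB) = wedge YA * ExteriorAlgebra.ι ℝ x * wedge YB := by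
  rw [wedge_append, wedge_cons, mul_assoc]

lemma Cell.dominates {T : ChordTree} (h : Cell T z lo N Y) :
    ∃ J, (∀ x ∈ J, lo + 1 ≤ x ∧ x + 2 ≤ T.top) ∧
      Dominates z (markers lo T.top N) Y.length J (wedge Y) := by
  induction T generalizing z lo N Y with
  | nil =>
    obtain rfl : Y = [] := h
    exact ⟨[], by simp, dominates_mon ⟨by simp, by simp, rfl⟩⟩
  | node A a c B ihA ihB =>
    obtain ⟨α, γ, ρ', ρ, σ, YA, YB, hc, hA, hB, rfl⟩ := h
    have := hc.lo_le; have := hc.add_two_le; have := hc.add_two_le_last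
    have tA := hA.top_le
    have tB := hB.top_le
    obtain ⟨J₁, hJ₁, d₁⟩ := ihA hA
    obtain ⟨J₂, hJ₂, d₂⟩ := ihB hB
    refine ⟨J₁ ++ (a + 1) :: J₂, fun x hx => ?_, ?_⟩
    · simp only [ChordTree.top]
      rcases List.mem_append.1 hx with hx | hx
      · have := hJ₁ x hx; omega
      · rcases List.mem_cons.1 hx with rfl | hx
        · omega
        · have := hJ₂ x hx; omega
    · have key := merge_dominates_tail_snd hc zero_le_one rfl
        (d₁.admissible (a := lo) (h := a) fun x hx => by have := hJ₁ x hx; omega)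
        (d₂.admissible (a := a + 2) (h := c) fun x hx => by have := hJ₂ x hx; omega) (z := z)
      simp only [List.replicate_zero, List.append_nil, add_zero] at key
      rw [length_append_cons, wedge_append_cons]
      exact merge_dominates hc rfl (d₁.markers_mono (by omega) le_rfl)
        (d₂.markers_mono (by omega) le_rfl) key

lemma Cell.dominates_avoiding {T : ChordTree} (h : Cell T z lo N Y) (i : ℕ) :
    ∃ J, (∀ x ∈ J, lo ≤ x ∧ x + 1 ≤ T.top ∧ x ≠ i ∧ x ≠ i + 1) ∧
      Dominates z (markers lo T.top N) Y.length J (wedge Y) := by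
  induction T generalizing z lo N Y with
  | nil =>
    obtain rfl : Y = [] := h
    exact ⟨[], by simp, dominates_mon ⟨by simp, by simp, rfl⟩⟩
  | node A a c B ihA ihB =>
    rcases le_or_gt c i with hci | hci
    · obtain ⟨J, hJ, d⟩ := h.dominates
      refine ⟨J, fun x hx => ?_, d⟩
      have := hJ x hx
      simp only [ChordTree.top] at *
      omega
    obtain ⟨α, γ, ρ', ρ, σ, YA, YB, hc, hA, hB, rfl⟩ := h
    have := hc.lo_le; have := hc.add_two_le; have := hc.add_two_le_last
    have tA := hA.top_le
    have tB := hB.top_le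
    rw [length_append_cons, wedge_append_cons]
    simp only [ChordTree.top]
    rcases lt_trichotomy i a with hi | rfl | hi
    · obtain ⟨J₁, hJ₁, d₁⟩ := ihA hA
      obtain ⟨J₂, hJ₂, d₂⟩ := hB.dominates
      have key := merge_dominates_tail_snd hc zero_le_one rfl
        (d₁.admissible (a := lo) (h := a) fun x hx => by have := hJ₁ x hx; omega)
        (d₂.admissible (a := a + 2) (h := c) fun x hx => by have := hJ₂ x hx; omega) (z := z)
      simp only [List.replicate_zero, List.append_nil, add_zero] at key
      refine ⟨J₁ ++ (a + 1) :: J₂, fun x hx => ?_, merge_dominates hc rfl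
        (d₁.markers_mono (by omega) le_rfl) (d₂.markers_mono (by omega) le_rfl) key⟩
      rcases List.mem_append.1 hx with hx | hx
      · have := hJ₁ x hx; omega
      · rcases List.mem_cons.1 hx with rfl | hx
        · omega
        · have := hJ₂ x hx; omega
    · obtain ⟨J₁, hJ₁, d₁⟩ := hA.dominates
      obtain ⟨J₂, hJ₂, d₂⟩ := hB.dominates
      have key := merge_dominates_head_fst hc zero_le_one zero_le_one rfl
        (d₁.admissible (a := lo) (h := i) fun x hx => by have := hJ₁ x hx; omega)
        (d₂.admissible (a := i + 2) (h := c) fun x hx => by have := hJ₂ x hx; omega) (z := z)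
        (fun hx => by have := hJ₂ c hx; omega)
      simp only [List.replicate_zero, List.append_nil, add_zero] at key
      refine ⟨J₁ ++ J₂ ++ [c], fun x hx => ?_, merge_dominates hc rfl
        (d₁.markers_mono (by omega) le_rfl) (d₂.markers_mono (by omega) le_rfl) key⟩
      simp only [List.mem_append, List.mem_singleton] at hx
      rcases hx with (hx | hx) | rfl
      · have := hJ₁ x hx; omega
      · have := hJ₂ x hx; omega
      · omega
    · obtain ⟨J₁, hJ₁, d₁⟩ := hA.dominates
      obtain ⟨J₂, hJ₂, d₂⟩ := ihB hB
      have key := merge_dominates_tail_fst hc zero_le_one zero_le_one rfl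
        (d₁.admissible (a := lo) (h := a) fun x hx => by have := hJ₁ x hx; omega)
        (d₂.admissible (a := a + 1) (h := c) fun x hx => by have := hJ₂ x hx; omega) (z := z)
        (fun hx => by have := hJ₁ a hx; omega)
      simp only [List.replicate_zero, List.append_nil, add_zero] at key
      refine ⟨J₁ ++ [a] ++ J₂, fun x hx => ?_, merge_dominates hc rfl
        (d₁.markers_mono (by omega) le_rfl) (d₂.markers_mono (by omega) le_rfl) key⟩
      simp only [List.mem_append, List.mem_singleton] at hx
      rcases hx with (hx | rfl) | hx
      · have := hJ₁ x hx; omega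
      · omega
      · have := hJ₂ x hx; omega

lemma wedge_mul_wedge_of_mem {l l' : List V} {x : V} (h : x ∈ l) (h' : x ∈ l') :
    wedge l * wedge l' = 0 := by
  obtain ⟨s, t, rfl⟩ := List.append_of_mem h'
  rw [wedge_append_cons, ← mul_assoc, ← mul_assoc, ← wedge_append,
    wedge_mul_ι_of_mem (List.mem_append_left s h), zero_mul]

/-- The value of the functional `φ` on the product of `Y` with four more vectors. -/
def bracket (φ : ExteriorAlgebra ℝ V →ₗ[ℝ] ℝ) (Y : List V) (p q r t : V) : ℝ :=
  φ (wedge Y * wedge [p, q, r, t])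

lemma exists_split {i : ℕ} (hL : L.Pairwise (· < ·)) (hi : i ∉ L) :
    ∃ L₁ L₂, L = L₁ ++ L₂ ∧ (∀ x ∈ L₁, x < i) ∧ ∀ x ∈ L₂, i < x := by
  induction L with
  | nil => exact ⟨[], [], by simp⟩
  | cons y L ih =>
    obtain ⟨hy, hL⟩ := List.pairwise_cons.1 hL
    rw [List.mem_cons, not_or] at hi
    rcases lt_or_gt_of_ne hi.1 with h | h
    · refine ⟨[], y :: L, rfl, by simp, fun x hx => ?_⟩
      rcases List.mem_cons.1 hx with rfl | hx
      · exact h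
      · exact h.trans (hy x hx)
    · obtain ⟨L₁, L₂, rfl, h₁, h₂⟩ := ih hL hi.2
      refine ⟨y :: L₁, L₂, rfl, fun x hx => ?_, h₂⟩
      rcases List.mem_cons.1 hx with rfl | hx
      · exact h
      · exact h₁ x hx

/-- Inserting a consecutive pair and two final markers into an increasing monomial. -/
lemma exists_insert {i j : ℕ} (hL : L.Pairwise (· < ·))
    (h : ∀ x ∈ L, lo ≤ x ∧ x < j ∧ x ≠ i ∧ x ≠ i + 1) (hi : lo ≤ i) (hij : i + 1 < j)
    (hj : j < N) : ∃ L', Admissible (Set.Icc lo N) (L.length + 4) L' ∧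
      mon z L' = mon z L * wedge [z i, z (i + 1), z j, z N] := by
  obtain ⟨L₁, L₂, rfl, h₁, h₂⟩ := exists_split (i := i) hL fun hx => (h i hx).2.2.1 rfl
  obtain ⟨p₁, p₂, p₃⟩ := List.pairwise_append.1 hL
  have h₁' : ∀ x ∈ L₁, lo ≤ x ∧ x < i := fun x hx => ⟨(h x (by simp [hx])).1, h₁ x hx⟩
  have h₂' : ∀ x ∈ L₂, i + 1 < x ∧ x < j := fun x hx => by
    have := h x (by simp [hx]); have := h₂ x hx; omega
  refine ⟨L₁ ++ ([i, i + 1] ++ (L₂ ++ [j, N])), ⟨?_, fun x hx => ?_, ?_⟩, ?_⟩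
  · simp only [List.pairwise_append, List.mem_append, List.mem_cons, List.not_mem_nil, or_false]
    refine ⟨p₁, ⟨by simp, ⟨p₂, by simp [hj], fun x hx y hy => ?_⟩, fun x hx y hy => ?_⟩,
      fun x hx y hy => ?_⟩
    · have := h₂' x hx; omega
    · rcases hy with hy | hy
      · have := h₂' y hy; omega
      · omega
    · have := h₁' x hx
      rcases hy with hy | hy | hy
      · omega
      · have := h₂' y hy; omega
      · omega
  · simp only [List.mem_append, List.mem_cons, List.not_mem_nil, or_false] at hx
    rw [Set.mem_Icc]
    rcases hx with hx | hx | hx | hx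
    · have := h₁' x hx; omega
    · omega
    · have := h₂' x hx; omega
    · omega
  · simp; omega
  · have hc := (commute_pair_wedge (z i) (z (i + 1)) (L₂.map z)).eq
    simp only [mon, List.map_append, List.map_cons, List.map_nil, wedge_append, wedge_cons,
      wedge_nil, mul_one]
    rw [← mul_assoc (ExteriorAlgebra.ι ℝ (z i)), mul_assoc (wedge (L₁.map z)),
      ← mul_assoc (ExteriorAlgebra.ι ℝ (z i) * _) (wedge (L₂.map z)), hc]
    simp only [mul_assoc]

lemma Cell.bracket_pos {T : ChordTree} (h : Cell T z lo N Y) {φ : ExteriorAlgebra ℝ V →ₗ[ℝ] ℝ}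
    (hφ : ∀ L, Admissible (Set.Icc lo N) (Y.length + 4) L → 0 < φ (mon z L)) {i j : ℕ}
    (hi : lo ≤ i) (hij : i + 1 < j) (hj : j < N) (hT : T.top ≤ j) :
    0 < bracket φ Y (z i) (z (i + 1)) (z j) (z N) := by
  obtain ⟨J, hJ, d⟩ := h.dominates_avoiding i
  have key : ∀ L, Admissible (markers lo T.top N) Y.length L →
      (∀ x ∈ L, x < j ∧ x ≠ i ∧ x ≠ i + 1) →
      0 < φ (mon z L * wedge [z i, z (i + 1), z j, z N]) := by
    intro L hL hL'
    obtain ⟨L', h₁, h₂⟩ := exists_insert (z := z) hL.1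
      (fun x hx => ⟨(hL.2.1 x hx).1, hL' x hx⟩) hi hij hj
    rw [← h₂]
    exact hφ L' (hL.2.2 ▸ h₁)
  have key' : ∀ L, Admissible (markers lo T.top N) Y.length L →
      0 ≤ φ (mon z L * wedge [z i, z (i + 1), z j, z N]) := by
    intro L hL
    by_cases hL' : ∀ x ∈ L, x < j ∧ x ≠ i ∧ x ≠ i + 1
    · exact (key L hL hL').le
    · push Not at hL'
      obtain ⟨x, hx, hx'⟩ := hL'
      rw [mon, wedge_mul_wedge_of_mem (List.mem_map_of_mem hx), map_zero]
      have : x = i ∨ x = i + 1 ∨ x = j ∨ x = N := by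
        rcases (hL.2.1 x hx).2 with h | h
        · by_contra! hne
          exact hne.2.1 (hx' (by omega) hne.1)
        · omega
      rcases this with rfl | rfl | rfl | rfl <;> simp
  exact d.pos (φ := φ ∘ₗ LinearMap.mulRight ℝ (wedge [z i, z (i + 1), z j, z N])) key'
    (key J d.1 fun x hx => by have := hJ x hx; omega)

end cell

section bracket

variable {φ ψ : ExteriorAlgebra ℝ V →ₗ[ℝ] ℝ} {Y Y' : List V}

lemma wedge_eq_zero {l : List V} (hl : ¬ l.Nodup) : wedge l = 0 := by
  induction l with
  | nil => simp at hl
  | cons x l ih =>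
    rw [List.nodup_cons, not_and_or, not_not] at hl
    rw [wedge_cons]
    rcases hl with hl | hl
    · exact ι_mul_wedge_of_mem hl
    · rw [ih hl, mul_zero]

lemma bracket_eq_zero_of_mem {p q r t x : V} (hx : x ∈ Y) (hx' : x ∈ [p, q, r, t]) :
    bracket φ Y p q r t = 0 := by
  rw [bracket, wedge_mul_wedge_of_mem hx hx', map_zero]

lemma bracket_eq_zero {p q r t : V} (h : ¬ [p, q, r, t].Nodup) : bracket φ Y p q r t = 0 := by
  rw [bracket, wedge_eq_zero h, mul_zero, map_zero]

lemma bracket_add_fst (p p' q r t : V) :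
    bracket φ Y (p + p') q r t = bracket φ Y p q r t + bracket φ Y p' q r t := by
  simp [bracket, mul_add, add_mul]

lemma bracket_add_snd (p q q' r t : V) :
    bracket φ Y p (q + q') r t = bracket φ Y p q r t + bracket φ Y p q' r t := by
  simp [bracket, mul_add, add_mul]

lemma bracket_add_trd (p q r r' t : V) :
    bracket φ Y p q (r + r') t = bracket φ Y p q r t + bracket φ Y p q r' t := by
  simp [bracket, mul_add, add_mul]

lemma bracket_add_fth (p q r t t' : V) :
    bracket φ Y p q r (t + t') = bracket φ Y p q r t + bracket φ Y p q r t' := by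
  simp [bracket, mul_add]

lemma bracket_smul_fst (c : ℝ) (p q r t : V) :
    bracket φ Y (c • p) q r t = c * bracket φ Y p q r t := by
  simp [bracket]

lemma bracket_smul_snd (c : ℝ) (p q r t : V) :
    bracket φ Y p (c • q) r t = c * bracket φ Y p q r t := by
  simp [bracket]

lemma bracket_smul_trd (c : ℝ) (p q r t : V) :
    bracket φ Y p q (c • r) t = c * bracket φ Y p q r t := by
  simp [bracket]

lemma bracket_smul_fth (c : ℝ) (p q r t : V) :
    bracket φ Y p q r (c • t) = c * bracket φ Y p q r t := by
  simp [bracket]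

lemma bracket_swap (p q r t : V) : bracket φ Y p q t r = -bracket φ Y p q r t := by
  have := bracket_eq_zero (φ := φ) (Y := Y) (p := p) (q := q) (r := r + t) (t := r + t) (by simp)
  rw [bracket_add_trd, bracket_add_fth, bracket_add_fth,
    bracket_eq_zero (p := p) (q := q) (r := r) (t := r) (by simp),
    bracket_eq_zero (p := p) (q := q) (r := t) (t := t) (by simp)] at this
  linarith

lemma commute_wedge_four (p q r t : V) (l : List V) : Commute (wedge [p, q, r, t]) (wedge l) := by
  have := (commute_pair_wedge p q l).mul_left (commute_pair_wedge r t l)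
  simpa [mul_assoc] using this

/-- `φ` is positive on the increasing monomials of degree `m` in `z lo, …, z N`. -/
def PositiveOn (φ : ExteriorAlgebra ℝ V →ₗ[ℝ] ℝ) (z : ℕ → V) (lo N m : ℕ) : Prop :=
  ∀ L, Admissible (Set.Icc lo N) m L → 0 < φ (mon z L)

/-- The brackets of two lists of vectors agree up to a positive factor. -/
def BracketRel (φ ψ : ExteriorAlgebra ℝ V →ₗ[ℝ] ℝ) (Y Y' : List V) : Prop :=
  ∃ κ : ℝ, 0 < κ ∧ ∀ p q r t, bracket φ Y p q r t = κ * bracket ψ Y' p q r t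

lemma BracketRel.symm (h : BracketRel φ ψ Y Y') : BracketRel ψ φ Y' Y := by
  obtain ⟨κ, hκ, h⟩ := h
  exact ⟨κ⁻¹, inv_pos.2 hκ, fun p q r t => by rw [h, inv_mul_cancel_left₀ hκ.ne']⟩

variable {lo N a c : ℕ} {s α γ ρ' ρ σ : ℝ} {YA YB : List V}

/-- The functional seen by the part of a diagram to the left of the last top chord. -/
def leftFunctional (φ : ExteriorAlgebra ℝ V →ₗ[ℝ] ℝ) (x : V) (YB : List V) :
    ExteriorAlgebra ℝ V →ₗ[ℝ] ℝ :=
  φ ∘ₗ LinearMap.mulRight ℝ (ExteriorAlgebra.ι ℝ x * wedge YB)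

/-- The functional seen by the part of a diagram below the last top chord. -/
def rightFunctional (φ : ExteriorAlgebra ℝ V →ₗ[ℝ] ℝ) (YA : List V) (x : V) :
    ExteriorAlgebra ℝ V →ₗ[ℝ] ℝ :=
  φ ∘ₗ LinearMap.mulLeft ℝ (wedge YA * ExteriorAlgebra.ι ℝ x)

lemma bracket_leftFunctional (x : V) (p q r t : V) :
    bracket (leftFunctional φ x YB) YA p q r t = bracket φ (YA ++ x :: YB) p q r t := by
  have := (commute_wedge_four p q r t (x :: YB)).eq
  rw [bracket, bracket, leftFunctional, wedge_append, LinearMap.comp_apply,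
    LinearMap.mulRight_apply, ← wedge_cons, mul_assoc, this, mul_assoc]

lemma bracket_rightFunctional (x : V) (p q r t : V) :
    bracket (rightFunctional φ YA x) YB p q r t = bracket φ (YA ++ x :: YB) p q r t := by
  rw [bracket, bracket, rightFunctional, wedge_append_cons, LinearMap.comp_apply,
    LinearMap.mulLeft_apply]
  simp only [mul_assoc]

lemma PositiveOn.pos_of_dominates {h : ℕ} (hφ : PositiveOn φ z lo N m)
    (hu : Dominates z (markers lo h N) m' J u) (hm : m' = m) (hh : h ≤ N) : 0 < φ u := by
  subst hm
  have hu' := hu.markers_mono hh le_rfl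
  exact hu'.pos (fun L hL => (hφ L hL).le) (hφ J hu'.1)

lemma PositiveOn.left {B : ChordTree} (hc : IsChord lo N a c ((-1) ^ YB.length) α γ ρ' ρ σ)
    (hB : Cell B (rightVec z c N ρ σ) (a + 1) (c + 2) YB)
    (hφ : PositiveOn φ z lo N ((YA ++ chordVec z a c N α γ ρ' ρ σ :: YB).length + 4)) :
    PositiveOn (leftFunctional φ (chordVec z a c N α γ ρ' ρ σ) YB)
      (leftVec z a N ρ' ((-1) ^ YB.length)) lo (a + 2) (YA.length + 4) := by
  have := hc.lo_le; have := hc.add_two_le; have := hc.add_two_le_last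
  have tB := hB.top_le
  intro L hL
  obtain ⟨J, hJ, d⟩ := hB.dominates
  have hlen := hL.2.2
  have dL := dominates_mon (z := leftVec z a N ρ' ((-1) ^ YB.length)) hL
  obtain ⟨L₁, e', he', hL₁, rfl⟩ := hL.split_top
  obtain ⟨L₀, e, he, hL₀, rfl⟩ := hL₁.split_top
  have key := merge_dominates_head_fst hc he he' rfl hL₀
    (d.admissible (a := a + 2) (h := c) fun x hx => by have := hJ x hx; omega) (z := z)
    (fun hx => by have := hJ c hx; omega)
  simp only [List.length_append, List.length_replicate] at hlen
  rw [hlen] at key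
  rw [length_append_cons] at hφ
  have := hφ.pos_of_dominates (merge_dominates hc rfl dL (d.markers_mono (by omega) le_rfl) key)
    (by omega) (by omega)
  rwa [leftFunctional, LinearMap.comp_apply, LinearMap.mulRight_apply, ← mul_assoc]

lemma PositiveOn.right {A : ChordTree} (hc : IsChord lo N a c ((-1) ^ YB.length) α γ ρ' ρ σ)
    (hA : Cell A (leftVec z a N ρ' ((-1) ^ YB.length)) lo (a + 2) YA)
    (hφ : PositiveOn φ z lo N ((YA ++ chordVec z a c N α γ ρ' ρ σ :: YB).length + 4)) :
    PositiveOn (rightFunctional φ YA (chordVec z a c N α γ ρ' ρ σ))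
      (rightVec z c N ρ σ) (a + 1) (c + 2) (YB.length + 4) := by
  have := hc.lo_le; have := hc.add_two_le; have := hc.add_two_le_last
  have tA := hA.top_le
  intro M hM
  obtain ⟨J, hJ, d⟩ := hA.dominates
  have hlen := hM.2.2
  have dM := dominates_mon (z := rightVec z c N ρ σ) hM
  obtain ⟨M₁, f', hf', hM₁, rfl⟩ := hM.split_top
  obtain ⟨M₀, f, hf, hM₀, rfl⟩ := hM₁.split_top
  simp only [List.length_append, List.length_replicate] at hlen
  have hs : (-1 : ℝ) ^ (YB.length + 4) = (-1) ^ YB.length := by rw [pow_add]; norm_num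
  have key := merge_dominates_tail_fst hc hf hf' (by rw [hlen, hs])
    (d.admissible (a := lo) (h := a) fun x hx => by have := hJ x hx; omega) hM₀ (z := z)
    (fun hx => by have := hJ a hx; omega)
  rw [hlen] at key
  rw [length_append_cons] at hφ
  have := hφ.pos_of_dominates (merge_dominates hc hs (d.markers_mono (by omega) le_rfl) dM key)
    (by omega) (by omega)
  rwa [rightFunctional, LinearMap.comp_apply, LinearMap.mulLeft_apply]

section relations

variable (hc : IsChord lo N a c s α γ ρ' ρ σ) (hx : chordVec z a c N α γ ρ' ρ σ ∈ Y)

include hc hx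

lemma bracket_chord_head :
    bracket φ Y (z a) (z (a + 1)) (z c) (z N) +
      ρ * bracket φ Y (z a) (z (a + 1)) (z (c + 1)) (z N) = 0 := by
  have h := bracket_eq_zero_of_mem (φ := φ) hx (p := z a) (q := z (a + 1)) (t := z N)
    (by simp : _ ∈ [_, _, chordVec z a c N α γ ρ' ρ σ, _])
  simp only [chordVec, bracket_add_trd, bracket_smul_trd,
    bracket_eq_zero (show ¬ [z a, z (a + 1), z a, z N].Nodup by simp),
    bracket_eq_zero (show ¬ [z a, z (a + 1), z (a + 1), z N].Nodup by simp),
    bracket_eq_zero (show ¬ [z a, z (a + 1), z N, z N].Nodup by simp)] at h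
  have hγ : γ ≠ 0 := right_ne_zero_of_mul hc.head_pos.ne'
  refine (mul_eq_zero.1 ?_).resolve_left hγ
  linear_combination h

lemma bracket_chord_last :
    bracket φ Y (z a) (z (a + 1)) (z c) (z (c + 1)) =
      σ * bracket φ Y (z a) (z (a + 1)) (z (c + 1)) (z N) := by
  have h := bracket_eq_zero_of_mem (φ := φ) hx (p := z a) (q := z (a + 1)) (t := z (c + 1))
    (by simp : _ ∈ [_, _, chordVec z a c N α γ ρ' ρ σ, _])
  simp only [chordVec, bracket_add_trd, bracket_smul_trd,
    bracket_eq_zero (show ¬ [z a, z (a + 1), z a, z (c + 1)].Nodup by simp),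
    bracket_eq_zero (show ¬ [z a, z (a + 1), z (a + 1), z (c + 1)].Nodup by simp),
    bracket_eq_zero (show ¬ [z a, z (a + 1), z (c + 1), z (c + 1)].Nodup by simp),
    bracket_swap (z a) (z (a + 1)) (z (c + 1)) (z N)] at h
  have hγ : γ ≠ 0 := right_ne_zero_of_mul hc.head_pos.ne'
  rw [← sub_eq_zero]
  refine (mul_eq_zero.1 ?_).resolve_left hγ
  linear_combination h

omit hc in
lemma bracket_chord_ends :
    α * bracket φ Y (z a) (z (a + 1)) (z (c + 1)) (z N) +
      γ * bracket φ Y (z c) (z (a + 1)) (z (c + 1)) (z N) = 0 := by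
  have h := bracket_eq_zero_of_mem (φ := φ) hx (q := z (a + 1)) (r := z (c + 1)) (t := z N)
    (by simp : _ ∈ [chordVec z a c N α γ ρ' ρ σ, _, _, _])
  simp only [chordVec, bracket_add_fst, bracket_smul_fst,
    bracket_eq_zero (show ¬ [z (a + 1), z (a + 1), z (c + 1), z N].Nodup by simp),
    bracket_eq_zero (show ¬ [z (c + 1), z (a + 1), z (c + 1), z N].Nodup by simp),
    bracket_eq_zero (show ¬ [z N, z (a + 1), z (c + 1), z N].Nodup by simp)] at h
  linear_combination h

lemma bracket_chord_tail :
    bracket φ Y (z c) (z a) (z (c + 1)) (z N) +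
      ρ' * bracket φ Y (z c) (z (a + 1)) (z (c + 1)) (z N) = 0 := by
  have h := bracket_eq_zero_of_mem (φ := φ) hx (p := z c) (r := z (c + 1)) (t := z N)
    (by simp : _ ∈ [_, chordVec z a c N α γ ρ' ρ σ, _, _])
  simp only [chordVec, bracket_add_snd, bracket_smul_snd,
    bracket_eq_zero (show ¬ [z c, z c, z (c + 1), z N].Nodup by simp),
    bracket_eq_zero (show ¬ [z c, z (c + 1), z (c + 1), z N].Nodup by simp),
    bracket_eq_zero (show ¬ [z c, z N, z (c + 1), z N].Nodup by simp)] at h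
  refine (mul_eq_zero.1 ?_).resolve_left hc.tail_pos.ne'
  linear_combination h

end relations

lemma Cell.bracket_chord_pos {A B : ChordTree} (h : Cell (.node A a c B) z lo N Y)
    (hφ : PositiveOn φ z lo N (Y.length + 4)) :
    0 < bracket φ Y (z a) (z (a + 1)) (z (c + 1)) (z N) := by
  have h' := h
  obtain ⟨α, γ, ρ', ρ, σ, YA, YB, hc, -⟩ := h'
  have := hc.lo_le; have := hc.add_two_le; have := hc.add_two_le_last
  exact h.bracket_pos hφ hc.lo_le (by omega) (by omega) le_rfl

lemma Cell.lt_top {T A B : ChordTree} (h : Cell T z lo N Y)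
    (h' : Cell (.node A a c B) z lo N Y') (hφ : PositiveOn φ z lo N (Y.length + 4))
    (hψ : PositiveOn ψ z lo N (Y'.length + 4)) (hr : BracketRel φ ψ Y Y') : c < T.top := by
  by_contra! hT
  have hpos := h'.bracket_chord_pos hψ
  obtain ⟨α, γ, ρ', ρ, σ, YA, YB, hc, -, -, rfl⟩ := h'
  have := hc.lo_le; have := hc.add_two_le; have := hc.add_two_le_last
  have h1 := h.bracket_pos hφ hc.lo_le (show a + 1 < c by omega) (by omega) hT
  obtain ⟨κ, hκ, hr⟩ := hr
  rw [hr] at h1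
  have h2 := bracket_chord_head (φ := ψ) hc (z := z) (List.mem_append_cons_self (xs := YA) (ys := YB))
  have h3 := pos_of_mul_pos_right h1 hκ.le
  have h4 := mul_pos hc.head_ratio_pos hpos
  linarith

lemma Cell.tail_le {a' : ℕ} {A B A' B' : ChordTree} (h : Cell (.node A a c B) z lo N Y)
    (h' : Cell (.node A' a' c B') z lo N Y') (hφ : PositiveOn φ z lo N (Y.length + 4))
    (hψ : PositiveOn ψ z lo N (Y'.length + 4)) (hr : BracketRel φ ψ Y Y') : a' ≤ a := by
  by_contra! haa
  have p := h.bracket_chord_pos hφ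
  have p' := h'.bracket_chord_pos hψ
  obtain ⟨α, γ, ρ', ρ, σ, YA, YB, hc, hA, hB, rfl⟩ := h
  obtain ⟨α₁, γ₁, ρ₁', ρ₁, σ₁, YA₁, YB₁, hc₁, hA₁, hB₁, rfl⟩ := h'
  obtain ⟨κ, hκ, hr⟩ := hr
  have := hc.lo_le; have := hc.add_two_le; have := hc.add_two_le_last
  have := hc₁.lo_le; have := hc₁.add_two_le; have := hc₁.add_two_le_last
  have tB := hB.top_le
  have tA := hA₁.top_le
  have h1 := hB.bracket_pos (hφ.right hc hA) (show a + 1 ≤ a' by omega)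
    (show a' + 1 < c + 1 by omega) (by omega) (by omega)
  have h2 := hA₁.bracket_pos (hψ.left hc₁ hB₁) (show lo ≤ a by omega)
    (show a + 1 < a' + 1 by omega) (by omega) (by omega)
  rw [bracket_rightFunctional, rightVec_of_le _ _ _ _ _ (by omega),
    rightVec_of_le _ _ _ _ _ (by omega), rightVec_add_one, rightVec_add_two, bracket_add_fth,
    bracket_eq_zero (by simp), zero_add, bracket_smul_fth, bracket_add_trd,
    bracket_smul_trd] at h1
  rw [bracket_leftFunctional, leftVec_of_le _ _ _ _ _ (by omega),
    leftVec_of_le _ _ _ _ _ (by omega), leftVec_add_one, leftVec_add_two,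
    bracket_smul_fth] at h2
  have h3 := pos_of_mul_pos_right h1 hc.last_ratio_pos.le
  rw [hr, hr] at h3
  have h4 := bracket_chord_head (φ := ψ) hc₁ (z := z)
    (List.mem_append_cons_self (xs := YA₁) (ys := YB₁))
  have h5 := bracket_chord_head (φ := φ) hc (z := z)
    (List.mem_append_cons_self (xs := YA) (ys := YB))
  rw [hr, hr] at h5
  rw [hr] at p
  have h6 := bracket_eq_zero_of_mem (φ := ψ) (Y := YA₁ ++ chordVec z a' c N α₁ γ₁ ρ₁' ρ₁ σ₁ :: YB₁)
    (p := z a) (q := z (a + 1)) (t := z N) List.mem_append_cons_self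
    (by simp : _ ∈ [_, _, chordVec z a' c N α₁ γ₁ ρ₁' ρ₁ σ₁, _])
  generalize hy : YA₁ ++ chordVec z a' c N α₁ γ₁ ρ₁' ρ₁ σ₁ :: YB₁ = Y' at *
  simp only [chordVec, bracket_add_trd, bracket_smul_trd,
    bracket_eq_zero (show ¬ [z a, z (a + 1), z N, z N].Nodup by simp)] at h2 h6
  have h7 := hc₁.tail_pos
  have h8 := hc₁.head_pos
  have h9 : 0 < bracket ψ Y' (z a) (z (a + 1)) (z c) (z N) +
      ρ₁ * bracket ψ Y' (z a) (z (a + 1)) (z (c + 1)) (z N) := by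
    refine pos_of_mul_pos_right ?_ h8.le
    have := mul_pos h7 h2
    linear_combination this - (-1) ^ YB₁.length * h6
  have h10 := mul_pos hκ h9
  have h11 := pos_of_mul_pos_right (b := ρ₁ - ρ) (by linear_combination h10 + h5) p.le
  have h12 := pos_of_mul_pos_right (b := ρ - ρ₁) (by linear_combination h3 + κ * h4)
    (mul_pos hκ p').le
  linarith

lemma neg_one_pow_eq_of_pos {x : ℝ} {i j : ℕ} (hi : 0 < (-1 : ℝ) ^ i * x)
    (hj : 0 < (-1 : ℝ) ^ j * x) : (-1 : ℝ) ^ i = (-1) ^ j := by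
  rcases neg_one_pow_eq_or ℝ i with h | h <;> rcases neg_one_pow_eq_or ℝ j with h' | h' <;>
    rw [h] at hi ⊢ <;> rw [h'] at hj ⊢ <;> linarith

/-- Proportional points come from diagrams of the same shape. -/
theorem Cell.eq_of_bracketRel {T T' : ChordTree} (h : Cell T z lo N Y) (h' : Cell T' z lo N Y')
    (hφ : PositiveOn φ z lo N (Y.length + 4)) (hψ : PositiveOn ψ z lo N (Y'.length + 4))
    (hr : BracketRel φ ψ Y Y') : T = T' := by
  induction T generalizing z lo N Y Y' φ ψ T' with
  | nil =>
    cases T' with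
    | nil => rfl
    | node A' a' c' B' => exact absurd (h.lt_top h' hφ hψ hr) (Nat.not_lt_zero _)
  | node A a c B ihA ihB =>
    cases T' with
    | nil => exact absurd (h'.lt_top h hψ hφ hr.symm) (Nat.not_lt_zero _)
    | node A' a' c' B' =>
      obtain rfl : c = c' := le_antisymm (Nat.lt_succ_iff.1 (h'.lt_top h hψ hφ hr.symm))
        (Nat.lt_succ_iff.1 (h.lt_top h' hφ hψ hr))
      obtain rfl : a = a' := le_antisymm (h'.tail_le h hψ hφ hr.symm) (h.tail_le h' hφ hψ hr)
      have p' := h'.bracket_chord_pos hψ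
      obtain ⟨α, γ, ρ', ρ, σ, YA, YB, hc, hA, hB, rfl⟩ := h
      obtain ⟨α₁, γ₁, ρ₁', ρ₁, σ₁, YA₁, YB₁, hc₁, hA₁, hB₁, rfl⟩ := h'
      have lA := hφ.left hc hB
      have lB := hφ.right hc hA
      have lA₁ := hψ.left hc₁ hB₁
      have lB₁ := hψ.right hc₁ hA₁
      obtain ⟨κ, hκ, hr⟩ := hr
      have hm := List.mem_append_cons_self (xs := YA) (ys := YB)
        (a := chordVec z a c N α γ ρ' ρ σ)
      have hm₁ := List.mem_append_cons_self (xs := YA₁) (ys := YB₁)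
        (a := chordVec z a c N α₁ γ₁ ρ₁' ρ₁ σ₁)
      have e1 := bracket_chord_head (φ := φ) hc hm
      have e2 := bracket_chord_last (φ := φ) hc hm
      have e3 := bracket_chord_ends (φ := φ) hm
      have e4 := bracket_chord_tail (φ := φ) hc hm
      have f1 := bracket_chord_head (φ := ψ) hc₁ hm₁
      have f2 := bracket_chord_last (φ := ψ) hc₁ hm₁
      have f3 := bracket_chord_ends (φ := ψ) hm₁
      have f4 := bracket_chord_tail (φ := ψ) hc₁ hm₁
      simp only [hr] at e1 e2 e3 e4
      have hp := p'.ne'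
      have hκ' := hκ.ne'
      obtain rfl : ρ = ρ₁ := by
        refine mul_right_cancel₀ (mul_ne_zero hκ' hp) ?_
        linear_combination e1 - κ * f1
      obtain rfl : σ = σ₁ := by
        refine mul_right_cancel₀ (mul_ne_zero hκ' hp) ?_
        linear_combination κ * f2 - e2
      have q : bracket ψ (YA₁ ++ chordVec z a c N α₁ γ₁ ρ₁' ρ σ :: YB₁) (z c) (z (a + 1))
          (z (c + 1)) (z N) ≠ 0 := by
        intro hq
        rw [hq, mul_zero, add_zero] at f3
        exact (mul_pos hc₁.tail_pos p').ne' f3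
      obtain rfl : ρ' = ρ₁' := by
        refine mul_right_cancel₀ (mul_ne_zero hκ' q) ?_
        linear_combination e4 - κ * f4
      have hs : (-1 : ℝ) ^ YB.length = (-1) ^ YB₁.length := by
        have hγ : α₁ * γ = α * γ₁ := by
          refine mul_right_cancel₀ (mul_ne_zero hκ' q) ?_
          linear_combination α₁ * e3 - κ * α * f3
        refine neg_one_pow_eq_of_pos (x := α₁ * γ) ?_ ?_
        · linear_combination mul_pos hc₁.tail_pos hc.head_pos
        · rw [hγ]
          linear_combination mul_pos hc.tail_pos hc₁.head_pos
      rw [hs] at hA lA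
      rw [ihA hA hA₁ lA lA₁ ⟨κ, hκ, fun p q r t => by
          rw [bracket_leftFunctional, bracket_leftFunctional, hr]⟩,
        ihB hB hB₁ lB lB₁ ⟨κ, hκ, fun p q r t => by
          rw [bracket_rightFunctional, bracket_rightFunctional, hr]⟩]

end bracket

section conversion

variable {n k : ℕ} {D : ChordDiagram n k} {S S₁ S₂ : List (Fin k)} {r : Fin k} {lo N : ℕ}
  {α β γ δ ε : Fin k → ℝ} {y : Fin k → V}

/-- `c_l` has no ancestor among the chords in `S`. -/
def TopIn (D : ChordDiagram n k) (S : List (Fin k)) (l : Fin k) : Prop :=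
  ∀ m ∈ S, ¬ D.Descendant m l

/-- `c_m` is the ancestor of `c_l` with the largest start among the chords in `S`. -/
def ParentIn (D : ChordDiagram n k) (S : List (Fin k)) (m l : Fin k) : Prop :=
  m ∈ S ∧ D.Descendant m l ∧ ∀ m' ∈ S, D.Descendant m' l → D.tail m' ≤ D.tail m

/-- The sign rules for the subdiagram of `D` with chords `S` on the markers from `lo` to `N`. -/
structure SubRules (D : ChordDiagram n k) (S : List (Fin k)) (lo N : ℕ)
    (α β γ δ ε : Fin k → ℝ) : Prop where
  sorted : S.Pairwise fun l m => D.tail l < D.tail m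
  lo_le : ∀ l ∈ S, lo ≤ D.tail l
  le_last : ∀ l ∈ S, D.head l + 2 ≤ N
  tail_fst_pos : ∀ l ∈ S, 0 < α l
  tail_snd_pos : ∀ l ∈ S, 0 < β l
  head_fst_pos : ∀ l ∈ S, 0 < (-1 : ℝ) ^ S.countP (D.Descendant l ·) * γ l
  head_snd_pos : ∀ l ∈ S, 0 < (-1 : ℝ) ^ S.countP (D.Descendant l ·) * δ l
  top_pos : ∀ l ∈ S, TopIn D S l → 0 < (-1 : ℝ) ^ S.countP (D.tail l < D.tail ·) * ε l
  parent_pos : ∀ l ∈ S, ∀ m, ParentIn D S m l →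
    0 < (-1 : ℝ) ^ S.countP (fun h => D.Descendant m h ∧ D.tail h < D.tail l) * ε l
  ratio_lt_of_descendant : ∀ l ∈ S, ∀ m ∈ S, D.Descendant m l → D.head l = D.head m →
    δ l / γ l < δ m / γ m
  ratio_lt_of_head_eq_tail : ∀ l ∈ S, ∀ m ∈ S, D.head m = D.tail l → δ m / γ m < β l / α l

/-- The part of the row of `c_l` that is supported on the markers of `c_l`. -/
def ownRow (D : ChordDiagram n k) (α β γ δ : Fin k → ℝ) (z : ℕ → V) (l : Fin k) : V :=
  α l • z (D.tail l) + β l • z (D.tail l + 1) + (γ l • z (D.head l) + δ l • z (D.head l + 1))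

/-- `y` lists the rows of the domino matrix of the subdiagram with chords `S`. -/
structure SubRows (D : ChordDiagram n k) (S : List (Fin k)) (N : ℕ) (α β γ δ ε : Fin k → ℝ)
    (z : ℕ → V) (y : Fin k → V) : Prop where
  top_eq : ∀ l ∈ S, TopIn D S l → y l = ownRow D α β γ δ z l + ε l • z N
  parent_eq : ∀ l ∈ S, ∀ m, ParentIn D S m l →
    y l = ownRow D α β γ δ z l + ε l • (α m • z (D.tail m) + β m • z (D.tail m + 1))

/-- The chords in `S₁` lie to the left of `c_r` and those in `S₂` below it. -/
structure IsSplit (D : ChordDiagram n k) (S₁ : List (Fin k)) (r : Fin k) (S₂ : List (Fin k)) :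
    Prop where
  head_le : ∀ l ∈ S₁, D.head l ≤ D.tail r
  tail_lt : ∀ l ∈ S₂, D.tail r < D.tail l
  head_le_head : ∀ l ∈ S₂, D.head l ≤ D.head r

lemma head_le_head_of_tail_lt {l m : Fin k} (h : D.tail l < D.tail m) (h' : D.tail m < D.head l) :
    D.head m ≤ D.head l := by
  have := D.noncrossing l m (D.tail_strictMono.lt_iff_lt.1 h)
  omega

lemma exists_isSplit (hS : S.Pairwise fun l m => D.tail l < D.tail m) (hne : S ≠ []) :
    ∃ S₁ r S₂, S = S₁ ++ r :: S₂ ∧ IsSplit D S₁ r S₂ := by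
  induction S with
  | nil => exact absurd rfl hne
  | cons x S ih =>
    obtain ⟨hx, hS⟩ := List.pairwise_cons.1 hS
    by_cases h : ∀ m ∈ S, D.tail m < D.head x
    · exact ⟨[], x, S, rfl, by simp, hx, fun l hl => head_le_head_of_tail_lt (hx l hl) (h l hl)⟩
    · push Not at h
      obtain ⟨m, hm, hxm⟩ := h
      obtain ⟨S₁, r, S₂, rfl, hs⟩ := ih hS (List.ne_nil_of_mem hm)
      refine ⟨x :: S₁, r, S₂, rfl, fun l hl => ?_, hs.tail_lt, hs.head_le_head⟩
      rcases List.mem_cons.1 hl with rfl | hl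
      · have hr := hx r (by simp)
        have := D.tail_add_two_le_head m
        rcases List.mem_append.1 hm with hm | hm
        · have := hs.head_le m hm; omega
        rcases List.mem_cons.1 hm with rfl | hm
        · exact hxm
        · by_contra! hlt
          have := head_le_head_of_tail_lt hr hlt
          have := hs.head_le_head m hm
          omega
      · exact hs.head_le l hl

lemma countP_tail_lt_add (hS : S.Pairwise fun l m => D.tail l < D.tail m) {l : Fin k}
    (hl : l ∈ S) :
    S.countP (D.tail · < D.tail l) + S.countP (D.tail l < D.tail ·) + 1 = S.length := by
  obtain ⟨s, t, rfl⟩ := List.append_of_mem hl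
  rw [List.pairwise_append, List.pairwise_cons] at hS
  obtain ⟨-, ⟨ht, -⟩, hs⟩ := hS
  have hs' : ∀ x ∈ s, D.tail x < D.tail l := fun x hx => hs x hx l List.mem_cons_self
  have h1 : s.countP (D.tail · < D.tail l) = s.length :=
    List.countP_eq_length.2 (by simpa using hs')
  have h2 : t.countP (D.tail l < D.tail ·) = t.length :=
    List.countP_eq_length.2 (by simpa using ht)
  have h3 : s.countP (D.tail l < D.tail ·) = 0 :=
    List.countP_eq_zero.2 (by simpa using fun x hx => (hs' x hx).le)
  have h4 : t.countP (D.tail · < D.tail l) = 0 :=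
    List.countP_eq_zero.2 (by simpa using fun x hx => (ht x hx).le)
  simp [h1, h2, h3, h4]
  omega

/-- The coefficients at the first head marker after the shear at the marker `c`. -/
def shearFst (D : ChordDiagram n k) (c : ℕ) (ρ : ℝ) (γ δ : Fin k → ℝ) (l : Fin k) : ℝ :=
  if D.head l = c then γ l - δ l / ρ else γ l

/-- The coefficients at the second head marker after the shear at the marker `c`. -/
def shearSnd (D : ChordDiagram n k) (c : ℕ) (ρ : ℝ) (δ : Fin k → ℝ) (l : Fin k) : ℝ :=
  if D.head l = c then δ l / ρ else δ l

section shear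

variable {c : ℕ} {ρ : ℝ} {l m : Fin k} {s : ℝ}

lemma ownRow_shear {w : ℕ → V} (hρ : 0 < ρ) (hw : ∀ i ≤ c, w i = z i)
    (hw' : w (c + 1) = z c + ρ • z (c + 1)) (hl : D.head l ≤ c) :
    ownRow D α β (shearFst D c ρ γ δ) (shearSnd D c ρ δ) w l = ownRow D α β γ δ z l := by
  have := D.tail_add_two_le_head l
  rw [ownRow, ownRow, hw _ (by omega), hw _ (by omega), hw _ hl]
  congr 1
  by_cases h : D.head l = c
  · simp only [shearFst, shearSnd, h, if_true, hw', smul_add, smul_smul, sub_smul,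
      div_mul_cancel₀ _ hρ.ne']
    abel
  · simp only [shearFst, shearSnd, h, if_false]
    rw [hw _ (by omega)]

lemma shearFst_pos (hρ : 0 < ρ) (hγ : 0 < s * γ l) (h : D.head l = c → δ l / γ l < ρ) :
    0 < s * shearFst D c ρ γ δ l := by
  rw [shearFst]
  split_ifs with hc
  · have hγ' : γ l ≠ 0 := right_ne_zero_of_mul hγ.ne'
    have : s * (γ l - δ l / ρ) = s * γ l * (1 - δ l / γ l / ρ) := by field_simp
    rw [this]
    exact mul_pos hγ (sub_pos.2 ((div_lt_one hρ).2 (h hc)))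
  · exact hγ

lemma shearSnd_pos (hρ : 0 < ρ) (hδ : 0 < s * δ l) : 0 < s * shearSnd D c ρ δ l := by
  rw [shearSnd]
  split_ifs
  · rw [← mul_div_assoc]
    exact div_pos hδ hρ
  · exact hδ

lemma shear_ratio_lt (hρ : 0 < ρ) (hγ : γ l ≠ 0) (hγ' : γ m ≠ 0)
    (h : D.head m = c → δ m / γ m < ρ) (hlm : D.head l = D.head m)
    (hr : δ l / γ l < δ m / γ m) :
    shearSnd D c ρ δ l / shearFst D c ρ γ δ l < shearSnd D c ρ δ m / shearFst D c ρ γ δ m := by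
  simp only [shearFst, shearSnd, hlm]
  split_ifs with hc
  · have e : ∀ x, γ x ≠ 0 → δ x / ρ / (γ x - δ x / ρ) = δ x / γ x / (ρ - δ x / γ x) := by
      intro x hx
      have : ρ - δ x / γ x = ρ / γ x * (γ x - δ x / ρ) := by field_simp
      rw [this]
      by_cases h0 : γ x - δ x / ρ = 0
      · simp [h0]
      · field_simp
    rw [e _ hγ, e _ hγ']
    have h1 := h hc
    rw [div_lt_div_iff₀ (by linarith) (by linarith)]
    nlinarith
  · exact hr

end shear

section split

lemma IsSplit.not_descendant_left (hs : IsSplit D S₁ r S₂) {l m : Fin k} (hl : l ∈ S₁)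
    (hm : m ∈ r :: S₂) : ¬ D.Descendant m l ∧ ¬ D.Descendant l m := by
  have := hs.head_le l hl
  have := D.tail_add_two_le_head l
  have := D.tail_add_two_le_head m
  have : D.tail r ≤ D.tail m := by
    rcases List.mem_cons.1 hm with rfl | hm
    · rfl
    · exact (hs.tail_lt m hm).le
  constructor <;> rintro ⟨h1, h2⟩ <;> omega

lemma IsSplit.descendant (hs : IsSplit D S₁ r S₂) {l : Fin k} (hl : l ∈ S₂) :
    D.Descendant r l := ⟨hs.tail_lt l hl, hs.head_le_head l hl⟩

lemma IsSplit.tail_le_of_mem (hs : IsSplit D S₁ r S₂) {l : Fin k} (hl : l ∈ S₁ ++ [r]) :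
    D.tail l ≤ D.tail r := by
  rcases List.mem_append.1 hl with hl | hl
  · have := hs.head_le l hl
    have := D.tail_add_two_le_head l
    omega
  · rw [List.mem_singleton.1 hl]

lemma countP_left {p : Fin k → Prop} [DecidablePred p]
    (hp : ∀ l ∈ r :: S₂, ¬ p l) : (S₁ ++ r :: S₂).countP (p ·) = S₁.countP (p ·) := by
  rw [List.countP_append, (List.countP_eq_zero (l := r :: S₂)).2 (by simpa using hp), add_zero]

lemma countP_right {p : Fin k → Prop} [DecidablePred p] (hp : ∀ l ∈ S₁ ++ [r], ¬ p l) :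
    (S₁ ++ r :: S₂).countP (p ·) = S₂.countP (p ·) := by
  rw [List.append_cons, List.countP_append,
    (List.countP_eq_zero (l := S₁ ++ [r])).2 (by simpa using hp), zero_add]

lemma IsSplit.topIn_left (hs : IsSplit D S₁ r S₂) {l : Fin k} (hl : l ∈ S₁)
    (h : TopIn D S₁ l) : TopIn D (S₁ ++ r :: S₂) l := by
  intro m hm
  rcases List.mem_append.1 hm with hm | hm
  · exact h m hm
  · exact (hs.not_descendant_left hl hm).1

lemma IsSplit.parentIn_left (hs : IsSplit D S₁ r S₂) {l m : Fin k} (hl : l ∈ S₁)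
    (h : ParentIn D S₁ m l) : ParentIn D (S₁ ++ r :: S₂) m l := by
  refine ⟨List.mem_append_left _ h.1, h.2.1, fun m' hm' hd => ?_⟩
  rcases List.mem_append.1 hm' with hm' | hm'
  · exact h.2.2 m' hm' hd
  · exact absurd hd (hs.not_descendant_left hl hm').1

lemma IsSplit.topIn (hs : IsSplit D S₁ r S₂) : TopIn D (S₁ ++ r :: S₂) r := by
  intro m hm hd
  rcases List.mem_append.1 hm with hm | hm
  · exact (hs.not_descendant_left hm List.mem_cons_self).2 hd
  rcases List.mem_cons.1 hm with rfl | hm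
  · exact lt_irrefl _ hd.1
  · exact lt_asymm (hs.tail_lt m hm) hd.1

lemma IsSplit.parentIn_of_topIn (hs : IsSplit D S₁ r S₂) {l : Fin k} (hl : l ∈ S₂)
    (h : TopIn D S₂ l) : ParentIn D (S₁ ++ r :: S₂) r l := by
  refine ⟨by simp, hs.descendant hl, fun m hm hd => ?_⟩
  rw [List.append_cons, List.mem_append] at hm
  rcases hm with hm | hm
  · exact hs.tail_le_of_mem hm
  · exact absurd hd (h m hm)

lemma IsSplit.parentIn_right (hs : IsSplit D S₁ r S₂) {l m : Fin k}
    (h : ParentIn D S₂ m l) : ParentIn D (S₁ ++ r :: S₂) m l := by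
  refine ⟨by simp [h.1], h.2.1, fun m' hm' hd => ?_⟩
  rw [List.append_cons, List.mem_append] at hm'
  rcases hm' with hm' | hm'
  · exact (hs.tail_le_of_mem hm').trans (hs.tail_lt m h.1).le
  · exact h.2.2 m' hm' hd

lemma ParentIn.not_topIn {l m : Fin k} (h : ParentIn D S m l) : ¬ TopIn D S l :=
  fun ht => ht m h.1 h.2.1

lemma SubRules.head_fst_ne_zero (h : SubRules D S lo N α β γ δ ε) {l : Fin k}
    (hl : l ∈ S) : γ l ≠ 0 :=
  right_ne_zero_of_mul (h.head_fst_pos l hl).ne'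

section rules

variable (hs : IsSplit D S₁ r S₂) (h : SubRules D (S₁ ++ r :: S₂) lo N α β γ δ ε)

include h

lemma SubRules.tail_ratio_pos : 0 < β r / α r :=
  div_pos (h.tail_snd_pos r (by simp)) (h.tail_fst_pos r (by simp))

lemma SubRules.head_ratio_pos : 0 < δ r / γ r := by
  rw [← mul_div_mul_left (δ r) (γ r) (left_ne_zero_of_mul (h.head_fst_pos r (by simp)).ne')]
  exact div_pos (h.head_snd_pos r (by simp)) (h.head_fst_pos r (by simp))

include hs

lemma IsSplit.sign_pos : 0 < (-1 : ℝ) ^ S₂.length * γ r := by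
  have := h.head_fst_pos r (by simp)
  rwa [countP_right fun l hl hd => (hs.tail_le_of_mem hl).not_gt hd.1,
    List.countP_eq_length.2 (by simpa using fun l hl => hs.descendant hl)] at this

lemma SubRules.last_ratio_pos : 0 < ε r / γ r := by
  have h1 := h.top_pos r (by simp) hs.topIn
  have h2 := hs.sign_pos h
  rw [countP_right fun l hl => (hs.tail_le_of_mem hl).not_gt,
    List.countP_eq_length.2 (by simpa using hs.tail_lt)] at h1
  rw [← mul_div_mul_left (ε r) (γ r) (left_ne_zero_of_mul h2.ne')]
  exact div_pos h1 h2

lemma SubRules.isChord {s : ℝ} (hs' : s = (-1) ^ S₂.length) :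
    IsChord lo N (D.tail r) (D.head r) s (α r) (γ r) (β r / α r) (δ r / γ r) (ε r / γ r) where
  lo_le := h.lo_le r (by simp)
  add_two_le := D.tail_add_two_le_head r
  add_two_le_last := h.le_last r (by simp)
  tail_pos := h.tail_fst_pos r (by simp)
  head_pos := hs' ▸ hs.sign_pos h
  tail_ratio_pos := h.tail_ratio_pos
  head_ratio_pos := h.head_ratio_pos
  last_ratio_pos := h.last_ratio_pos hs

/-- The subdiagram to the left of the last top chord satisfies the sign rules. -/
lemma SubRules.left : SubRules D S₁ lo (D.tail r + 2) α β
    (shearFst D (D.tail r) (β r / α r) γ δ) (shearSnd D (D.tail r) (β r / α r) δ)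
    (fun l => if TopIn D S₁ l then -(-1) ^ S₂.length * ε l else ε l) := by
  have hsub : ∀ l ∈ S₁, l ∈ S₁ ++ r :: S₂ := fun l => List.mem_append_left _
  have hρ := h.tail_ratio_pos
  have hr : r ∈ S₁ ++ r :: S₂ := by simp
  have hlt : ∀ l ∈ S₁, D.head l = D.tail r → δ l / γ l < β r / α r := fun l hl =>
    h.ratio_lt_of_head_eq_tail r hr l (hsub l hl)
  have hcount : ∀ l ∈ S₁, (S₁ ++ r :: S₂).countP (D.Descendant l ·) =
      S₁.countP (D.Descendant l ·) :=
    fun l hl => countP_left fun m hm => (hs.not_descendant_left hl hm).2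
  have htail : ∀ l ∈ S₁, ∀ m ∈ r :: S₂, D.tail l < D.tail m := fun l hl m hm =>
    (List.pairwise_append.1 h.sorted).2.2 l hl m hm
  refine ⟨(List.pairwise_append.1 h.sorted).1, fun l hl => h.lo_le l (hsub l hl),
    fun l hl => Nat.add_le_add_right (hs.head_le l hl) 2,
    fun l hl => h.tail_fst_pos l (hsub l hl), fun l hl => h.tail_snd_pos l (hsub l hl),
    fun l hl => shearFst_pos hρ (hcount l hl ▸ h.head_fst_pos l (hsub l hl)) (hlt l hl),
    fun l hl => shearSnd_pos hρ (hcount l hl ▸ h.head_snd_pos l (hsub l hl)),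
    fun l hl ht => ?_, fun l hl m hm => ?_,
    fun l hl m hm hd he => shear_ratio_lt hρ (h.head_fst_ne_zero (hsub l hl))
      (h.head_fst_ne_zero (hsub m hm)) (hlt m hm) he
      (h.ratio_lt_of_descendant l (hsub l hl) m (hsub m hm) hd he),
    fun l hl m hm he => ?_⟩
  · have := h.top_pos l (hsub l hl) (hs.topIn_left hl ht)
    rw [List.countP_append, (List.countP_eq_length (l := r :: S₂)).2 (by simpa using htail l hl),
      List.length_cons] at this
    simp only [if_pos ht]
    refine this.trans_eq ?_
    ring
  · have := h.parent_pos l (hsub l hl) m (hs.parentIn_left hl hm)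
    rw [countP_left fun x hx hd => (htail l hl x hx).not_gt hd.2] at this
    simpa only [if_neg hm.not_topIn] using this
  · have h1 := h.ratio_lt_of_head_eq_tail l (hsub l hl) m (hsub m hm) he
    have h2 : D.head m ≠ D.tail r := (he.trans_lt (htail l hl r List.mem_cons_self)).ne
    simpa only [shearFst, shearSnd, if_neg h2] using h1

/-- The subdiagram below the last top chord satisfies the sign rules. -/
lemma SubRules.right : SubRules D S₂ (D.tail r + 1) (D.head r + 2) α β
    (shearFst D (D.head r) (δ r / γ r) γ δ) (shearSnd D (D.head r) (δ r / γ r) δ)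
    (fun l => if TopIn D S₂ l then -γ r * ε l else ε l) := by
  have hsub : ∀ l ∈ S₂, l ∈ S₁ ++ r :: S₂ := fun l hl => by simp [hl]
  have hρ := h.head_ratio_pos
  have hr : r ∈ S₁ ++ r :: S₂ := by simp
  have hlt : ∀ l ∈ S₂, D.head l = D.head r → δ l / γ l < δ r / γ r := fun l hl =>
    h.ratio_lt_of_descendant l (hsub l hl) r hr (hs.descendant hl)
  have hcount : ∀ l ∈ S₂, (S₁ ++ r :: S₂).countP (D.Descendant l ·) =
      S₂.countP (D.Descendant l ·) :=
    fun l hl => countP_right fun m hm hd =>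
      ((hs.tail_le_of_mem hm).trans_lt (hs.tail_lt l hl)).not_gt hd.1
  have hsort : S₂.Pairwise fun l m => D.tail l < D.tail m :=
    (List.pairwise_cons.1 (List.pairwise_append.1 h.sorted).2.1).2
  refine ⟨hsort, hs.tail_lt,
    fun l hl => Nat.add_le_add_right (hs.head_le_head l hl) 2,
    fun l hl => h.tail_fst_pos l (hsub l hl), fun l hl => h.tail_snd_pos l (hsub l hl),
    fun l hl => shearFst_pos hρ (hcount l hl ▸ h.head_fst_pos l (hsub l hl)) (hlt l hl),
    fun l hl => shearSnd_pos hρ (hcount l hl ▸ h.head_snd_pos l (hsub l hl)),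
    fun l hl ht => ?_, fun l hl m hm => ?_,
    fun l hl m hm hd he => shear_ratio_lt hρ (h.head_fst_ne_zero (hsub l hl))
      (h.head_fst_ne_zero (hsub m hm)) (hlt m hm) he
      (h.ratio_lt_of_descendant l (hsub l hl) m (hsub m hm) hd he),
    fun l hl m hm he => ?_⟩
  · have h1 := h.parent_pos l (hsub l hl) r (hs.parentIn_of_topIn hl ht)
    rw [countP_right fun x hx hd => (hs.tail_le_of_mem hx).not_gt hd.1.1,
      List.countP_congr (q := (D.tail · < D.tail l))
        (by simpa using fun x hx _ => hs.descendant hx)] at h1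
    have h2 := mul_pos (hs.sign_pos h) h1
    rw [← countP_tail_lt_add hsort hl] at h2
    simp only [if_pos ht]
    refine h2.trans_eq ?_
    rw [pow_succ, pow_add]
    have h3 : ((-1 : ℝ) ^ S₂.countP (D.tail · < D.tail l)) *
      (-1) ^ S₂.countP (D.tail · < D.tail l) = 1 := by rw [← mul_pow]; norm_num
    linear_combination -γ r * ε l * (-1) ^ S₂.countP (D.tail l < D.tail ·) * h3
  · have := h.parent_pos l (hsub l hl) m (hs.parentIn_right hm)
    rw [countP_right fun x hx hd =>
      ((hs.tail_le_of_mem hx).trans_lt (hs.tail_lt m hm.1)).not_gt hd.1.1] at this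
    simpa only [if_neg hm.not_topIn] using this
  · have h1 := h.ratio_lt_of_head_eq_tail l (hsub l hl) m (hsub m hm) he
    have h2 : D.head m ≠ D.head r := by
      have := D.tail_add_two_le_head l
      have := hs.head_le_head l hl
      omega
    simpa only [shearFst, shearSnd, if_neg h2] using h1

variable (hy : SubRows D (S₁ ++ r :: S₂) N α β γ δ ε z y)

include hy

lemma SubRows.eq_chordVec : y r = chordVec z (D.tail r) (D.head r) N (α r) (γ r)
    (β r / α r) (δ r / γ r) (ε r / γ r) := by
  have hα := (h.tail_fst_pos r (by simp)).ne'
  have hγ := h.head_fst_ne_zero (l := r) (by simp)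
  rw [hy.top_eq r (by simp) hs.topIn, ownRow, chordVec]
  simp only [smul_add, smul_smul, mul_div_cancel₀ _ hα, mul_div_cancel₀ _ hγ]
  abel

lemma SubRows.left : SubRows D S₁ (D.tail r + 2) α β
    (shearFst D (D.tail r) (β r / α r) γ δ) (shearSnd D (D.tail r) (β r / α r) δ)
    (fun l => if TopIn D S₁ l then -(-1) ^ S₂.length * ε l else ε l)
    (leftVec z (D.tail r) N (β r / α r) ((-1) ^ S₂.length)) y := by
  have hsub : ∀ l ∈ S₁, l ∈ S₁ ++ r :: S₂ := fun l => List.mem_append_left _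
  have hrow : ∀ l ∈ S₁, _ := fun l hl => ownRow_shear (α := α) (β := β) (γ := γ) (δ := δ)
    h.tail_ratio_pos (fun i hi => leftVec_of_le z _ N _ ((-1) ^ S₂.length) hi)
    (leftVec_add_one z (D.tail r) N _ _) (hs.head_le l hl)
  refine ⟨fun l hl ht => ?_, fun l hl m hm => ?_⟩
  · rw [hy.top_eq l (hsub l hl) (hs.topIn_left hl ht), hrow l hl, leftVec_add_two, if_pos ht,
      smul_smul]
    congr 2
    have : (-1 : ℝ) ^ S₂.length * (-1) ^ S₂.length = 1 := by rw [← mul_pow]; norm_num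
    linear_combination -ε l * this
  · have h1 := hs.head_le m hm.1
    have h2 := D.tail_add_two_le_head m
    rw [hy.parent_eq l (hsub l hl) m (hs.parentIn_left hl hm), hrow l hl, if_neg hm.not_topIn,
      leftVec_of_le _ _ _ _ _ (by omega), leftVec_of_le _ _ _ _ _ (by omega)]

lemma SubRows.right : SubRows D S₂ (D.head r + 2) α β
    (shearFst D (D.head r) (δ r / γ r) γ δ) (shearSnd D (D.head r) (δ r / γ r) δ)
    (fun l => if TopIn D S₂ l then -γ r * ε l else ε l)
    (rightVec z (D.head r) N (δ r / γ r) (ε r / γ r))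
    (fun l => y l - (if TopIn D S₂ l then ε l else 0) • y r) := by
  have hsub : ∀ l ∈ S₂, l ∈ S₁ ++ r :: S₂ := fun l hl => by simp [hl]
  have hrow : ∀ l ∈ S₂, _ := fun l hl => ownRow_shear (α := α) (β := β) (γ := γ) (δ := δ)
    h.head_ratio_pos (fun i hi => rightVec_of_le z _ N _ (ε r / γ r) hi)
    (rightVec_add_one z (D.head r) N _ _) (hs.head_le_head l hl)
  refine ⟨fun l hl ht => ?_, fun l hl m hm => ?_⟩
  · have hα := (h.tail_fst_pos r (by simp)).ne'
    rw [hy.parent_eq l (hsub l hl) r (hs.parentIn_of_topIn hl ht), hrow l hl, rightVec_add_two,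
      if_pos ht, if_pos ht, hy.eq_chordVec hs h, chordVec, smul_add (α r), smul_smul (α r),
      mul_div_cancel₀ _ hα]
    module
  · have h1 := hs.head_le_head m hm.1
    have h2 := D.tail_add_two_le_head m
    rw [hy.parent_eq l (hsub l hl) m (hs.parentIn_right hm), hrow l hl, if_neg hm.not_topIn,
      if_neg hm.not_topIn, rightVec_of_le _ _ _ _ _ (by omega), rightVec_of_le _ _ _ _ _ (by omega),
      zero_smul, sub_zero]

end rules

lemma ι_mul_wedge_map_sub (x : V) (c : Fin k → ℝ) (l : List (Fin k)) :
    ExteriorAlgebra.ι ℝ x * wedge (l.map fun i => y i - c i • x) =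
      ExteriorAlgebra.ι ℝ x * wedge (l.map y) := by
  induction l with
  | nil => rfl
  | cons i l ih =>
    have h (w : V) : ExteriorAlgebra.ι ℝ x * ExteriorAlgebra.ι ℝ w =
        -(ExteriorAlgebra.ι ℝ w * ExteriorAlgebra.ι ℝ x) := ι_mul_ι_comm x w
    simp only [List.map_cons, wedge_cons, ← mul_assoc]
    rw [map_sub, map_smul, mul_sub, mul_smul_comm, ExteriorAlgebra.ι_sq_zero, smul_zero, sub_zero,
      h, neg_mul, neg_mul, mul_assoc, mul_assoc, ih]

/-- The rows of a domino matrix span the same space as a point of a cell of the same shape. -/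
theorem exists_cell (h : SubRules D S lo N α β γ δ ε) (hy : SubRows D S N α β γ δ ε z y) :
    ∃ T Y, Cell T z lo N Y ∧ wedge Y = wedge (S.map y) ∧ Y.length = S.length ∧
      T.chords = S.map fun l => (D.tail l, D.head l) := by
  induction hlen : S.length using Nat.strong_induction_on generalizing S z lo N γ δ ε y with
  | _ j ih =>
    subst hlen
    rcases eq_or_ne S [] with rfl | hne
    · exact ⟨.nil, [], rfl, rfl, rfl, rfl⟩
    obtain ⟨S₁, r, S₂, rfl, hs⟩ := exists_isSplit h.sorted hne
    obtain ⟨A, YA, hA, wA, lA, cA⟩ := ih S₁.length (by simp) (h.left hs)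
      (hy.left hs h) rfl
    obtain ⟨B, YB, hB, wB, lB, cB⟩ := ih S₂.length (by simp; omega) (h.right hs)
      (hy.right hs h) rfl
    refine ⟨.node A (D.tail r) (D.head r) B, YA ++ y r :: YB, ⟨α r, γ r, β r / α r, δ r / γ r,
      ε r / γ r, YA, YB, h.isChord hs (by rw [lB]), by rwa [lB], hB,
      by rw [hy.eq_chordVec hs h]⟩, ?_, ?_, ?_⟩
    · rw [wedge_append, wedge_cons, wA, wB, ι_mul_wedge_map_sub, List.map_append, wedge_append,
        List.map_cons, wedge_cons]
    · simp [lA, lB]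
    · simp [ChordTree.chords, cA, cB]

end split

end conversion

section domino

variable {n k : ℕ} {D : ChordDiagram n k} {α β γ δ ε : Fin k → ℝ}

lemma topIn_finRange {l : Fin k} : TopIn D (List.finRange k) l ↔ D.IsTop l := by
  simp [TopIn, ChordDiagram.IsTop]

lemma parentIn_finRange {l m : Fin k} : ParentIn D (List.finRange k) m l ↔ D.IsParent m l := by
  simp [ParentIn, ChordDiagram.IsParent]

lemma countP_finRange (p : Fin k → Prop) [DecidablePred p] :
    (List.finRange k).countP (p ·) = (Finset.univ.filter p).card := by
  rw [List.countP_eq_length_filter]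
  rfl

lemma exists_isParent {l m : Fin k} (h : D.Descendant m l) : ∃ p, D.IsParent p l := by
  obtain ⟨p, hp, hmax⟩ := Finset.exists_max_image (Finset.univ.filter (D.Descendant · l)) D.tail
    ⟨m, by simpa using h⟩
  exact ⟨p, by simpa using hp, fun m' hm' => hmax m' (by simpa using hm')⟩

/-- The ratio rule for chords with a common head propagates from parents to all ancestors. -/
lemma ratio_lt_of_descendant
    (h : ∀ l m, D.IsParent m l → D.head l = D.head m → δ l / γ l < δ m / γ m) {l m : Fin k}
    (hd : D.Descendant m l) (he : D.head l = D.head m) : δ l / γ l < δ m / γ m := by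
  induction ht : D.tail l using Nat.strong_induction_on generalizing l with
  | _ j ih =>
    subst ht
    obtain ⟨p, hp⟩ := exists_isParent hd
    rcases (hp.2 m hd).lt_or_eq with hlt | heq
    · have h1 := D.tail_add_two_le_head l
      have h2 := hp.1.1
      have h3 := hp.1.2
      have h4 := head_le_head_of_tail_lt hlt (by omega)
      have h5 : D.head l = D.head p := by omega
      exact (h l p hp h5).trans (ih _ h2 ⟨hlt, h4⟩ (by omega) rfl)
    · obtain rfl := D.tail_strictMono.injective heq
      exact h l m hp he

lemma subRules_finRange (h : D.SignRules α β γ δ ε) :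
    SubRules D (List.finRange k) 1 n α β γ δ ε := by
  obtain ⟨hα, hβ, hγ, hδ, htop, hparent, hdesc, hht⟩ := h
  refine ⟨(List.pairwise_lt_finRange k).imp fun h => D.tail_strictMono h,
    fun l _ => D.one_le_tail l, fun l _ => D.head_add_two_le l, fun l _ => hα l, fun l _ => hβ l,
    fun l _ => ?_, fun l _ => ?_, fun l _ ht => ?_, fun l _ m hm => ?_,
    fun l _ m _ => ratio_lt_of_descendant hdesc, fun l _ m _ => hht l m⟩
  · rw [countP_finRange]; exact hγ l
  · rw [countP_finRange]; exact hδ l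
  · rw [countP_finRange]; convert htop l (topIn_finRange.1 ht)
    rw [ChordDiagram.behind]
  · rw [countP_finRange]; convert hparent l m (parentIn_finRange.1 hm)
    rw [ChordDiagram.beyond]

lemma sum_marker_smul {w : ℕ} (Z : Matrix (Fin n) (Fin w) ℝ) {p : ℕ} (hp : 1 ≤ p) (x : ℝ) :
    ∑ a : Fin n, (if (a : ℕ) + 1 = p then x else 0) • Z a = x • markerRow Z p := by
  rw [markerRow]
  split_ifs with h
  · rw [Finset.sum_eq_single_of_mem ⟨p - 1, h⟩ (Finset.mem_univ _) fun a _ ha => ?_]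
    · rw [if_pos (by simp; omega)]
    · rw [if_neg fun h' => ha (Fin.ext (by simp; omega)), zero_smul]
  · rw [smul_zero]
    exact Finset.sum_eq_zero fun a _ => by rw [if_neg (by omega), zero_smul]

lemma dominoMatrix_mul_row {w : ℕ} (Z : Matrix (Fin n) (Fin w) ℝ) (l : Fin k) :
    (D.dominoMatrix α β γ δ ε * Z) l = ownRow D α β γ δ (markerRow Z) l +
      (if D.IsTop l then ε l • markerRow Z n else 0) +
      ∑ m, if D.IsParent m l then
        ε l • (α m • markerRow Z (D.tail m) + β m • markerRow Z (D.tail m + 1)) else 0 := by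
  have h1 := D.one_le_tail
  have h2 := D.tail_add_two_le_head l
  have h3 := D.head_add_two_le l
  have h4 := h1 l
  have row : (D.dominoMatrix α β γ δ ε * Z) l =
      ∑ a, D.dominoMatrix α β γ δ ε l a • Z a := by
    ext b
    simp [Matrix.mul_apply]
  have hsum (m : Fin k) : (∑ a : Fin n, (if D.IsParent m l then
        (if (a : ℕ) + 1 = D.tail m then ε l * α m else 0) +
        (if (a : ℕ) + 1 = D.tail m + 1 then ε l * β m else 0)
      else 0) • Z a) = if D.IsParent m l then
        ε l • (α m • markerRow Z (D.tail m) + β m • markerRow Z (D.tail m + 1)) else 0 := by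
    split_ifs
    · simp only [add_smul, Finset.sum_add_distrib, sum_marker_smul Z (h1 m),
        sum_marker_smul Z (Nat.le_add_left 1 (D.tail m)), smul_add, mul_smul]
    · simp
  have htop : (∑ a : Fin n, (if D.IsTop l ∧ (a : ℕ) + 1 = n then ε l else 0) • Z a) =
      if D.IsTop l then ε l • markerRow Z n else 0 := by
    split_ifs with ht
    · simp only [ht, true_and]
      exact sum_marker_smul Z (by omega) _
    · simp [ht]
  rw [row]
  simp only [ChordDiagram.dominoMatrix, Matrix.of_apply, add_smul, Finset.sum_add_distrib,
    Finset.sum_smul, htop]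
  rw [Finset.sum_comm]
  simp only [hsum]
  rw [sum_marker_smul Z (by omega), sum_marker_smul Z (by omega), sum_marker_smul Z (by omega),
    sum_marker_smul Z (by omega), ownRow, add_assoc (_ + _) (_ • _) (_ • _)]

lemma subRows_finRange {w : ℕ} (Z : Matrix (Fin n) (Fin w) ℝ) :
    SubRows D (List.finRange k) n α β γ δ ε (markerRow Z)
      fun l => (D.dominoMatrix α β γ δ ε * Z) l := by
  refine ⟨fun l _ ht => ?_, fun l _ m hm => ?_⟩
  · rw [topIn_finRange] at ht
    rw [dominoMatrix_mul_row, if_pos ht, Finset.sum_eq_zero, add_zero]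
    exact fun m _ => if_neg fun hp => ht m hp.1
  · rw [parentIn_finRange] at hm
    rw [dominoMatrix_mul_row, if_neg fun ht => ht m hm.1, add_zero,
      Finset.sum_eq_single_of_mem m (Finset.mem_univ m) fun p _ hpm => if_neg fun hp => ?_,
      if_pos hm]
    exact hpm (D.tail_strictMono.injective (le_antisymm (hm.2 p hp.1) (hp.2 m hm.1)))

end domino

section determinant

variable {n k w : ℕ}

lemma wedge_ofFn (v : Fin k → V) : wedge (List.ofFn v) = ExteriorAlgebra.ιMulti ℝ k v := by
  rw [wedge, List.map_ofFn, ExteriorAlgebra.ιMulti_apply]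
  rfl

lemma exists_map_eq_mul {v v' : Fin k → V} (h : ∀ i, v i ∈ Submodule.span ℝ (Set.range v')) :
    ∃ κ : ℝ, ∀ f : V [⋀^Fin k]→ₗ[ℝ] ℝ, f v = κ * f v' := by
  simp only [Submodule.mem_span_range_iff_exists_fun] at h
  choose g hg using h
  refine ⟨(Pi.basisFun ℝ (Fin k)).det g, fun f => ?_⟩
  have := congrArg (· g) ((f.compLinearMap (Fintype.linearCombination ℝ v')).eq_smul_basis_det
    (Pi.basisFun ℝ (Fin k)))
  simp only [AlternatingMap.compLinearMap_apply, AlternatingMap.smul_apply,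
    Fintype.linearCombination_apply, hg] at this
  rw [this, smul_eq_mul, mul_comm]
  congr 2
  ext i
  simp [Pi.single_apply]

/-- The determinant as a functional on the exterior algebra. -/
def detFunctional (w : ℕ) : ExteriorAlgebra ℝ (Fin w → ℝ) →ₗ[ℝ] ℝ :=
  ExteriorAlgebra.liftAlternating (R := ℝ) fun i =>
    if h : w = i then h ▸ Matrix.detRowAlternating else 0

lemma detFunctional_wedge (M : Matrix (Fin w) (Fin w) ℝ) :
    detFunctional w (wedge (List.ofFn fun i => M i)) = M.det := by
  rw [wedge_ofFn, detFunctional, ExteriorAlgebra.liftAlternating_apply_ιMulti, dif_pos rfl]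
  rfl

lemma positiveOn_detFunctional {Z : Matrix (Fin n) (Fin w) ℝ} (hZ : IsPositiveMatrix Z) :
    PositiveOn (detFunctional w) (markerRow Z) 1 n w := by
  rintro L ⟨hL, hmem, rfl⟩
  have hlt (i : Fin L.length) : L.get i - 1 < n := by
    have h := hmem _ (L.get_mem i)
    have h1 : 1 ≤ L.get i := h.1
    have h2 : L.get i ≤ n := h.2
    omega
  have hf : StrictMono fun i : Fin L.length => (⟨L.get i - 1, hlt i⟩ : Fin n) := by
    intro i j hij
    have h1 : 1 ≤ L.get i := (hmem _ (L.get_mem i)).1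
    have h2 : L.get i < L.get j := List.pairwise_iff_get.1 hL i j hij
    exact Fin.mk_lt_mk.2 (by omega)
  convert hZ _ hf
  rw [← detFunctional_wedge, mon]
  congr 2
  refine List.ext_get (by simp) fun i h1 h2 => ?_
  have h := hlt ⟨i, by simpa using h1⟩
  simp only [List.get_eq_getElem] at h
  ext b
  simp [markerRow, h]

lemma exists_bracket_eq_mul (φ : ExteriorAlgebra ℝ V →ₗ[ℝ] ℝ) {v v' : Fin k → V}
    (h : ∀ i, v i ∈ Submodule.span ℝ (Set.range v')) :
    ∃ κ : ℝ, ∀ p q r t, bracket φ (List.ofFn v) p q r t =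
      κ * bracket φ (List.ofFn v') p q r t := by
  obtain ⟨κ, hκ⟩ := exists_map_eq_mul h
  refine ⟨κ, fun p q r t => ?_⟩
  simp only [bracket, wedge_ofFn]
  exact hκ ((φ ∘ₗ LinearMap.mulRight ℝ (wedge [p, q, r, t])).compAlternatingMap
      (ExteriorAlgebra.ιMulti ℝ k))

end determinant

end Bcfw

/-- **Separation.** Let `Da ≠ Db` be two different chord diagrams in
`CD_{n,k}`, let `Z` be positive, and let `Ca, Cb` be domino matrices of `Da, Db`
respectively, each satisfying the sign rules of its own diagram.  Then `Ca * Z` and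
`Cb * Z` have different row spaces; i.e. the images of two different BCFW cells under the
amplituhedron map are disjoint. -/
theorem bcfw_cell_images_disjoint
    (n k : ℕ) (hk : 1 ≤ k) (hn : k + 4 ≤ n)
    (Da Db : ChordDiagram n k) (hab : Da ≠ Db)
    (αa βa γa δa εa αb βb γb δb εb : Fin k → ℝ)
    (hsa : Da.SignRules αa βa γa δa εa) (hsb : Db.SignRules αb βb γb δb εb)
    (Z : Matrix (Fin n) (Fin (k + 4)) ℝ) (hZ : IsPositiveMatrix Z) :
    rowSpace (Da.dominoMatrix αa βa γa δa εa * Z) ≠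
      rowSpace (Db.dominoMatrix αb βb γb δb εb * Z) := by
  intro heq
  obtain ⟨Ta, Ya, ca, wa, la, ea⟩ :=
    Bcfw.exists_cell (Bcfw.subRules_finRange hsa) (Bcfw.subRows_finRange Z)
  obtain ⟨Tb, Yb, cb, wb, lb, eb⟩ :=
    Bcfw.exists_cell (Bcfw.subRules_finRange hsb) (Bcfw.subRows_finRange Z)
  rw [List.length_finRange] at la lb
  rw [← List.ofFn_eq_map] at wa wb
  have hφ := Bcfw.positiveOn_detFunctional hZ
  have hφa : Bcfw.PositiveOn (Bcfw.detFunctional (k + 4)) (markerRow Z) 1 n (Ya.length + 4) :=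
    la.symm ▸ hφ
  have hφb : Bcfw.PositiveOn (Bcfw.detFunctional (k + 4)) (markerRow Z) 1 n (Yb.length + 4) :=
    lb.symm ▸ hφ
  obtain ⟨κ, hκ⟩ := Bcfw.exists_bracket_eq_mul (Bcfw.detFunctional (k + 4))
    (v := fun l => (Da.dominoMatrix αa βa γa δa εa * Z) l)
    (v' := fun l => (Db.dominoMatrix αb βb γb δb εb * Z) l)
    fun l => heq.le (Submodule.subset_span ⟨l, rfl⟩)
  simp only [Bcfw.bracket, ← wa, ← wb] at hκ
  have pa := ca.bracket_pos hφa le_rfl (by omega) (by omega : n - 1 < n) ca.top_le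
  have pb := cb.bracket_pos hφb le_rfl (by omega) (by omega : n - 1 < n) cb.top_le
  have hT : Ta = Tb := ca.eq_of_bracketRel cb hφa hφb
    ⟨κ, pos_of_mul_pos_left ((hκ _ _ _ _).symm ▸ pa) pb.le, hκ⟩
  subst hT
  have h : ∀ l, (Da.tail l, Da.head l) = (Db.tail l, Db.head l) := fun l =>
    List.map_inj_left.1 (ea.symm.trans eb) l (List.mem_finRange l)
  refine hab ?_
  have ht : Da.tail = Db.tail := funext fun l => congrArg Prod.fst (h l)
  have hh : Da.head = Db.head := funext fun l => congrArg Prod.snd (h l)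
  cases Da
  cases Db
  simp only at ht hh
  subst ht hh
  rfl

end
end

section
/- Let k ≥ 1 and n ≥ k+4, let Z ∈ Mat_{n×(k+4)}(ℝ) be positive, and let C ∈ Mat_{k×n}(ℝ) be totally nonnegative of rank k such that the row space of C contains a nonzero vector supported on {i, i⊕1, j, j⊕1} for some i, j ∈ [n] for which these four indices are distinct, where a⊕1 denotes the cyclic successor of a in [n] (so n⊕1 = 1). Then for every ε > 0 there exists a matrix Y′ ∈ Mat_{k×(k+4)}(ℝ) with every entry of Y′ − CZ of absolute value less than ε, such that no totally nonnegative rank-k matrix C′ ∈ Mat_{k×n}(ℝ) satisfies rowspace(C′Z) = rowspace(Y′). (This expresses that Z̃(S_∂A) is contained in the topological boundary of the amplituhedron A_{n,k,4}(Z).) -/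
open scoped Classical

noncomputable section

/-- The cyclic successor of the (1-based) marker `p` in `[n]`: `n ⊕ 1 = 1`. -/
def cyc (n p : ℕ) : ℕ := if p = n then 1 else p + 1

/-- An alternating form on `ℝⁿ` expands along the maximal minors of the matrix of its arguments. -/
theorem alternatingMap_eq_sum_minors {k n : ℕ} (φ : (Fin n → ℝ) [⋀^Fin k]→ₗ[ℝ] ℝ)
    (C : Matrix (Fin k) (Fin n) ℝ) :
    φ C = ∑ g : Fin k ↪o Fin n,
      (C.submatrix id g).det * φ (fun r => Pi.single (g r) 1) := by
  let ψ : (Fin n → ℝ) [⋀^Fin k]→ₗ[ℝ] ℝ := ∑ g : Fin k ↪o Fin n,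
    φ (fun r => Pi.single (g r) 1) •
      (Matrix.detRowAlternating (n := Fin k) (R := ℝ)).compLinearMap (LinearMap.funLeft ℝ ℝ g)
  have hψ : ∀ M : Matrix (Fin k) (Fin n) ℝ, ψ M = ∑ g : Fin k ↪o Fin n,
      (M.submatrix id g).det * φ (fun r => Pi.single (g r) 1) := by
    intro M
    let evalAt : ((Fin n → ℝ) [⋀^Fin k]→ₗ[ℝ] ℝ) →+ ℝ :=
      { toFun := fun f => f M, map_zero' := rfl, map_add' := fun _ _ => rfl }
    exact (map_sum evalAt _ _).trans (Finset.sum_congr rfl fun g _ => mul_comm _ _)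
  suffices h : φ = ψ by rw [← hψ, ← h]
  have hmono : ∀ g : Fin k ↪o Fin n, φ (fun r => Pi.single (g r) 1) =
      ψ (fun r => Pi.single (g r) 1) := by
    intro g
    refine ((hψ _).trans ?_).symm
    rw [Finset.sum_eq_single g]
    · have : (Matrix.submatrix (fun r : Fin k => (Pi.single (g r) 1 : Fin n → ℝ)) id g) =
          (1 : Matrix (Fin k) (Fin k) ℝ) := by
        ext a b
        change (Pi.single (g a) 1 : Fin n → ℝ) (g b) = _
        simp [Pi.single_apply, Matrix.one_apply, eq_comm]
      rw [this, Matrix.det_one, one_mul]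
    · intro g' _ hne
      obtain ⟨a, ha⟩ : ∃ a, g a ∉ Set.range g' := by
        by_contra! hcon
        apply hne
        have hsub : Set.range g ⊆ Set.range g' := by
          rintro _ ⟨a, rfl⟩
          exact hcon a
        have hcard : (Set.range g).ncard = (Set.range g').ncard := by
          rw [Set.ncard_range_of_injective g.injective,
            Set.ncard_range_of_injective g'.injective]
        have := Set.eq_of_subset_of_ncard_le hsub hcard.ge
        exact (OrderEmbedding.range_inj.1 this).symm
      rw [Matrix.det_eq_zero_of_row_eq_zero a, zero_mul]
      intro b
      exact Pi.single_eq_of_ne (fun h => ha ⟨b, h⟩) _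
    · simp
  refine (Pi.basisFun ℝ (Fin n)).ext_alternating fun v hv => ?_
  have hs : StrictMono (v ∘ Tuple.sort v) :=
    (Tuple.monotone_sort v).strictMono_of_injective (hv.comp (Equiv.injective _))
  have h := hmono (OrderEmbedding.ofStrictMono _ hs)
  have h1 := φ.map_perm (fun i => Pi.basisFun ℝ (Fin n) (v i)) (Tuple.sort v)
  have h2 := ψ.map_perm (fun i => Pi.basisFun ℝ (Fin n) (v i)) (Tuple.sort v)
  have h3 : Equiv.Perm.sign (Tuple.sort v) • φ (fun i => Pi.basisFun ℝ (Fin n) (v i)) =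
      Equiv.Perm.sign (Tuple.sort v) • ψ (fun i => Pi.basisFun ℝ (Fin n) (v i)) := by
    rw [← h1, ← h2]
    simpa [Function.comp_def] using h
  exact smul_left_cancel _ h3

/-- The determinant of the matrix obtained by stacking `Y` on top of `W`. -/
def stackedDet {k m : ℕ} (W : Matrix (Fin m) (Fin (k + m)) ℝ)
    (Y : Matrix (Fin k) (Fin (k + m)) ℝ) : ℝ :=
  ((Matrix.fromRows Y W).submatrix id finSumFinEquiv).det

theorem stackedDet_updateRow {k m : ℕ} (W : Matrix (Fin m) (Fin (k + m)) ℝ)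
    (Y : Matrix (Fin k) (Fin (k + m)) ℝ) (r : Fin k) (z : Fin (k + m) → ℝ) :
    stackedDet W (Y.updateRow r z) =
      (((Matrix.fromRows Y W).submatrix id finSumFinEquiv).updateRow (Sum.inl r)
        (z ∘ finSumFinEquiv)).det := by
  unfold stackedDet
  congr 1
  ext a b
  rcases a with a | a
  · by_cases h : a = r
    · subst h; simp
    · simp [Matrix.updateRow_ne, h]
  · simp [Matrix.updateRow_ne]

/-- `stackedDet W` as an alternating form in the rows of its argument. -/
def stackedDetAlternating {k m : ℕ} (W : Matrix (Fin m) (Fin (k + m)) ℝ) :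
    (Fin (k + m) → ℝ) [⋀^Fin k]→ₗ[ℝ] ℝ where
  toFun := stackedDet W
  map_update_add' {inst} Y r x y := by
    obtain rfl := Subsingleton.elim inst (instDecidableEqFin k)
    refine (stackedDet_updateRow W Y r (x + y)).trans ?_
    refine (Matrix.det_updateRow_add _ _ _ _).trans ?_
    exact congrArg₂ _ (stackedDet_updateRow W Y r x).symm (stackedDet_updateRow W Y r y).symm
  map_update_smul' {inst} Y r a x := by
    obtain rfl := Subsingleton.elim inst (instDecidableEqFin k)
    refine (stackedDet_updateRow W Y r (a • x)).trans ?_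
    refine (Matrix.det_updateRow_smul _ _ _ _).trans ?_
    exact congrArg _ (stackedDet_updateRow W Y r x).symm
  map_eq_zero_of_eq' Y r s h hrs := by
    refine Matrix.det_zero_of_row_eq (i := Sum.inl r) (j := Sum.inl s) (by simpa using hrs) ?_
    ext c
    exact congrFun h _

/-- Expansion of `stackedDet W (C * Z)` along the maximal minors of `C`. -/
theorem stackedDet_mul {k m n : ℕ} (W : Matrix (Fin m) (Fin (k + m)) ℝ)
    (C : Matrix (Fin k) (Fin n) ℝ) (Z : Matrix (Fin n) (Fin (k + m)) ℝ) :
    stackedDet W (C * Z) = ∑ g : Fin k ↪o Fin n,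
      (C.submatrix id g).det * stackedDet W (Z.submatrix g id) := by
  have h := alternatingMap_eq_sum_minors
    ((stackedDetAlternating W).compLinearMap Z.vecMulLinear) C
  refine Eq.trans h (Finset.sum_congr rfl fun g _ => congrArg _ ?_)
  refine congrArg (stackedDet W) ?_
  ext a b
  simp

/-- A totally nonnegative matrix of full rank has a positive maximal minor. -/
theorem exists_pos_minor {k n : ℕ} {C : Matrix (Fin k) (Fin n) ℝ} (hC : IsTotallyNonnegRect C)
    (hrank : C.rank = k) : ∃ g : Fin k ↪o Fin n, 0 < (C.submatrix id g).det := by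
  by_contra! hcon
  have hz : ∀ g : Fin k ↪o Fin n, (C.submatrix id g).det = 0 := fun g =>
    le_antisymm (hcon g) (hC g g.strictMono)
  have hsurj : Function.Surjective C.mulVec := by
    have : LinearMap.range C.mulVecLin = ⊤ := by
      apply Submodule.eq_top_of_finrank_eq
      simpa [Matrix.rank] using hrank
    exact LinearMap.range_eq_top.1 this
  obtain ⟨B, hB⟩ := Matrix.mulVec_surjective_iff_exists_right_inverse.1 hsurj
  have h := alternatingMap_eq_sum_minors
    ((Matrix.detRowAlternating (n := Fin k) (R := ℝ)).compLinearMap B.vecMulLinear) C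
  simp only [hz, zero_mul, Finset.sum_const_zero] at h
  have h1 : (C * B).det = 0 := h
  simp [hB] at h1

/-- Left multiplication by `M` modulo the rows of `W`. -/
theorem stackedDet_mul_add_mul {k m : ℕ} (W : Matrix (Fin m) (Fin (k + m)) ℝ)
    (M : Matrix (Fin k) (Fin k) ℝ) (B : Matrix (Fin k) (Fin m) ℝ)
    (Y : Matrix (Fin k) (Fin (k + m)) ℝ) :
    stackedDet W (M * Y + B * W) = M.det * stackedDet W Y := by
  have : (Matrix.fromRows (M * Y + B * W) W) =
      Matrix.fromBlocks M B 0 1 * Matrix.fromRows Y W := by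
    rw [← Matrix.fromRows_fromCols_eq_fromBlocks, Matrix.fromRows_mul,
      Matrix.fromCols_mul_fromRows, Matrix.fromCols_mul_fromRows]
    simp
  unfold stackedDet
  rw [this, ← Matrix.submatrix_mul_equiv _ _ id (Equiv.refl _) finSumFinEquiv, Matrix.det_mul]
  simp

@[fun_prop]
theorem continuous_stackedDet {k m : ℕ} (W : Matrix (Fin m) (Fin (k + m)) ℝ) :
    Continuous (stackedDet W) := by
  refine Continuous.matrix_det (continuous_matrix fun a b => ?_)
  rcases a with a | a
  · exact continuous_apply_apply _ _
  · exact continuous_const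

/-- On a line from `Y₀` to a point where `stackedDet W` does not vanish, `stackedDet W` is nonzero
in a punctured neighbourhood of `Y₀`. -/
theorem eventually_stackedDet_ne_zero {k m : ℕ} (W : Matrix (Fin m) (Fin (k + m)) ℝ)
    (Y₀ Y₁ : Matrix (Fin k) (Fin (k + m)) ℝ) (h : stackedDet W Y₁ ≠ 0) :
    ∀ᶠ t : ℝ in nhdsWithin 0 {0}ᶜ, stackedDet W (Y₀ + t • (Y₁ - Y₀)) ≠ 0 := by
  let A := (Matrix.fromRows Y₀ W).submatrix id finSumFinEquiv
  let B := (Matrix.fromRows (Y₁ - Y₀) (0 : Matrix (Fin m) (Fin (k + m)) ℝ)).submatrix id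
    finSumFinEquiv
  let p : Polynomial ℝ :=
    (A.map Polynomial.C + (Polynomial.X : Polynomial ℝ) • B.map Polynomial.C).det
  have hp : ∀ t, p.eval t = stackedDet W (Y₀ + t • (Y₁ - Y₀)) := by
    intro t
    rw [← Polynomial.coe_evalRingHom, RingHom.map_det]
    unfold stackedDet
    congr 1
    ext a b
    rcases a with a | a <;> simp [A, B]
  have hp0 : p ≠ 0 := by
    intro h0
    apply h
    have := hp 1
    simpa [h0] using this.symm
  have hfin : {t | p.IsRoot t}.Finite := Polynomial.finite_setOfPred_isRoot hp0
  filter_upwards [nhdsNE_le_cofinite (0 : ℝ) hfin.compl_mem_cofinite] with t ht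
  rw [← hp]
  exact ht

/-- The Vandermonde determinant of a concatenation. -/
theorem det_vandermonde_append {k m : ℕ} (u : Fin k → ℝ) (v : Fin m → ℝ) :
    (Matrix.vandermonde (Fin.append u v)).det = (Matrix.vandermonde u).det *
      (∏ x, ∏ t, (v t - u x)) * (Matrix.vandermonde v).det := by
  have key : ∀ {r : ℕ} (w : Fin r → ℝ), (Matrix.vandermonde w).det =
      ∏ x, ∏ y, if x < y then w y - w x else 1 := by
    intro r w
    rw [Matrix.det_vandermonde]
    refine Finset.prod_congr rfl fun x _ => ?_
    rw [← Finset.prod_filter]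
    refine Finset.prod_congr ?_ fun _ _ => rfl
    ext y
    simp
  have h1 : ∀ x y, Fin.castAdd m (x : Fin k) < Fin.natAdd k (y : Fin m) := fun x y => by
    simp only [Fin.lt_def, Fin.val_castAdd, Fin.val_natAdd]; omega
  have h2 : ∀ x y, ¬ Fin.natAdd k (y : Fin m) < Fin.castAdd m (x : Fin k) := fun x y =>
    (h1 x y).asymm
  have h3 : ∀ x y, Fin.castAdd m (x : Fin k) < Fin.castAdd m y ↔ x < y := fun _ _ => Iff.rfl
  rw [key, key, key, Fin.prod_univ_add]
  simp [Fin.prod_univ_add, h1, h2, h3, Finset.prod_mul_distrib]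

theorem det_vandermonde_pos {r n : ℕ} {h : Fin r → Fin n} (hh : StrictMono h) :
    0 < (Matrix.vandermonde fun x => ((h x : ℕ) : ℝ)).det := by
  rw [Matrix.det_vandermonde]
  refine Finset.prod_pos fun x _ => Finset.prod_pos fun y hy => ?_
  rw [sub_pos, Nat.cast_lt, ← Fin.lt_def]
  exact hh (Finset.mem_Ioi.1 hy)

/-- For a positive matrix, the minor on an arbitrary list of distinct rows has the sign of the
Vandermonde determinant of the row indices. -/
theorem IsPositiveMatrix.det_mul_det_vandermonde_pos {n r : ℕ} {Z : Matrix (Fin n) (Fin r) ℝ}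
    (hZ : IsPositiveMatrix Z) {h : Fin r → Fin n} (hh : Function.Injective h) :
    0 < (Z.submatrix h id).det * (Matrix.vandermonde fun x => ((h x : ℕ) : ℝ)).det := by
  have hs : StrictMono (h ∘ Tuple.sort h) :=
    (Tuple.monotone_sort h).strictMono_of_injective (hh.comp (Equiv.injective _))
  have h1 := hZ _ hs
  have h2 := det_vandermonde_pos hs
  have e1 := Matrix.det_permute (Tuple.sort h) (Z.submatrix h id)
  have e2 := Matrix.det_permute (Tuple.sort h) (Matrix.vandermonde fun x => ((h x : ℕ) : ℝ))
  have e3 : (Z.submatrix (h ∘ Tuple.sort h) id).det =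
      Equiv.Perm.sign (Tuple.sort h) * (Z.submatrix h id).det := e1
  have e4 : (Matrix.vandermonde fun x => (((h ∘ Tuple.sort h) x : ℕ) : ℝ)).det =
      Equiv.Perm.sign (Tuple.sort h) *
        (Matrix.vandermonde fun x => ((h x : ℕ) : ℝ)).det := e2
  rw [e3] at h1
  rw [e4] at h2
  have h3 := mul_pos h1 h2
  rcases Int.units_eq_one_or (Equiv.Perm.sign (Tuple.sort h)) with hσ | hσ <;>
    simpa [hσ] using h3

theorem stackedDet_submatrix {k m n : ℕ} (Z : Matrix (Fin n) (Fin (k + m)) ℝ)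
    (g : Fin k → Fin n) (p : Fin m → Fin n) :
    stackedDet (Z.submatrix p id) (Z.submatrix g id) =
      (Z.submatrix (Fin.append g p) id).det := by
  rw [← Matrix.det_submatrix_equiv_self finSumFinEquiv]
  unfold stackedDet
  congr 1
  ext a b
  rcases a with a | a <;> simp

theorem append_natCast {k m n : ℕ} (g : Fin k → Fin n) (p : Fin m → Fin n) :
    (fun x => (((Fin.append g p x : Fin n) : ℕ) : ℝ)) =
      Fin.append (fun x => ((g x : ℕ) : ℝ)) (fun x => ((p x : ℕ) : ℝ)) := by
  ext x
  refine Fin.addCases (fun i => ?_) (fun i => ?_) x <;> simp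

theorem neg_one_pow_mul_prod_pos {r n : ℕ} (J : Fin r ↪o Fin n) (m : Fin n)
    (hm : m ∉ Set.range J) (hmax : ∀ a, m < a → a ∈ Set.range J) :
    0 < (-1 : ℝ) ^ (n - 1 - (m : ℕ)) * ∏ x, (((m : ℕ) : ℝ) - ((J x : ℕ) : ℝ)) := by
  have hcard : (Finset.univ.filter fun x => m < J x).card = n - 1 - (m : ℕ) := by
    rw [← Fin.card_Ioi, ← Finset.card_map J.toEmbedding]
    congr 1
    ext a
    simp only [Finset.mem_map, Finset.mem_filter, Finset.mem_univ, true_and, Finset.mem_Ioi]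
    constructor
    · rintro ⟨x, hx, rfl⟩
      exact hx
    · intro ha
      obtain ⟨x, rfl⟩ := hmax a ha
      exact ⟨x, ha, rfl⟩
  have hpow : (-1 : ℝ) ^ (n - 1 - (m : ℕ)) = ∏ x, if m < J x then -1 else 1 := by
    rw [Finset.prod_ite, Finset.prod_const, Finset.prod_const_one, mul_one, hcard]
  rw [hpow, ← Finset.prod_mul_distrib]
  refine Finset.prod_pos fun x _ => ?_
  split_ifs with h
  · have : ((m : ℕ) : ℝ) < ((J x : ℕ) : ℝ) := Nat.cast_lt.2 h
    linarith
  · have hne : J x ≠ m := fun e => hm ⟨x, e⟩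
    have : ((J x : ℕ) : ℝ) < ((m : ℕ) : ℝ) := Nat.cast_lt.2 ((not_lt.1 h).lt_of_ne hne)
    linarith

/-- For small `δ > 0`, an alternating sum in powers of `δ` is governed by its last nonzero
coefficient. -/
theorem eventually_sum_neg_pow_pos {n : ℕ} (d : Fin n → ℝ) (m : Fin n)
    (hm : 0 < (-1 : ℝ) ^ (n - 1 - (m : ℕ)) * d m) (hd : ∀ a, m < a → d a = 0) :
    ∀ᶠ δ : ℝ in nhdsWithin 0 (Set.Ioi 0), 0 < ∑ a : Fin n, (-δ) ^ (n - 1 - (a : ℕ)) * d a := by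
  let F : ℝ → ℝ := fun δ =>
    ∑ a : Fin n, (-1) ^ (n - 1 - (a : ℕ)) * δ ^ ((m : ℕ) - (a : ℕ)) * d a
  have hF : Continuous F := by fun_prop
  have hF0 : F 0 = (-1 : ℝ) ^ (n - 1 - (m : ℕ)) * d m := by
    simp only [F]
    rw [Finset.sum_eq_single m]
    · simp
    · intro a _ ha
      rcases lt_or_gt_of_ne ha with h | h
      · have : (m : ℕ) - (a : ℕ) ≠ 0 := by
          have := Fin.lt_def.1 h
          omega
        simp [zero_pow this]
      · simp [hd a h]
    · simp
  have hev : ∀ᶠ δ in nhdsWithin 0 (Set.Ioi 0), 0 < F δ :=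
    (hF.tendsto 0).eventually (lt_mem_nhds (hF0 ▸ hm)) |>.filter_mono nhdsWithin_le_nhds
  filter_upwards [hev, self_mem_nhdsWithin] with δ h hδ
  have : ∑ a : Fin n, (-δ) ^ (n - 1 - (a : ℕ)) * d a = δ ^ (n - 1 - (m : ℕ)) * F δ := by
    simp only [F, Finset.mul_sum]
    refine Finset.sum_congr rfl fun a _ => ?_
    rcases le_or_gt a m with ha | ha
    · have : n - 1 - (a : ℕ) = n - 1 - (m : ℕ) + ((m : ℕ) - (a : ℕ)) := by
        have := Fin.le_def.1 ha
        omega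
      rw [neg_pow, this]
      ring
    · simp [hd a ha]
  rw [this]
  exact mul_pos (pow_pos hδ _) h

/-- The matrix `Z` with the row `w` added at the bottom. -/
def appendRow {n r : ℕ} (Z : Matrix (Fin n) (Fin r) ℝ) (w : Fin r → ℝ) :
    Matrix (Fin (n + 1)) (Fin r) ℝ :=
  Matrix.of (Fin.snoc (α := fun _ => Fin r → ℝ) (fun a => Z a) w)

theorem appendRow_castSucc {n r : ℕ} (Z : Matrix (Fin n) (Fin r) ℝ) (w : Fin r → ℝ)
    (a : Fin n) : appendRow Z w a.castSucc = Z a :=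
  Fin.snoc_castSucc (α := fun _ => Fin r → ℝ) _ _ _

theorem appendRow_last {n r : ℕ} (Z : Matrix (Fin n) (Fin r) ℝ) (w : Fin r → ℝ) :
    appendRow Z w (Fin.last n) = w :=
  Fin.snoc_last (α := fun _ => Fin r → ℝ) _ _

/-- A positive matrix admits a row completing all of its `r`-element families of rows, in
increasing order, to positively oriented bases. -/
theorem IsPositiveMatrix.exists_last_row {n r : ℕ} {Z : Matrix (Fin n) (Fin (r + 1)) ℝ}
    (hZ : IsPositiveMatrix Z) (hr : r + 1 ≤ n) :
    ∃ w : Fin (r + 1) → ℝ, ∀ J : Fin r ↪o Fin n,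
      0 < (appendRow (Z.submatrix J id) w).det := by
  let L : (Fin r ↪o Fin n) → (Fin (r + 1) → ℝ) →ₗ[ℝ] ℝ := fun J =>
    (Matrix.detRowAlternating (n := Fin (r + 1)) (R := ℝ)).toMultilinearMap.toLinearMap
      (appendRow (Z.submatrix J id) 0) (Fin.last r)
  have hL : ∀ J w, L J w = (appendRow (Z.submatrix J id) w).det := by
    intro J w
    exact congrArg Matrix.det (Fin.update_snoc_last (α := fun _ => Fin (r + 1) → ℝ)
      (p := fun x => Z (J x)) (x := 0) (z := w))
  have hLZ : ∀ J m, L J (Z m) = (Z.submatrix (Fin.append J fun _ : Fin 1 => m) id).det := by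
    intro J m
    rw [hL]
    congr 1
    ext a b
    refine Fin.lastCases ?_ (fun i => ?_) a
    · rw [appendRow_last]
      exact congrArg (fun x => Z x b) (Fin.append_right J (fun _ : Fin 1 => m) 0).symm
    · rw [appendRow_castSucc]
      exact congrArg (fun x => Z x b) (Fin.append_left J (fun _ : Fin 1 => m) i).symm
  have hev : ∀ J, ∀ᶠ δ : ℝ in nhdsWithin 0 (Set.Ioi 0),
      0 < L J (∑ a : Fin n, (-δ) ^ (n - 1 - (a : ℕ)) • Z a) := by
    intro J
    have hne : (Finset.univ.filter fun a => a ∉ Set.range J).Nonempty := by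
      by_contra hcon
      have hsurj : Function.Surjective J := fun a => by
        by_contra ha
        exact hcon ⟨a, by simpa using ha⟩
      have := Fintype.card_le_of_surjective _ hsurj
      simp at this
      omega
    obtain ⟨m, hm, hmax⟩ := Finset.exists_max_image _ id hne
    replace hm : m ∉ Set.range J := (Finset.mem_filter.1 hm).2
    replace hmax : ∀ a, m < a → a ∈ Set.range J := by
      intro a ha
      by_contra hcon
      exact (hmax a (Finset.mem_filter.2 ⟨Finset.mem_univ _, hcon⟩)).not_gt ha
    have hpos : 0 < (-1 : ℝ) ^ (n - 1 - (m : ℕ)) * L J (Z m) := by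
      have hinj : Function.Injective (Fin.append J fun _ : Fin 1 => m) := by
        rw [Fin.append_injective_iff]
        exact ⟨J.injective, Function.injective_of_subsingleton _, fun i _ h => hm ⟨i, h⟩⟩
      have h1 := hZ.det_mul_det_vandermonde_pos hinj
      rw [append_natCast, det_vandermonde_append, ← hLZ] at h1
      have h2 := det_vandermonde_pos J.strictMono
      have h3 := neg_one_pow_mul_prod_pos J m hm hmax
      simp only [Finset.univ_unique, Finset.prod_singleton, Matrix.det_unique,
        Matrix.vandermonde_apply, Fin.default_eq_zero, Fin.val_zero, pow_zero, mul_one] at h1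
      have h4 : 0 < (∏ x, (((m : ℕ) : ℝ) - ((J x : ℕ) : ℝ))) * L J (Z m) := by
        refine pos_of_mul_pos_right (a := (Matrix.vandermonde fun x => ((J x : ℕ) : ℝ)).det)
          ?_ h2.le
        linarith
      rcases neg_one_pow_eq_or ℝ (n - 1 - (m : ℕ)) with h | h <;> rw [h] at h3 ⊢ <;> nlinarith
    have h := eventually_sum_neg_pow_pos (fun a => L J (Z a)) m hpos (fun a ha => by
      obtain ⟨x, rfl⟩ := hmax a ha
      rw [hL]
      refine Matrix.det_zero_of_row_eq (Fin.castSucc_lt_last x).ne ?_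
      rw [appendRow_castSucc, appendRow_last]
      rfl)
    simpa [map_sum] using h
  obtain ⟨δ, hδ⟩ := (Filter.eventually_all.2 hev).exists
  exact ⟨_, fun J => hL J _ ▸ hδ J⟩

/-- A positive matrix can be extended by one row to a positive matrix. -/
theorem IsPositiveMatrix.exists_snoc {n r : ℕ} {Z : Matrix (Fin n) (Fin r) ℝ}
    (hZ : IsPositiveMatrix Z) (hr : r ≤ n) :
    ∃ w : Fin r → ℝ,
      IsPositiveMatrix (appendRow Z w) := by
  rcases r with _ | r
  · exact ⟨0, fun f _ => by simp⟩
  obtain ⟨w, hw⟩ := hZ.exists_last_row hr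
  refine ⟨w, fun f hf => ?_⟩
  by_cases hlast : f (Fin.last r) = Fin.last n
  · have hne : ∀ x : Fin r, f x.castSucc ≠ Fin.last n := fun x => by
      rw [← hlast]
      exact (hf (Fin.castSucc_lt_last x)).ne
    have hJ : StrictMono fun x : Fin r => (f x.castSucc).castPred (hne x) := fun x y hxy =>
      Fin.castPred_lt_castPred_iff.2 (hf (Fin.castSucc_lt_castSucc_iff.2 hxy))
    convert hw (OrderEmbedding.ofStrictMono _ hJ) using 2
    ext a b
    refine Fin.lastCases ?_ (fun i => ?_) a
    · rw [Matrix.submatrix_apply, hlast, appendRow_last, appendRow_last]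
      rfl
    · rw [Matrix.submatrix_apply, ← Fin.castSucc_castPred _ (hne i), appendRow_castSucc,
        appendRow_castSucc]
      rfl
  · have hne : ∀ x, f x ≠ Fin.last n := fun x h => by
      have := hf.monotone (Fin.le_last x)
      rw [h] at this
      exact hlast (le_antisymm (Fin.le_last _) this)
    have hJ : StrictMono fun x => (f x).castPred (hne x) := fun x y hxy =>
      Fin.castPred_lt_castPred_iff.2 (hf hxy)
    convert hZ _ hJ using 2
    ext a b
    exact congrFun ((congrArg (appendRow Z w) (Fin.castSucc_castPred _ (hne a)).symm).trans
      (appendRow_castSucc Z w _)) b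

/-- A positive matrix can be extended by any number of rows to a positive matrix. -/
theorem IsPositiveMatrix.exists_extension {n r : ℕ} {Z : Matrix (Fin n) (Fin r) ℝ}
    (hZ : IsPositiveMatrix Z) (hr : r ≤ n) (m : ℕ) :
    ∃ Z' : Matrix (Fin (n + m)) (Fin r) ℝ, IsPositiveMatrix Z' ∧
      ∀ a, Z' (Fin.castAdd m a) = Z a := by
  induction m with
  | zero => exact ⟨Z, hZ, fun _ => rfl⟩
  | succ m ih =>
    obtain ⟨Z', hZ', h⟩ := ih
    obtain ⟨w, hw⟩ := hZ'.exists_snoc (hr.trans (Nat.le_add_right n m))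
    refine ⟨_, hw, fun a => ?_⟩
    rw [← h a]
    exact appendRow_castSucc Z' w (Fin.castAdd m a)

/-- There is an `m`-plane that every `k` rows of a positive matrix complete, with the same
orientation, to the whole space. -/
theorem IsPositiveMatrix.exists_stackedDet_pos {k m n : ℕ} {Z : Matrix (Fin n) (Fin (k + m)) ℝ}
    (hZ : IsPositiveMatrix Z) (hn : k + m ≤ n) :
    ∃ W : Matrix (Fin m) (Fin (k + m)) ℝ,
      ∀ g : Fin k ↪o Fin n, 0 < stackedDet W (Z.submatrix g id) := by
  obtain ⟨Z', hZ', h⟩ := hZ.exists_extension hn m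
  refine ⟨Z'.submatrix (Fin.natAdd n) id, fun g => ?_⟩
  have hg : Z.submatrix g id = Z'.submatrix (Fin.castAdd m ∘ g) id := by
    ext a b
    exact congrFun (h (g a)).symm b
  rw [hg, stackedDet_submatrix]
  apply hZ'
  intro x y
  refine Fin.addCases (fun i => ?_) (fun i => ?_) x <;>
    refine Fin.addCases (fun j => ?_) (fun j => ?_) y <;> intro hxy
  · have : i < j := hxy
    rw [Fin.append_left, Fin.append_left]
    exact g.strictMono this
  · rw [Fin.append_left, Fin.append_right, Fin.lt_def]
    exact (g i).isLt.trans_le (Nat.le_add_right _ _)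
  · exact absurd (Fin.lt_def.1 hxy) (by simp only [Fin.val_natAdd, Fin.val_castAdd]; omega)
  · rw [Fin.append_right, Fin.append_right]
    rw [Fin.lt_def] at hxy ⊢
    simp only [Fin.val_natAdd] at hxy ⊢
    omega

/-- The forms `Y ↦ stackedDet (Z.submatrix p id) Y` have a fixed weak sign on the rows of `Z`
when `p` lists two pairs of cyclically consecutive rows. -/
theorem IsPositiveMatrix.exists_sign {k n : ℕ} {Z : Matrix (Fin n) (Fin (k + 4)) ℝ}
    (hZ : IsPositiveMatrix Z) {p : Fin 4 → Fin n} (hp : Function.Injective p) {ε₁ ε₂ : ℝ}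
    (hε₁ : ε₁ ≠ 0) (hε₂ : ε₂ ≠ 0)
    (h₁ : ∀ x : Fin n,
      0 ≤ ε₁ * ((((p 0 : ℕ) : ℝ) - ((x : ℕ) : ℝ)) * (((p 1 : ℕ) : ℝ) - ((x : ℕ) : ℝ))))
    (h₂ : ∀ x : Fin n,
      0 ≤ ε₂ * ((((p 2 : ℕ) : ℝ) - ((x : ℕ) : ℝ)) * (((p 3 : ℕ) : ℝ) - ((x : ℕ) : ℝ)))) :
    ∃ s : ℝ, s ≠ 0 ∧ ∀ g : Fin k ↪o Fin n,
      0 ≤ s * stackedDet (Z.submatrix p id) (Z.submatrix g id) := by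
  set K := (Matrix.vandermonde fun x => ((p x : ℕ) : ℝ)).det with hK
  have hK0 : K ≠ 0 := Matrix.det_vandermonde_ne_zero_iff.2 fun a b hab =>
    hp (Fin.ext (Nat.cast_injective hab))
  refine ⟨ε₁ ^ k * ε₂ ^ k * K, by positivity, fun g => ?_⟩
  rw [stackedDet_submatrix]
  by_cases hinj : Function.Injective (Fin.append g p)
  · have hdet := hZ.det_mul_det_vandermonde_pos hinj
    rw [append_natCast, det_vandermonde_append, ← hK] at hdet
    have hV := det_vandermonde_pos g.strictMono
    set V := (Matrix.vandermonde fun x => ((g x : ℕ) : ℝ)).det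
    set P := ∏ x, ∏ t, (((p t : ℕ) : ℝ) - ((g x : ℕ) : ℝ)) with hP
    set D := (Z.submatrix (Fin.append g p) id).det
    have hεP : 0 ≤ ε₁ ^ k * ε₂ ^ k * P := by
      have : ε₁ ^ k * ε₂ ^ k * P = ∏ x : Fin k,
          (ε₁ * ((((p 0 : ℕ) : ℝ) - ((g x : ℕ) : ℝ)) * (((p 1 : ℕ) : ℝ) - ((g x : ℕ) : ℝ)))) *
          (ε₂ * ((((p 2 : ℕ) : ℝ) - ((g x : ℕ) : ℝ)) * (((p 3 : ℕ) : ℝ) - ((g x : ℕ) : ℝ)))) := by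
        have hc : ∀ a : ℝ, a ^ k = ∏ _x : Fin k, a := fun a => by simp
        rw [hP, hc ε₁, hc ε₂, ← Finset.prod_mul_distrib, ← Finset.prod_mul_distrib]
        refine Finset.prod_congr rfl fun x _ => ?_
        rw [Fin.prod_univ_four]
        ring
      rw [this]
      exact Finset.prod_nonneg fun x _ => mul_nonneg (h₁ _) (h₂ _)
    have hDPK : 0 < D * P * K := by
      refine pos_of_mul_pos_right (a := V) ?_ hV.le
      linarith
    have hP2 : 0 < P ^ 2 := by
      have : P ≠ 0 := by
        rintro h
        simp [h] at hDPK
      positivity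
    refine nonneg_of_mul_nonneg_left (b := P ^ 2) ?_ hP2
    have := mul_nonneg hεP hDPK.le
    linarith
  · obtain ⟨a, b, hab, hne⟩ : ∃ a b, Fin.append g p a = Fin.append g p b ∧ a ≠ b := by
      simpa [Function.Injective] using hinj
    have : (Z.submatrix (Fin.append g p) id).det = 0 := by
      refine Matrix.det_zero_of_row_eq hne ?_
      ext c
      simp [hab]
    simp [this]

/-- Some choice of `k` rows of a positive matrix is complementary to given `m` distinct rows. -/
theorem IsPositiveMatrix.exists_stackedDet_ne_zero {k m n : ℕ}
    {Z : Matrix (Fin n) (Fin (k + m)) ℝ} (hZ : IsPositiveMatrix Z) (hn : k + m ≤ n)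
    {p : Fin m → Fin n} (hp : Function.Injective p) :
    ∃ Y, stackedDet (Z.submatrix p id) Y ≠ 0 := by
  have hcard : k ≤ (Finset.univ.image p)ᶜ.card := by
    rw [Finset.card_compl, Finset.card_image_of_injective _ hp]
    simp
    omega
  let g := Finset.orderEmbOfCardLe _ hcard
  have hg : ∀ x t, g x ≠ p t := fun x t h => by
    have := Finset.orderEmbOfCardLe_mem _ hcard x
    simp only [Finset.mem_compl, Finset.mem_image, Finset.mem_univ, true_and, not_exists] at this
    exact this t h.symm
  refine ⟨Z.submatrix g id, ?_⟩
  rw [stackedDet_submatrix]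
  have hinj : Function.Injective (Fin.append g p) := Fin.append_injective_iff.2
    ⟨g.injective, hp, hg⟩
  exact left_ne_zero_of_mul (hZ.det_mul_det_vandermonde_pos hinj).ne'

/-- If a nontrivial combination of the rows of `Y₀` lies in the row span of `W`, then a nonzero
`stackedDet W` takes both signs near `Y₀`. -/
theorem exists_near_mul_stackedDet_neg {k m : ℕ} {W : Matrix (Fin m) (Fin (k + m)) ℝ}
    {Y₀ Y₁ : Matrix (Fin k) (Fin (k + m)) ℝ} (h : stackedDet W Y₁ ≠ 0)
    {c : Fin k → ℝ} (hc : c ≠ 0) {b : Fin m → ℝ}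
    (hcb : Matrix.vecMul c Y₀ = Matrix.vecMul b W) {s : ℝ} (hs : s ≠ 0)
    {S : Set (Matrix (Fin k) (Fin (k + m)) ℝ)} (hS : S ∈ nhds Y₀) :
    ∃ Y ∈ S, s * stackedDet W Y < 0 := by
  have hcc : dotProduct c c ≠ 0 := fun h0 => hc (dotProduct_self_eq_zero.1 h0)
  let u : Fin k → ℝ := (-2 / dotProduct c c) • c
  let M : Matrix (Fin k) (Fin k) ℝ :=
    1 + Matrix.replicateCol Unit u * Matrix.replicateRow Unit c
  have hM : M.det = -1 := by
    rw [Matrix.det_one_add_replicateCol_mul_replicateRow]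
    simp only [u, dotProduct_smul, smul_eq_mul]
    field_simp
    norm_num
  let T : Matrix (Fin k) (Fin (k + m)) ℝ → Matrix (Fin k) (Fin (k + m)) ℝ := fun Y =>
    M * Y + (-(Matrix.replicateCol Unit u * Matrix.replicateRow Unit b)) * W
  have hT : Continuous T := by fun_prop
  have hT0 : T Y₀ = Y₀ := by
    simp only [T, M, Matrix.add_mul, Matrix.one_mul, Matrix.neg_mul, Matrix.mul_assoc,
      ← Matrix.replicateRow_vecMul, hcb]
    simp
  have hTdet : ∀ Y, stackedDet W (T Y) = -stackedDet W Y := fun Y => by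
    rw [stackedDet_mul_add_mul, hM, neg_one_mul]
  have hTS : T ⁻¹' S ∈ nhds Y₀ := hT.continuousAt (hT0.symm ▸ hS)
  have hline : Filter.Tendsto (fun t : ℝ => Y₀ + t • (Y₁ - Y₀)) (nhdsWithin 0 {0}ᶜ)
      (nhds Y₀) := by
    have : Continuous fun t : ℝ => Y₀ + t • (Y₁ - Y₀) := by fun_prop
    have h0 := this.tendsto 0
    rw [zero_smul, add_zero] at h0
    exact h0.mono_left nhdsWithin_le_nhds
  obtain ⟨t, ht, htS, htT⟩ := ((eventually_stackedDet_ne_zero W Y₀ Y₁ h).and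
    ((hline.eventually hS).and (hline.eventually hTS))).exists
  rcases lt_or_gt_of_ne (mul_ne_zero hs ht) with hlt | hgt
  · exact ⟨_, htS, hlt⟩
  · refine ⟨_, htT, ?_⟩
    rw [hTdet]
    linarith

/-- The product of the differences to two cyclically consecutive indices has a constant weak
sign. -/
theorem exists_sign_of_cyc {n i : ℕ} (hi1 : 1 ≤ i) :
    ∃ ε : ℝ, ε ≠ 0 ∧ ∀ x : Fin n,
      0 ≤ ε * ((((i - 1 : ℕ) : ℝ) - ((x : ℕ) : ℝ)) *
        (((cyc n i - 1 : ℕ) : ℝ) - ((x : ℕ) : ℝ))) := by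
  by_cases h : i = n
  · refine ⟨-1, by norm_num, fun x => ?_⟩
    have h1 : ((x : ℕ) : ℝ) ≤ ((i - 1 : ℕ) : ℝ) := Nat.cast_le.2 (by omega)
    have h2 : (0 : ℝ) ≤ ((x : ℕ) : ℝ) := Nat.cast_nonneg _
    simp only [cyc, h, if_true, Nat.sub_self, Nat.cast_zero]
    rw [h] at h1
    nlinarith
  · refine ⟨1, one_ne_zero, fun x => ?_⟩
    simp only [cyc, h, if_false, Nat.add_sub_cancel, one_mul]
    rcases le_or_gt i x with hx | hx
    · have h1 : ((i : ℕ) : ℝ) ≤ ((x : ℕ) : ℝ) := Nat.cast_le.2 hx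
      have h2 : ((i - 1 : ℕ) : ℝ) ≤ ((x : ℕ) : ℝ) := Nat.cast_le.2 (by omega)
      nlinarith
    · have h1 : ((x : ℕ) : ℝ) ≤ ((i : ℕ) : ℝ) := Nat.cast_le.2 hx.le
      have h2 : ((x : ℕ) : ℝ) ≤ ((i - 1 : ℕ) : ℝ) := Nat.cast_le.2 (by omega)
      nlinarith

theorem cyc_sub_one_lt {n i : ℕ} (hi1 : 1 ≤ i) (hin : i ≤ n) : cyc n i - 1 < n := by
  unfold cyc
  split_ifs <;> omega

theorem one_le_cyc (n i : ℕ) : 1 ≤ cyc n i := by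
  unfold cyc
  split_ifs <;> omega

theorem exists_vecMul_of_mem_rowSpace {k n : ℕ} {A : Matrix (Fin k) (Fin n) ℝ}
    {v : Fin n → ℝ} (hv : v ∈ rowSpace A) : ∃ c, Matrix.vecMul c A = v := by
  obtain ⟨c, hc⟩ := (Submodule.mem_span_range_iff_exists_fun ℝ).1 hv
  exact ⟨c, by rw [Matrix.vecMul_eq_sum, ← hc]⟩

theorem exists_mul_eq_of_rowSpace_eq {k n : ℕ} {A B : Matrix (Fin k) (Fin n) ℝ}
    (h : rowSpace A = rowSpace B) : ∃ M : Matrix (Fin k) (Fin k) ℝ, M * A = B := by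
  have hrow : ∀ r, ∃ c, Matrix.vecMul c A = B r := fun r =>
    exists_vecMul_of_mem_rowSpace (h ▸ Submodule.subset_span ⟨r, rfl⟩)
  choose M hM using hrow
  refine ⟨Matrix.of M, ?_⟩
  ext a b
  exact congrFun (hM a) b

/-- Let `Z` be positive and `C` totally nonnegative of rank `k`, whose
row space contains a nonzero vector supported on the four distinct cyclic markers
`{i, i⊕1, j, j⊕1}`.  Then arbitrarily close to `C * Z` there are matrices `Y'` whose row
space is not of the form `rowSpace (C' * Z)` for any totally nonnegative rank-`k` matrix
`C'`; i.e. the image of `S_∂A` is contained in the topological boundary of the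
amplituhedron `A_{n,k,4}(Z)`. -/
theorem image_of_SdA_in_amplituhedron_boundary
    (n k : ℕ) (hk : 1 ≤ k) (hn : k + 4 ≤ n)
    (Z : Matrix (Fin n) (Fin (k + 4)) ℝ) (hZ : IsPositiveMatrix Z)
    (C : Matrix (Fin k) (Fin n) ℝ) (hC : IsTotallyNonnegRect C) (hrank : C.rank = k)
    (i j : ℕ) (hi1 : 1 ≤ i) (hin : i ≤ n) (hj1 : 1 ≤ j) (hjn : j ≤ n)
    (hdist : ({i, cyc n i, j, cyc n j} : Finset ℕ).card = 4)
    (hvec : ∃ v ∈ rowSpace C, v ≠ 0 ∧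
      ∀ a : Fin n, v a ≠ 0 → (a : ℕ) + 1 ∈ ({i, cyc n i, j, cyc n j} : Finset ℕ))
    (ε : ℝ) (hε : 0 < ε) :
    ∃ Y' : Matrix (Fin k) (Fin (k + 4)) ℝ,
      (∀ (r : Fin k) (c : Fin (k + 4)), |Y' r c - (C * Z) r c| < ε) ∧
      ∀ C' : Matrix (Fin k) (Fin n) ℝ, IsTotallyNonnegRect C' → C'.rank = k →
        rowSpace (C' * Z) ≠ rowSpace Y' := by
  obtain ⟨v, hv, hv0, hvsupp⟩ := hvec
  let p : Fin 4 → Fin n := ![⟨i - 1, by omega⟩, ⟨cyc n i - 1, cyc_sub_one_lt hi1 hin⟩,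
    ⟨j - 1, by omega⟩, ⟨cyc n j - 1, cyc_sub_one_lt hj1 hjn⟩]
  have hci := one_le_cyc n i
  have hcj := one_le_cyc n j
  have himage : Finset.univ.image (fun t => (p t : ℕ) + 1) = {i, cyc n i, j, cyc n j} := by
    ext a
    simp [Fin.exists_fin_succ, p, Nat.sub_add_cancel hi1, Nat.sub_add_cancel hj1,
      Nat.sub_add_cancel hci, Nat.sub_add_cancel hcj, eq_comm]
  have hp : Function.Injective p := by
    have hinj : Set.InjOn (fun t => (p t : ℕ) + 1) (Finset.univ : Finset (Fin 4)) := by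
      rw [← Finset.card_image_iff, himage, hdist]
      simp
    exact fun a b hab => hinj (by simp) (by simp) (by simp [hab])
  have hsupp : ∀ a, a ∉ Finset.univ.image p → v a = 0 := by
    intro a ha
    by_contra hva
    have hmem := hvsupp a hva
    rw [← himage] at hmem
    obtain ⟨t, -, ht⟩ := Finset.mem_image.1 hmem
    exact ha (Finset.mem_image.2 ⟨t, Finset.mem_univ _, Fin.ext (by simpa using ht)⟩)
  obtain ⟨c, hc⟩ := exists_vecMul_of_mem_rowSpace hv
  have hc0 : c ≠ 0 := by
    rintro rfl
    exact hv0 (by simpa using hc.symm)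
  have hcb : Matrix.vecMul c (C * Z) = Matrix.vecMul (v ∘ p) (Z.submatrix p id) := by
    rw [← Matrix.vecMul_vecMul, hc, Matrix.vecMul_eq_sum, Matrix.vecMul_eq_sum,
      ← Finset.sum_subset (Finset.subset_univ (Finset.univ.image p)),
      Finset.sum_image fun _ _ _ _ h => hp h]
    · rfl
    · intro a _ ha
      rw [hsupp a ha, zero_smul]
  obtain ⟨ε₁, hε₁, h₁⟩ := exists_sign_of_cyc (n := n) hi1
  obtain ⟨ε₂, hε₂, h₂⟩ := exists_sign_of_cyc (n := n) hj1
  obtain ⟨s, hs, hsign⟩ := hZ.exists_sign hp hε₁ hε₂ h₁ h₂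
  obtain ⟨W, hW⟩ := hZ.exists_stackedDet_pos hn
  have hWpos : ∀ C' : Matrix (Fin k) (Fin n) ℝ, IsTotallyNonnegRect C' → C'.rank = k →
      0 < stackedDet W (C' * Z) := by
    intro C' hC' hrank'
    obtain ⟨g, hg⟩ := exists_pos_minor hC' hrank'
    rw [stackedDet_mul]
    exact Finset.sum_pos' (fun g _ => mul_nonneg (hC' g g.strictMono) (hW g).le)
      ⟨g, Finset.mem_univ _, mul_pos hg (hW g)⟩
  have hWnonneg : ∀ C' : Matrix (Fin k) (Fin n) ℝ, IsTotallyNonnegRect C' →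
      0 ≤ s * stackedDet (Z.submatrix p id) (C' * Z) := by
    intro C' hC'
    rw [stackedDet_mul, Finset.mul_sum]
    refine Finset.sum_nonneg fun g _ => ?_
    rw [mul_left_comm]
    exact mul_nonneg (hC' g g.strictMono) (hsign g)
  obtain ⟨Y₁, hY₁⟩ := hZ.exists_stackedDet_ne_zero hn hp
  have hclose : ∀ᶠ Y in nhds (C * Z), ∀ r c, |Y r c - (C * Z) r c| < ε := by
    refine Filter.eventually_all.2 fun r => Filter.eventually_all.2 fun c => ?_
    have hcont : Continuous fun Y : Matrix (Fin k) (Fin (k + 4)) ℝ =>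
        |Y r c - (C * Z) r c| := by fun_prop
    exact hcont.continuousAt.eventually_lt_const (by simpa using hε)
  have hWnear : ∀ᶠ Y in nhds (C * Z), 0 < stackedDet W Y :=
    (continuous_stackedDet W).continuousAt.eventually (lt_mem_nhds (hWpos C hC hrank))
  obtain ⟨Y', ⟨hY'close, hY'pos⟩, hY'neg⟩ :=
    exists_near_mul_stackedDet_neg hY₁ hc0 hcb hs (hclose.and hWnear)
  refine ⟨Y', hY'close, fun C' hC' hrank' hrow => ?_⟩
  obtain ⟨M, rfl⟩ := exists_mul_eq_of_rowSpace_eq hrow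
  have hdet : ∀ V : Matrix (Fin 4) (Fin (k + 4)) ℝ,
      stackedDet V (M * (C' * Z)) = M.det * stackedDet V (C' * Z) := fun V => by
    simpa using stackedDet_mul_add_mul V M 0 (C' * Z)
  rw [hdet] at hY'pos hY'neg
  have hM : 0 < M.det := pos_of_mul_pos_left hY'pos (hWpos C' hC' hrank').le
  have := mul_nonneg hM.le (hWnonneg C' hC')
  linarith

end
end

section
/- Let d ≥ 1 and let F : ℝ^d → ℝ be a polynomial of degree at most one in each variable (a multi-affine polynomial) that is not identically zero. If p ∈ ℝ^d satisfies F(p) = 0, then every neighborhood of p contains a point x with F(x) > 0 and a point y with F(y) < 0. -/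
namespace MvPolynomial

/-- A polynomial of degree at most one in the variable `i` satisfies the midpoint identity along
the `i`-th coordinate direction. -/
theorem eval_update_add_eval_update_of_degreeOf_le_one {σ R : Type*} [Fintype σ] [DecidableEq σ]
    [CommRing R] {F : MvPolynomial σ R} {i : σ} (h : F.degreeOf i ≤ 1) (x : σ → R) (t : R) :
    eval (Function.update x i (x i + t)) F + eval (Function.update x i (x i - t)) F =
      2 * eval x F := by
  simp only [eval_eq', Finset.mul_sum, ← Finset.sum_add_distrib]
  refine Finset.sum_congr rfl fun m hm => ?_
  have hmi : m i ≤ 1 := (monomial_le_degreeOf i hm).trans h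
  have key (c : R) : ∏ j, Function.update x i c j ^ m j =
      c ^ m i * ∏ j ∈ Finset.univ.erase i, x j ^ m j := by
    rw [← Finset.mul_prod_erase _ _ (Finset.mem_univ i), Function.update_self]
    congr 1
    refine Finset.prod_congr rfl fun j hj => ?_
    rw [Function.update_of_ne (Finset.ne_of_mem_erase hj)]
  rw [key, key, ← Finset.mul_prod_erase _ _ (Finset.mem_univ i)]
  interval_cases m i <;> ring

/-- A nonzero multi-affine real polynomial takes positive values arbitrarily close to each of its
zeros. -/
theorem exists_mem_eval_pos_of_degreeOf_le_one {σ : Type*} [Fintype σ]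
    {F : MvPolynomial σ ℝ} (hdeg : ∀ i, F.degreeOf i ≤ 1) (hF : F ≠ 0)
    {p : σ → ℝ} (hp : eval p F = 0) {U : Set (σ → ℝ)} (hU : U ∈ nhds p) :
    ∃ x ∈ U, 0 < eval x F := by
  classical
  by_contra! hneg
  obtain ⟨ε, hε, hball⟩ := Metric.mem_nhds_iff.1 hU
  have hbox (x : σ → ℝ) (hx : ∀ j, |x j - p j| < ε) : eval x F ≤ 0 :=
    hneg x (hball (by simpa [dist_pi_lt_iff hε, Real.dist_eq] using hx))
  have hzero (y : σ → ℝ) (hy : ∀ j, |y j - p j| < ε) (s : Finset σ) :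
      eval (s.piecewise y p) F = 0 := by
    induction s using Finset.induction_on with
    | empty => simpa using hp
    | insert i s hi ih =>
      have hpi : s.piecewise y p i = p i := s.piecewise_eq_of_notMem _ _ hi
      have hs (j : σ) : |s.piecewise y p j - p j| < ε := by
        by_cases hj : j ∈ s <;> simp [hj, hy, hε]
      have hupd (c : ℝ) (hc : |c - p i| < ε) :
          eval (Function.update (s.piecewise y p) i c) F ≤ 0 := by
        refine hbox _ fun j => ?_
        rcases eq_or_ne j i with rfl | hj
        · simpa using hc
        · simpa [hj] using hs j
      have hmid := eval_update_add_eval_update_of_degreeOf_le_one (hdeg i)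
        (s.piecewise y p) (y i - p i)
      rw [ih, hpi, add_sub_cancel] at hmid
      have h₁ := hupd (y i) (hy i)
      have h₂ := hupd (p i - (y i - p i)) (by simpa [abs_sub_comm] using hy i)
      rw [Finset.piecewise_insert]
      linarith
  refine hF (funext_set (fun i => Metric.ball (p i) ε) (fun i => ?_) fun y hy => ?_)
  · rw [Real.ball_eq_Ioo]
    exact Set.Ioo_infinite (by linarith)
  · have hy' (j : σ) : |y j - p j| < ε := by
      simpa [Real.dist_eq] using hy j (Set.mem_univ j)
    simpa using hzero y hy' Finset.univ

end MvPolynomial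


/-- A nonzero multi-affine polynomial `F` on `ℝ^d` (degree at most one
in each variable) takes both strictly positive and strictly negative values in every
neighborhood of each of its zeros. -/
theorem multiaffine_polynomial_sign_change
    (d : ℕ) (hd : 1 ≤ d)
    (F : MvPolynomial (Fin d) ℝ)
    (hdeg : ∀ i : Fin d, F.degreeOf i ≤ 1) (hF : F ≠ 0)
    (p : Fin d → ℝ) (hp : MvPolynomial.eval p F = 0) :
    ∀ U ∈ nhds p,
      (∃ x ∈ U, 0 < MvPolynomial.eval x F) ∧ (∃ y ∈ U, MvPolynomial.eval y F < 0) := by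
  intro U hU
  refine ⟨MvPolynomial.exists_mem_eval_pos_of_degreeOf_le_one hdeg hF hp hU, ?_⟩
  simpa using MvPolynomial.exists_mem_eval_pos_of_degreeOf_le_one (F := -F)
    (fun i => by simpa [MvPolynomial.degreeOf_neg] using hdeg i) (neg_ne_zero.2 hF)
    (by simpa using hp) hU
end

section
/- Let k ≥ 0 and n ≥ k+5, let Z ∈ Mat_{n×(k+5)}(ℝ), let i ∈ [n] and j ∈ [k+5] with Z_{i,j} ≠ 0, and fix any column index q₀ ∈ [k+5]∖{j}. Define the matrix Z′, with rows indexed by p ∈ [n]∖{i} and columns indexed by q ∈ [k+5]∖{j}, by Z′_{p,q} = (−1)^{[p<i]+[q<j]}·(Z_{p,q} − Z_{i,q}·Z_{p,j}/Z_{i,j})·(Z_{i,j})^{[q=q₀]}, where [P] is 1 if P holds and 0 otherwise. Then for every (k+4)-element subset J ⊆ [n]∖{i}, the determinant of the (k+5)×(k+5) submatrix of Z on the rows J∪{i} (in increasing order) equals the determinant of the (k+4)×(k+4) submatrix of Z′ on the rows J (in increasing order, using all columns of Z′). In particular, if all (k+5)×(k+5) minors of Z are positive, then all (k+4)×(k+4)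 minors of Z′ are positive. -/
open scoped Classical

noncomputable section

/-- Schur complement expansion of a determinant at a nonzero entry. -/
theorem det_eq_pivot_mul_det_sub {m : ℕ} (A : Matrix (Fin (m + 1)) (Fin (m + 1)) ℝ)
    (a b : Fin (m + 1)) (h : A a b ≠ 0) :
    A.det = (-1) ^ (a + b : ℕ) * A a b *
      (Matrix.of fun p q => A (a.succAbove p) (b.succAbove q) -
        A a (b.succAbove q) * A (a.succAbove p) b / A a b).det := by
  set B : Matrix (Fin (m + 1)) (Fin (m + 1)) ℝ := Matrix.of fun p q =>
    if p = a then A a q else A p q - A a q * A p b / A a b with hB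
  have hAB : A.det = B.det := by
    refine Matrix.det_eq_of_forall_row_eq_smul_add_const
      (fun p => if p = a then 0 else A p b / A a b) a (by simp) fun p q => ?_
    by_cases hp : p = a
    · simp [hB, hp]
    · simp [hB, hp]
      ring
  rw [hAB, Matrix.det_succ_column B b, Finset.sum_eq_single a]
  · congr 1
    · simp [hB]
    · congr 1
      ext p q
      simp [hB]
  · intro p _ hp
    have : B p b = 0 := by
      simp only [hB, Matrix.of_apply, if_neg hp]
      field_simp
      ring
    simp [this]
  · simp

theorem prod_neg_one_pow_succAbove_lt {m : ℕ} (a : Fin (m + 1)) :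
    ∏ p : Fin m, (-1 : ℝ) ^ (if a.succAbove p < a then 1 else 0) = (-1) ^ (a : ℕ) := by
  rw [Finset.prod_pow_eq_pow_sum]
  congr 1
  simp only [Fin.succAbove_lt_iff_castSucc_lt, Finset.sum_boole, Nat.cast_id]
  have := Fin.sum_univ_succAbove (fun p => if p < a then 1 else 0) a
  simp only [Fin.succAbove_lt_iff_castSucc_lt, Finset.sum_boole, Nat.cast_id, lt_irrefl,
    if_false, zero_add] at this
  rw [← this, ← Fin.card_Iio]
  congr 1
  ext p
  simp

/-- The maximal minor of `Z` on the rows `f`, one of which is the row `i`, agrees with the maximal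
minor of the projected matrix on the remaining rows `g`. -/
theorem det_submatrix_eq_det_projection {m n : ℕ}
    (Z : Matrix (Fin (n + 1)) (Fin (m + 1)) ℝ)
    (i : Fin (n + 1)) (j : Fin (m + 1)) (hZij : Z i j ≠ 0)
    (q₀ : Fin (m + 1)) (hq₀ : q₀ ≠ j)
    (Z' : Matrix (Fin n) (Fin m) ℝ)
    (hZ' : ∀ (p : Fin n) (q : Fin m),
      Z' p q =
        (-1 : ℝ) ^ ((if i.succAbove p < i then 1 else 0) +
            (if j.succAbove q < j then 1 else 0)) *
          (Z (i.succAbove p) (j.succAbove q) -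
            Z i (j.succAbove q) * Z (i.succAbove p) j / Z i j) *
          (if j.succAbove q = q₀ then Z i j else 1))
    {f : Fin (m + 1) → Fin (n + 1)} (hf : StrictMono f) {g : Fin m → Fin n}
    {a : Fin (m + 1)} (hfa : f a = i) (hfg : ∀ t, f (a.succAbove t) = i.succAbove (g t)) :
    (Z.submatrix f id).det = (Z'.submatrix g id).det := by
  have hsign (t : Fin m) : i.succAbove (g t) < i ↔ a.succAbove t < a := by
    rw [← hfg, ← hfa, hf.lt_iff_lt]
  have hscale : ∏ q : Fin m, (if j.succAbove q = q₀ then Z i j else 1) = Z i j := by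
    obtain ⟨r, rfl⟩ := Fin.exists_succAbove_eq hq₀
    simp
  set C : Matrix (Fin m) (Fin m) ℝ := Matrix.of fun p q =>
    Z (f (a.succAbove p)) (j.succAbove q) -
      Z i (j.succAbove q) * Z (f (a.succAbove p)) j / Z i j with hC
  have hZ'C : Z'.submatrix g id = Matrix.of fun p q =>
      (-1 : ℝ) ^ (if a.succAbove p < a then 1 else 0) *
        (Matrix.of fun p q => ((-1 : ℝ) ^ (if j.succAbove q < j then 1 else 0) *
          (if j.succAbove q = q₀ then Z i j else 1)) * C p q) p q := by
    ext p q
    simp only [Matrix.submatrix_apply, id, hZ', hsign, Matrix.of_apply, hC, hfg, pow_add]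
    ring
  rw [hZ'C, Matrix.det_mul_column, Matrix.det_mul_row, Finset.prod_mul_distrib, hscale,
    prod_neg_one_pow_succAbove_lt, prod_neg_one_pow_succAbove_lt,
    det_eq_pivot_mul_det_sub _ a j (by simpa [hfa] using hZij)]
  simp only [Matrix.submatrix_apply, id, hfa, pow_add, hC]
  ring

/-- The increasing enumeration of `J ∪ {i}` passes through `i`, and skipping `i` in it gives the
increasing enumeration of `J`. -/
theorem exists_orderEmbOfFin_insert_image_succAbove {m n : ℕ} (i : Fin (n + 1))
    (J : Finset (Fin n)) (hJ : J.card = m)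
    (hS : (insert i (J.image i.succAbove)).card = m + 1) :
    ∃ a : Fin (m + 1), (insert i (J.image i.succAbove)).orderEmbOfFin hS a = i ∧
      ∀ t, (insert i (J.image i.succAbove)).orderEmbOfFin hS (a.succAbove t) =
        i.succAbove (J.orderEmbOfFin hJ t) := by
  set f := (insert i (J.image i.succAbove)).orderEmbOfFin hS with hf
  have hi : i ∈ Set.range f := by
    rw [hf, Finset.range_orderEmbOfFin]
    simp
  obtain ⟨a, ha⟩ := hi
  have hcard : (J.image i.succAbove).card = m := by
    rw [Finset.card_image_of_injective _ Fin.succAbove_right_injective, hJ]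
  refine ⟨a, ha, fun t => ?_⟩
  have h₁ : (fun t => f (a.succAbove t)) = (J.image i.succAbove).orderEmbOfFin hcard := by
    refine Finset.orderEmbOfFin_unique hcard (fun t => ?_)
      (f.strictMono.comp (Fin.strictMono_succAbove a))
    refine (Finset.mem_insert.mp (Finset.orderEmbOfFin_mem _ hS _)).resolve_left fun h => ?_
    exact Fin.succAbove_ne a t (f.injective (h.trans ha.symm))
  have h₂ : (fun t => i.succAbove (J.orderEmbOfFin hJ t)) =
      (J.image i.succAbove).orderEmbOfFin hcard :=
    Finset.orderEmbOfFin_unique hcard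
      (fun t => Finset.mem_image_of_mem _ (Finset.orderEmbOfFin_mem _ _ _))
      ((Fin.strictMono_succAbove i).comp (J.orderEmbOfFin hJ).strictMono)
  exact congrFun (h₁.trans h₂.symm) t

theorem card_insert_image_succAbove {n : ℕ} (i : Fin (n + 1)) (J : Finset (Fin n)) :
    (insert i (J.image i.succAbove)).card = J.card + 1 := by
  rw [Finset.card_insert_of_notMem (by simp [Fin.succAbove_ne]),
    Finset.card_image_of_injective _ Fin.succAbove_right_injective]

theorem rowMinor_eq_det_orderEmbOfFin {N r : ℕ} (A : Matrix (Fin N) (Fin r) ℝ)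
    (S : Finset (Fin N)) (h : S.card = r) :
    rowMinor A S = (A.submatrix (S.orderEmbOfFin h) id).det := by
  rw [rowMinor, dif_pos h]
  rfl

/-- Let `Z` be an `(n+1) × (k+5)` real matrix with `n + 1 ≥ k + 5`,
let `i` be a row index and `j` a column index with `Z i j ≠ 0`, and fix a column
`q₀ ≠ j`.  Let `Z'` be the `n × (k+4)` matrix, with rows indexed by the rows of `Z`
other than `i` (via `i.succAbove`) and columns indexed by the columns of `Z` other than
`j` (via `j.succAbove`), given by
`Z' p q = (-1)^{[p<i]+[q<j]} · (Z p q − Z i q · Z p j / Z i j) · (Z i j)^{[q = q₀]}`.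
Then for every `(k+4)`-element set `J` of rows of `Z'`, the maximal minor of `Z` on the
rows `J ∪ {i}` equals the maximal minor of `Z'` on the rows `J` (all rows in increasing
order).  In particular, if `Z` is positive then so is `Z'`. -/
theorem inc_projection_preserves_maximal_minors
    (k n : ℕ) (hn : k + 5 ≤ n + 1)
    (Z : Matrix (Fin (n + 1)) (Fin (k + 5)) ℝ)
    (i : Fin (n + 1)) (j : Fin (k + 5)) (hZij : Z i j ≠ 0)
    (q₀ : Fin (k + 5)) (hq₀ : q₀ ≠ j)
    (Z' : Matrix (Fin n) (Fin (k + 4)) ℝ)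
    (hZ' : ∀ (p : Fin n) (q : Fin (k + 4)),
      Z' p q =
        (-1 : ℝ) ^ ((if i.succAbove p < i then 1 else 0) +
            (if j.succAbove q < j then 1 else 0)) *
          (Z (i.succAbove p) (j.succAbove q) -
            Z i (j.succAbove q) * Z (i.succAbove p) j / Z i j) *
          (if j.succAbove q = q₀ then Z i j else 1)) :
    (∀ J : Finset (Fin n), J.card = k + 4 →
        rowMinor Z (insert i (J.image i.succAbove)) = rowMinor Z' J) ∧
    (IsPositiveMatrix Z → IsPositiveMatrix Z') := by
  have hminor (J : Finset (Fin n)) (hJ : J.card = k + 4) :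
      rowMinor Z (insert i (J.image i.succAbove)) = rowMinor Z' J := by
    have hS : (insert i (J.image i.succAbove)).card = k + 5 := by
      rw [card_insert_image_succAbove, hJ]
    obtain ⟨a, ha, hfg⟩ := exists_orderEmbOfFin_insert_image_succAbove i J hJ hS
    rw [rowMinor_eq_det_orderEmbOfFin Z _ hS, rowMinor_eq_det_orderEmbOfFin Z' J hJ]
    exact det_submatrix_eq_det_projection Z i j hZij q₀ hq₀ Z' hZ'
      (OrderEmbedding.strictMono _) ha hfg
  refine ⟨hminor, fun hZ g hg => ?_⟩
  have hJ : (Finset.univ.image g).card = k + 4 := by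
    simp [Finset.card_image_of_injective _ hg.injective]
  have hS : (insert i ((Finset.univ.image g).image i.succAbove)).card = k + 5 := by
    rw [card_insert_image_succAbove, hJ]
  have hgJ : g = (Finset.univ.image g).orderEmbOfFin hJ :=
    Finset.orderEmbOfFin_unique hJ (by simp) hg
  rw [hgJ, ← rowMinor_eq_det_orderEmbOfFin, ← hminor _ hJ, rowMinor_eq_det_orderEmbOfFin Z _ hS]
  exact hZ _ (OrderEmbedding.strictMono _)

end
end
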